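/- arXiv:1210.3786 — 6 statements merged into one kernel-verified Lean document; each statement's English description precedes it below -/
import Mathlib

section
/- Let p ≥ 1 and for j = 1,…,p let (λ^{(j)}_k)_{k≥1} be a nondecreasing sequence of positive real numbers tending to infinity, with counting function N_j(λ) = #{k ∈ ℕ_{≥1} : λ^{(j)}_k ≤ λ}. Suppose there exist real numbers 0 ≤ τ < α, an integer 1 ≤ ν ≤ p, and distinct indices j_1,…,j_ν ∈ {1,…,p} such that N_{j_q}(λ) ~ A_{j_q} λ^α as λ → ∞ with constants A_{j_q} > 0 for q = 1,…,ν, and N_j(λ) = O(λ^τ) as λ → ∞ for every j ∉ {j_1,…,j_ν}. Then for each j ∉ {j_1,…,j_ν} the series Σ_{k=1}^∞ (λ^{(j)}_k)^{-α} converges, and the product counting function N(λ) = #{(k_1,…,k_p) ∈ ℕ_{≥1}^p : λ^{(1)}_{k_1} λ^{(2)}_{k_2} ⋯ λ^{(p)}_{k_p} ≤ λ} satisfies N(λ) ~ A λ^α (α log λ)^{ν−1}/(ν−1)! as λ → ∞, where A = (∏_{q=1}^ν A_{j_q}) · ∏_{j ∉ {j_1,…,j_ν}} (Σ_{k=1}^∞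 (λ^{(j)}_k)^{-α}). -/
open Filter Asymptotics Real

/-- The counting function of a sequence of reals: `N(x) = #{k : f k ≤ x}`. -/
noncomputable def countingFn (f : ℕ → ℝ) (x : ℝ) : ℝ :=
  Nat.card {k : ℕ | f k ≤ x}

/-- The counting function of products of `p` sequences:
`N(x) = #{(k₁,…,k_p) : f 1 k₁ ⋯ f p k_p ≤ x}`. -/
noncomputable def prodCountingFn {p : ℕ} (f : Fin p → ℕ → ℝ) (x : ℝ) : ℝ :=
  Nat.card {k : Fin p → ℕ | ∏ j, f j (k j) ≤ x}

open Topology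


noncomputable def gcnt {ι : Type*} (w : ι → ℝ) (x : ℝ) : ℝ := Nat.card {i | w i ≤ x}

structure Good {ι : Type*} (w : ι → ℝ) (c : ℝ) : Prop where
  pos : 0 < c
  le : ∀ i, c ≤ w i
  fin : ∀ x, {i | w i ≤ x}.Finite

lemma Good.wpos {ι : Type*} {w : ι → ℝ} {c : ℝ} (h : Good w c) (i : ι) : 0 < w i :=
  h.pos.trans_le (h.le i)

lemma gcnt_nonneg {ι : Type*} (w : ι → ℝ) (x : ℝ) : 0 ≤ gcnt w x := Nat.cast_nonneg _

lemma gcnt_equiv {ι κ : Type*} (e : ι ≃ κ) (w : κ → ℝ) (x : ℝ) :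
    gcnt (fun i => w (e i)) x = gcnt w x := by
  unfold gcnt
  congr 1
  exact Nat.card_congr (e.subtypeEquiv (fun a => Iff.rfl))

lemma Good.mono {ι : Type*} {w : ι → ℝ} {c : ℝ} (h : Good w c) {x y : ℝ} (hxy : x ≤ y) :
    gcnt w x ≤ gcnt w y := by
  unfold gcnt
  exact_mod_cast Nat.card_mono (h.fin y) (fun i (hi : w i ≤ x) => hi.trans hxy)

lemma Good.zero {ι : Type*} {w : ι → ℝ} {c : ℝ} (h : Good w c) {x : ℝ} (hx : x < c) :
    gcnt w x = 0 := by
  unfold gcnt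
  have : {i | w i ≤ x} = ∅ := by
    ext i; simpa using hx.trans_le (h.le i)
  rw [this]; simp

lemma Good.prod {ι κ : Type*} {v : ι → ℝ} {w : κ → ℝ} {c d : ℝ} (hv : Good v c) (hw : Good w d) :
    Good (fun p : ι × κ => v p.1 * w p.2) (c * d) where
  pos := mul_pos hv.pos hw.pos
  le p := mul_le_mul (hv.le _) (hw.le _) hw.pos.le (hv.wpos _).le
  fin x := by
    refine ((hv.fin (x / d)).prod (hw.fin (x / c))).subset ?_
    rintro ⟨i, k⟩ (h : v i * w k ≤ x)
    constructor
    · show v i ≤ x / d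
      rw [le_div_iff₀ hw.pos]
      exact (mul_le_mul_of_nonneg_left (hw.le k) (hv.wpos i).le).trans h
    · show w k ≤ x / c
      rw [le_div_iff₀ hv.pos, mul_comm]
      exact (mul_le_mul_of_nonneg_right (hv.le i) (hw.wpos k).le).trans h

lemma Good.equiv {ι κ : Type*} {w : κ → ℝ} {c : ℝ} (h : Good w c) (e : ι ≃ κ) :
    Good (fun i => w (e i)) c where
  pos := h.pos
  le i := h.le _
  fin x := (h.fin x).preimage e.injective.injOn

lemma gcnt_zero_of {ι κ : Type*} {v : ι → ℝ} {w : κ → ℝ} {c d : ℝ} (hv : Good v c)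
    (hw : Good w d) {x : ℝ} {i : ι} (hi : x / d < v i) : gcnt w (x / v i) = 0 := by
  apply hw.zero
  rw [div_lt_iff₀ (hv.wpos i)]
  rwa [div_lt_iff₀ hw.pos, mul_comm] at hi

lemma gcnt_prod {ι κ : Type*} {v : ι → ℝ} {w : κ → ℝ} {c d : ℝ} (hv : Good v c) (hw : Good w d)
    (x : ℝ) : gcnt (fun p : ι × κ => v p.1 * w p.2) x = ∑' i, gcnt w (x / v i) := by
  classical
  have hf := (hv.prod hw).fin x
  have h1 : ∑' i, gcnt w (x / v i) = ∑ i ∈ (hv.fin (x / d)).toFinset, gcnt w (x / v i) := by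
    apply tsum_eq_sum
    intro i hi
    simp only [Set.Finite.mem_toFinset, Set.mem_ofPred_eq, not_le] at hi
    exact gcnt_zero_of hv hw hi
  rw [h1]
  unfold gcnt
  rw [Nat.card_coe_set_eq, Set.ncard_eq_toFinset_card _ hf,
    Finset.card_eq_sum_card_fiberwise (f := Prod.fst) (t := (hv.fin (x / d)).toFinset)]
  · push_cast
    refine Finset.sum_congr rfl fun i hi => ?_
    rw [Nat.card_coe_set_eq, Set.ncard_eq_toFinset_card _ (hw.fin _)]
    congr 1
    symm
    apply Finset.card_bij (fun k _ => (i, k))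
    · intro k hk
      simp only [Set.Finite.mem_toFinset, Set.mem_ofPred_eq, Finset.mem_filter, and_true] at hk ⊢
      rwa [le_div_iff₀ (hv.wpos i), mul_comm] at hk
    · intro a _ b _ h
      simpa using h
    · rintro ⟨i', k⟩ hk
      simp only [Set.Finite.mem_toFinset, Set.mem_ofPred_eq, Finset.mem_filter] at hk
      obtain ⟨hk, rfl⟩ := hk
      refine ⟨k, ?_, rfl⟩
      simp only [Set.Finite.mem_toFinset, Set.mem_ofPred_eq]
      rwa [le_div_iff₀ (hv.wpos _), mul_comm]
  · rintro ⟨i, k⟩ h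
    simp only [Set.Finite.coe_toFinset, Set.mem_ofPred_eq] at h ⊢
    rw [le_div_iff₀ hw.pos]
    exact (mul_le_mul_of_nonneg_left (hw.le k) (hv.wpos i).le).trans h

/-- uniform bound -/
lemma unif_bound {κ : Type*} {w : κ → ℝ} {d : ℝ} (hw : Good w d) {α B : ℝ} (hα : 0 < α) {m : ℕ}
    (h : Tendsto (fun x => gcnt w x / (x ^ α * (log x) ^ m)) atTop (𝓝 B)) {K : ℝ} (hK : 0 < K) :
    ∃ C, 0 < C ∧ ∀ᶠ x in atTop, ∀ y, 0 < y → y ≤ K * x →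
      gcnt w y ≤ C * (y ^ α * (log x) ^ m) := by
  have hB : 0 ≤ B := by
    refine ge_of_tendsto h ?_
    filter_upwards [eventually_ge_atTop 1] with x hx
    have := log_nonneg hx
    have := gcnt_nonneg w x
    positivity
  have h2 : ∀ᶠ x in atTop, gcnt w x / (x ^ α * (log x) ^ m) < B + 1 :=
    h.eventually (gt_mem_nhds (by linarith))
  obtain ⟨X, hX⟩ := (h2.and (eventually_ge_atTop (exp 1))).exists_forall_of_atTop
  refine ⟨(B + 1) * 2 ^ m + gcnt w X * d ^ (-α), ?_, ?_⟩
  · have := gcnt_nonneg w X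
    have := hw.pos
    positivity
  filter_upwards [eventually_ge_atTop (exp 1), eventually_ge_atTop K] with x hx hxK y hy hyx
  have hx0 : 0 < x := (exp_pos 1).trans_le hx
  have hlx : 1 ≤ log x := by rwa [le_log_iff_exp_le hx0]
  have hlm : 1 ≤ log x ^ m := one_le_pow₀ hlx
  have hd := hw.pos
  have hyα : 0 < y ^ α := rpow_pos_of_pos hy _
  have hg := gcnt_nonneg w X
  rw [add_mul]
  rcases le_total X y with hXy | hXy
  · obtain ⟨h3, h4⟩ := hX y hXy
    have hly : 1 ≤ log y := by rwa [le_log_iff_exp_le hy]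
    have hlyx : log y ≤ 2 * log x := by
      have h5 : log y ≤ log (K * x) := log_le_log hy hyx
      rw [log_mul hK.ne' hx0.ne'] at h5
      have : log K ≤ log x := log_le_log hK hxK
      linarith
    rw [div_lt_iff₀ (by positivity)] at h3
    have : (B + 1) * (y ^ α * log y ^ m) ≤ (B + 1) * (y ^ α * (2 * log x) ^ m) := by gcongr
    rw [mul_pow] at this
    have h6 : 0 ≤ gcnt w X * d ^ (-α) * (y ^ α * log x ^ m) := by positivity
    calc _ ≤ _ := h3.le
      _ ≤ _ := this
      _ = (B + 1) * 2 ^ m * (y ^ α * log x ^ m) := by ring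
      _ ≤ _ := by linarith
  · have h6 : 0 ≤ (B + 1) * 2 ^ m * (y ^ α * log x ^ m) := by positivity
    rcases lt_or_ge y d with hyd | hyd
    · rw [hw.zero hyd]; positivity
    · have h7 : 1 ≤ d ^ (-α) * y ^ α := by
        rw [rpow_neg hd.le, inv_mul_eq_div, one_le_div (by positivity)]
        exact rpow_le_rpow hd.le hyd hα.le
      have h8 : 1 ≤ d ^ (-α) * y ^ α * log x ^ m := by nlinarith
      calc gcnt w y ≤ gcnt w X := hw.mono hXy
        _ ≤ gcnt w X * (d ^ (-α) * y ^ α * log x ^ m) := le_mul_of_one_le_right hg h8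
        _ = gcnt w X * d ^ (-α) * (y ^ α * log x ^ m) := by ring
        _ ≤ _ := by linarith

lemma lemA {ι κ : Type*} {v : ι → ℝ} {w : κ → ℝ} {c d : ℝ} (hv : Good v c)
    (hw : Good w d) {α B S : ℝ} (hα : 0 < α) {m : ℕ}
    (h : Tendsto (fun x => gcnt w x / (x ^ α * (log x) ^ m)) atTop (𝓝 B))
    (hS : HasSum (fun i => v i ^ (-α)) S) :
    Tendsto (fun x => gcnt (fun p : ι × κ => v p.1 * w p.2) x / (x ^ α * (log x) ^ m)) atTop
      (𝓝 (S * B)) := by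
  simp_rw [gcnt_prod hv hw, ← tsum_div_const, ← hS.tsum_eq, ← tsum_mul_right]
  obtain ⟨C, hC, hb⟩ := unif_bound hw hα h (K := 1 / c) (by have := hv.pos; positivity)
  refine tendsto_tsum_of_dominated_convergence (bound := fun i => C * v i ^ (-α))
    (hS.summable.mul_left C) ?_ ?_
  · intro i
    have hvi := hv.wpos i
    have h1 : Tendsto (fun x : ℝ => x / v i) atTop atTop := tendsto_id.atTop_div_const hvi
    have h2 : Tendsto (fun x : ℝ => log (x / v i) / log x) atTop (𝓝 1) := by
      have h3 : Tendsto (fun x : ℝ => 1 - log (v i) / log x) atTop (𝓝 (1 - 0)) :=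
        tendsto_const_nhds.sub (tendsto_log_atTop.const_div_atTop _)
      rw [sub_zero] at h3
      refine h3.congr' ?_
      filter_upwards [eventually_gt_atTop 1] with x hx
      have := log_pos hx
      rw [log_div (by linarith) hvi.ne']
      field_simp
    have h4 := ((h.comp h1).mul ((h2.pow m).const_mul (v i ^ (-α))))
    rw [one_pow, mul_one, mul_comm] at h4
    refine h4.congr' ?_
    filter_upwards [eventually_gt_atTop 1, h1.eventually_gt_atTop 1] with x hx hxv
    have := log_pos hx
    have := log_pos hxv
    have hx0 : 0 < x := by linarith
    simp only [Function.comp]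
    rw [div_rpow hx0.le hvi.le, rpow_neg hvi.le, div_pow]
    have := rpow_pos_of_pos hvi α
    have := rpow_pos_of_pos hx0 α
    field_simp
  · filter_upwards [hb, eventually_gt_atTop 1] with x hx hx1 i
    have hvi := hv.wpos i
    have hx0 : 0 < x := by linarith
    have h1 := hx (x / v i) (by positivity) (by
      rw [div_mul_eq_mul_div, one_mul]
      exact div_le_div_of_nonneg_left hx0.le hv.pos (hv.le i))
    have := log_pos hx1
    have := rpow_pos_of_pos hx0 α
    rw [Real.norm_of_nonneg (div_nonneg (gcnt_nonneg _ _) (by positivity)),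
      div_le_iff₀ (by positivity)]
    refine h1.trans (le_of_eq ?_)
    rw [div_rpow hx0.le hvi.le, rpow_neg hvi.le]
    ring

lemma seq_good {v : ℕ → ℝ} (hm : Monotone v) (hp : ∀ k, 0 < v k) (ht : Tendsto v atTop atTop) :
    Good v (v 0) where
  pos := hp 0
  le i := hm (Nat.zero_le i)
  fin x := by
    obtain ⟨K, hK⟩ := (ht.eventually_gt_atTop x).exists_forall_of_atTop
    refine (Set.finite_Iio K).subset fun k (hk : v k ≤ x) => ?_
    by_contra h
    exact absurd (hK k (not_lt.1 h)) (not_lt.2 hk)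

lemma cnt_ge {v : ℕ → ℝ} {c : ℝ} (hg : Good v c) (hm : Monotone v) (k : ℕ) :
    (k : ℝ) + 1 ≤ gcnt v (v k) := by
  unfold gcnt
  have h := Nat.card_mono (hg.fin (v k)) (s := Set.Iic k) (fun i (hi : i ≤ k) => hm hi)
  have h2 : Nat.card (Set.Iic k) = k + 1 := by simp
  rw [h2] at h
  exact_mod_cast h

lemma cnt_le {v : ℕ → ℝ} (hm : Monotone v) {k : ℕ} {y : ℝ} (hy : y < v k) :
    gcnt v y ≤ k := by
  unfold gcnt
  have h := Nat.card_mono (Set.finite_Iio k) (s := {i | v i ≤ y}) (fun i (hi : v i ≤ y) => by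
    by_contra h
    have := hm (not_lt.1 h)
    linarith)
  have h2 : Nat.card (Set.Iio k) = k := by simp
  rw [h2] at h
  exact_mod_cast h

lemma seq_asymp {v : ℕ → ℝ} (hm : Monotone v) (hp : ∀ k, 0 < v k) (ht : Tendsto v atTop atTop)
    {α A : ℝ} (h : Tendsto (fun x => gcnt v x / x ^ α) atTop (𝓝 A)) :
    Tendsto (fun k : ℕ => ((k : ℝ) + 1) * v k ^ (-α)) atTop (𝓝 A) := by
  have hg := seq_good hm hp ht
  have hθ : Tendsto (fun k : ℕ => 1 - 1 / ((k : ℝ) + 1)) atTop (𝓝 1) := by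
    simpa using (tendsto_const_nhds (x := (1 : ℝ))).sub
      (tendsto_one_div_add_atTop_nhds_zero_nat (𝕜 := ℝ))
  have hθα : Tendsto (fun k : ℕ => (1 - 1 / ((k : ℝ) + 1)) ^ α) atTop (𝓝 1) := by
    have := hθ.rpow_const (p := α) (Or.inl one_ne_zero)
    simpa using this
  have hθv : Tendsto (fun k : ℕ => (1 - 1 / ((k : ℝ) + 1)) * v k) atTop atTop :=
    hθ.pos_mul_atTop one_pos ht
  have hlow := hθα.mul (h.comp hθv)
  rw [one_mul] at hlow
  refine tendsto_of_tendsto_of_tendsto_of_le_of_le' hlow (h.comp ht) ?_ ?_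
  · filter_upwards [eventually_gt_atTop 0] with k hk
    have hv := hp k
    have hk' : (0 : ℝ) < k := by exact_mod_cast hk
    have hθ0 : 0 < 1 - 1 / ((k : ℝ) + 1) := by
      rw [sub_pos, div_lt_one (by positivity)]; linarith
    have hlt : (1 - 1 / ((k : ℝ) + 1)) * v k < v k := by
      have : 0 < 1 / ((k : ℝ) + 1) := by positivity
      nlinarith
    have := cnt_le hm hlt
    simp only [Function.comp]
    rw [mul_rpow hθ0.le hv.le, rpow_neg hv.le, ← div_eq_mul_inv]
    have h1 := rpow_pos_of_pos hθ0 α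
    have h2 := rpow_pos_of_pos hv α
    rw [← mul_div_assoc, mul_div_mul_left _ _ h1.ne']
    gcongr
    linarith
  · filter_upwards with k
    have hv := hp k
    have h2 := rpow_pos_of_pos hv α
    simp only [Function.comp]
    rw [rpow_neg hv.le, ← div_eq_mul_inv]
    gcongr
    exact cnt_ge hg hm k

open MeasureTheory in
lemma tsum_eq_integral {h : ℕ → ℝ} {K : ℕ} (hK : ∀ k, K ≤ k → h k = 0) {c : ℝ} (hc : 0 < c) :
    ∑' k, h k = ∫ s in Set.Ioi (0 : ℝ), c * exp (c * s) * h (⌊exp (c * s)⌋₊ - 1) := by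
  have himg : (fun s => exp (c * s)) '' Set.Ioi (0 : ℝ) = Set.Ioi 1 := by
    ext t
    constructor
    · rintro ⟨s, hs, rfl⟩
      have hs : 0 < s := hs
      simp only [Set.mem_Ioi, one_lt_exp_iff]
      positivity
    · intro ht
      have ht : 1 < t := ht
      refine ⟨log t / c, div_pos (log_pos ht) hc, ?_⟩
      simp only
      rw [mul_div_cancel₀ _ hc.ne', exp_log (by linarith)]
  have hd : ∀ s ∈ Set.Ioi (0 : ℝ), HasDerivWithinAt (fun s => exp (c * s)) (c * exp (c * s))
      (Set.Ioi 0) s := by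
    intro s _
    have := ((hasDerivAt_id s).const_mul c).exp
    simp only [id, mul_one] at this
    rw [mul_comm] at this
    exact this.hasDerivWithinAt
  have hinj : Set.InjOn (fun s => exp (c * s)) (Set.Ioi (0 : ℝ)) := by
    intro a _ b _ hab
    simpa [hc.ne'] using hab
  have h1 := integral_image_eq_integral_abs_deriv_smul measurableSet_Ioi hd hinj
    (fun t => h (⌊t⌋₊ - 1))
  rw [himg] at h1
  have h2 : ∫ s in Set.Ioi (0 : ℝ), c * exp (c * s) * h (⌊exp (c * s)⌋₊ - 1) =
      ∫ t in Set.Ioi (1 : ℝ), h (⌊t⌋₊ - 1) := by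
    rw [h1]
    congr 1
    ext s
    rw [abs_of_pos (by positivity), smul_eq_mul]
  rw [h2, tsum_eq_sum (s := Finset.range K) (fun k hk => hK k (by simpa using hk))]
  have h3 : ∫ t in Set.Ioi (1 : ℝ), h (⌊t⌋₊ - 1) = ∫ t in Set.Ici (1 : ℝ), h (⌊t⌋₊ - 1) :=
    (integral_Ici_eq_integral_Ioi).symm
  have h4 : ∀ t ∈ Set.Ici (1 : ℝ), h (⌊t⌋₊ - 1) = ∑ k ∈ Finset.range K,
      (Set.Ico ((k : ℝ) + 1) (k + 2)).indicator (fun _ => h k) t := by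
    intro t ht
    have ht : 1 ≤ t := ht
    have hf : 1 ≤ ⌊t⌋₊ := by rwa [Nat.one_le_floor_iff]
    obtain ⟨n, hn⟩ : ∃ n, ⌊t⌋₊ = n + 1 := ⟨⌊t⌋₊ - 1, by omega⟩
    have hn' := (Nat.floor_eq_iff (by linarith : 0 ≤ t)).1 hn
    push_cast at hn'
    rw [hn, Nat.add_sub_cancel]
    have key : ∀ k : ℕ, t ∈ Set.Ico ((k : ℝ) + 1) (k + 2) ↔ k = n := by
      intro k
      constructor
      · rintro ⟨a, b⟩
        have e1 : (k : ℝ) < n + 1 := by linarith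
        have e2 : (n : ℝ) < k + 1 := by linarith
        have e1 : k < n + 1 := by exact_mod_cast e1
        have e2 : n < k + 1 := by exact_mod_cast e2
        omega
      · rintro rfl
        exact ⟨hn'.1, by linarith [hn'.2]⟩
    simp only [Set.indicator_apply, key]
    rw [Finset.sum_ite_eq' (Finset.range K) n]
    split_ifs with hh
    · rfl
    · exact hK n (by simpa using hh)
  rw [h3, setIntegral_congr_fun measurableSet_Ici h4, integral_finsetSum]
  · refine Finset.sum_congr rfl fun k _ => ?_
    rw [setIntegral_indicator measurableSet_Ico, setIntegral_const]
    have : Set.Ici (1 : ℝ) ∩ Set.Ico ((k : ℝ) + 1) (k + 2) = Set.Ico ((k : ℝ) + 1) (k + 2) := by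
      apply Set.inter_eq_right.2
      rintro t ⟨ht, _⟩
      have : (0 : ℝ) ≤ k := Nat.cast_nonneg k
      show 1 ≤ t
      linarith
    rw [this, Real.volume_real_Ico_of_le (by linarith)]
    simp
    ring
  · intro k _
    apply IntegrableOn.integrable
    rw [integrableOn_indicator_iff measurableSet_Ico] 
    refine (integrableOn_const (by simp)).mono_set Set.inter_subset_left

open MeasureTheory in
lemma lemB {κ : Type*} {v : ℕ → ℝ} {w : κ → ℝ} {d : ℝ} (hm : Monotone v) (hp : ∀ k, 0 < v k)
    (ht : Tendsto v atTop atTop) (hw : Good w d) {α A B : ℝ} (hα : 0 < α) (hA : 0 < A) {m : ℕ}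
    (hv : Tendsto (fun x => gcnt v x / x ^ α) atTop (𝓝 A))
    (h : Tendsto (fun x => gcnt w x / (x ^ α * (log x) ^ m)) atTop (𝓝 B)) :
    Tendsto (fun x => gcnt (fun p : ℕ × κ => v p.1 * w p.2) x / (x ^ α * (log x) ^ (m + 1))) atTop
      (𝓝 (α * A * B / (m + 1))) := by
  have hg := seq_good hm hp ht
  have hasy := seq_asymp hm hp ht hv
  set k : ℝ → ℝ → ℕ := fun x s => ⌊exp (α * log x * s)⌋₊ - 1 with hk
  set F : ℝ → ℝ → ℝ := fun x s => (α * log x) * exp (α * log x * s) *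
    (gcnt w (x / v (k x s)) / (x ^ α * (log x) ^ (m + 1))) with hF
  have hsum : ∀ᶠ x in atTop, ∫ s in Set.Ioi (0 : ℝ), F x s =
      gcnt (fun p : ℕ × κ => v p.1 * w p.2) x / (x ^ α * (log x) ^ (m + 1)) := by
    filter_upwards [eventually_gt_atTop 1] with x hx
    have hL := log_pos hx
    rw [gcnt_prod hg hw, ← tsum_div_const]
    obtain ⟨K, hK⟩ := (ht.eventually_gt_atTop (x / d)).exists_forall_of_atTop
    rw [tsum_eq_integral (K := K) (c := α * log x) _ (by positivity)]
    intro n hn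
    rw [gcnt_zero_of hg hw (hK n hn), zero_div]
  obtain ⟨C2, hC2⟩ := hasy.bddAbove_range
  have hC2' : ∀ n : ℕ, ((n : ℝ) + 1) * v n ^ (-α) ≤ C2 := fun n => hC2 ⟨n, rfl⟩
  have hC2pos : 0 < C2 := lt_of_lt_of_le (by have := rpow_pos_of_pos (hp 0) (-α); positivity)
    (hC2' 0)
  have hfl : ∀ x s : ℝ, 1 ≤ exp (α * log x * s) →
      ((k x s : ℝ) + 1) = (⌊exp (α * log x * s)⌋₊ : ℝ) := by
    intro x s h1
    have hf : 1 ≤ ⌊exp (α * log x * s)⌋₊ := by rwa [Nat.one_le_floor_iff]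
    have : k x s + 1 = ⌊exp (α * log x * s)⌋₊ := by simp only [hk]; omega
    exact_mod_cast this
  have hE : ∀ x s : ℝ, 1 ≤ exp (α * log x * s) →
      exp (α * log x * s) * v (k x s) ^ (-α) ≤ 2 * C2 := by
    intro x s h1
    have h2 := hfl x s h1
    have h3 := Nat.lt_floor_add_one (exp (α * log x * s))
    have h4 : (0 : ℝ) ≤ k x s := Nat.cast_nonneg _
    have h5 := rpow_pos_of_pos (hp (k x s)) (-α)
    have h6 : exp (α * log x * s) ≤ 2 * ((k x s : ℝ) + 1) := by linarith
    calc _ ≤ 2 * ((k x s : ℝ) + 1) * v (k x s) ^ (-α) := by gcongr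
      _ = 2 * (((k x s : ℝ) + 1) * v (k x s) ^ (-α)) := by ring
      _ ≤ _ := by linarith [hC2' (k x s)]
  have hFeq : ∀ x s : ℝ, 1 < x → F x s = α * (exp (α * log x * s) * v (k x s) ^ (-α)) *
      (gcnt w (x / v (k x s)) / ((x / v (k x s)) ^ α * (log x) ^ m)) := by
    intro x s hx
    have hL := log_pos hx
    have hx0 : 0 < x := by linarith
    have hvk := hp (k x s)
    have h1 := rpow_pos_of_pos hx0 α
    have h2 := rpow_pos_of_pos hvk α
    simp only [hF]
    rw [div_rpow hx0.le hvk.le, rpow_neg hvk.le, pow_succ]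
    field_simp
  obtain ⟨C, hC, hb⟩ := unif_bound hw hα h (K := 1 / v 0) (by have := hp 0; positivity)
  have hlim : ∀ s : ℝ, 0 < s → s ≠ 1 → Tendsto (fun x => F x s) atTop
      (𝓝 ((Set.Iio 1).indicator (fun s => α * A * B * (1 - s) ^ m) s)) := by
    intro s hs hs1
    have hexp : Tendsto (fun x => exp (α * log x * s)) atTop atTop := by
      refine tendsto_exp_atTop.comp ?_
      exact (tendsto_log_atTop.const_mul_atTop hα).atTop_mul_const hs
    have hkt : Tendsto (fun x => k x s) atTop atTop :=
      (tendsto_sub_atTop_nat 1).comp (tendsto_nat_floor_atTop.comp hexp)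
    have hE1 : Tendsto (fun x => exp (α * log x * s) * v (k x s) ^ (-α)) atTop (𝓝 A) := by
      have e1 := (hasy.comp hkt).div ((tendsto_nat_floor_div_atTop (R := ℝ)).comp hexp)
        one_ne_zero
      rw [div_one] at e1
      refine e1.congr' ?_
      filter_upwards [hexp.eventually_ge_atTop 1] with x hx
      have h2 := hfl x s hx
      have h4 : (0 : ℝ) ≤ k x s := Nat.cast_nonneg _
      simp only [Pi.div_apply, Function.comp]
      rw [← h2]
      have : (k x s : ℝ) + 1 ≠ 0 := by positivity
      field_simp
    have hlogv : Tendsto (fun x => log (x / v (k x s)) / log x) atTop (𝓝 (1 - s)) := by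
      have e1 : Tendsto (fun x => (1 - s) +
          (log (exp (α * log x * s) * v (k x s) ^ (-α)) / α) / log x) atTop (𝓝 ((1 - s) + 0)) :=
        tendsto_const_nhds.add (((hE1.log hA.ne').div_const α).div_atTop tendsto_log_atTop)
      rw [add_zero] at e1
      refine e1.congr' ?_
      filter_upwards [eventually_gt_atTop 1] with x hx
      have hL := log_pos hx
      have hvk := hp (k x s)
      rw [log_mul (exp_pos _).ne' (rpow_pos_of_pos hvk _).ne', log_exp, log_rpow hvk,
        log_div (by linarith) hvk.ne']
      field_simp
      ring
    rcases lt_or_gt_of_ne hs1 with hs1 | hs1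
    · rw [Set.indicator_of_mem (show s ∈ Set.Iio 1 from hs1)]
      have hlogy : Tendsto (fun x => log (x / v (k x s))) atTop atTop := by
        refine (hlogv.pos_mul_atTop (by linarith) tendsto_log_atTop).congr' ?_
        filter_upwards [eventually_gt_atTop 1] with x hx
        have hL := log_pos hx
        field_simp
      have hy : Tendsto (fun x => x / v (k x s)) atTop atTop := by
        refine (tendsto_exp_atTop.comp hlogy).congr' ?_
        filter_upwards [eventually_gt_atTop 1] with x hx
        have hvk := hp (k x s)
        exact exp_log (by positivity)
      have e2 := ((hE1.const_mul α).mul (h.comp hy)).mul (hlogv.pow m)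
      refine e2.congr' ?_
      filter_upwards [eventually_gt_atTop 1, hlogy.eventually_gt_atTop 0] with x hx hxy
      rw [hFeq x s hx]
      have hL := log_pos hx
      have hvk := hp (k x s)
      have := rpow_pos_of_pos (show 0 < x / v (k x s) by positivity) α
      simp only [Function.comp]
      rw [div_pow]
      field_simp
    · rw [Set.indicator_of_notMem (by simpa using hs1.le)]
      have hlogy : Tendsto (fun x => log (x / v (k x s))) atTop atBot := by
        refine (hlogv.neg_mul_atTop (by linarith) tendsto_log_atTop).congr' ?_
        filter_upwards [eventually_gt_atTop 1] with x hx
        have hL := log_pos hx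
        field_simp
      refine tendsto_const_nhds.congr' ?_
      filter_upwards [eventually_gt_atTop 1, hlogy.eventually_lt_atBot (log d)] with x hx hxy
      have hvk := hp (k x s)
      have : x / v (k x s) < d := (log_lt_log_iff (by positivity) hw.pos).1 hxy
      simp only [hF]
      rw [hw.zero this]
      simp
  have hbound : ∀ᶠ x in atTop, ∀ s ∈ Set.Ioi (0 : ℝ),
      ‖F x s‖ ≤ (Set.Iic 2).indicator (fun _ => α * (2 * C2) * C) s := by
    filter_upwards [hb, eventually_gt_atTop 1,
      tendsto_log_atTop.eventually_gt_atTop (log (2 * C2) / α - log d)] with x hx hx1 hx2 s hs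
    have hs : 0 < s := hs
    have hL := log_pos hx1
    have hx0 : 0 < x := by linarith
    have hvk := hp (k x s)
    have he : 1 ≤ exp (α * log x * s) := one_le_exp (by positivity)
    have hee := hE x s he
    have hy : 0 < x / v (k x s) := by positivity
    by_cases hs2 : s ≤ 2
    · rw [Set.indicator_of_mem (show s ∈ Set.Iic 2 from hs2), hFeq x s hx1]
      have h1 := hx (x / v (k x s)) hy (by
        rw [div_mul_eq_mul_div, one_mul]
        exact div_le_div_of_nonneg_left hx0.le (hp 0) (hm (Nat.zero_le _)))
      have h2 := rpow_pos_of_pos hy α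
      have h3 : gcnt w (x / v (k x s)) / ((x / v (k x s)) ^ α * log x ^ m) ≤ C := by
        rw [div_le_iff₀ (by positivity)]
        exact h1
      have h4 : 0 ≤ gcnt w (x / v (k x s)) / ((x / v (k x s)) ^ α * log x ^ m) :=
        div_nonneg (gcnt_nonneg _ _) (by positivity)
      have h5 := rpow_pos_of_pos hvk (-α)
      rw [Real.norm_of_nonneg (by positivity)]
      gcongr
    · rw [Set.indicator_of_notMem (by simpa using hs2)]
      have hs2 : 2 < s := not_le.1 hs2
      have : x / v (k x s) < d := by
        rw [← log_lt_log_iff hy hw.pos, log_div hx0.ne' hvk.ne']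
        have h6 := log_le_log (mul_pos (exp_pos _) (rpow_pos_of_pos hvk (-α))) hee
        rw [log_mul (exp_pos _).ne' (rpow_pos_of_pos hvk _).ne', log_exp, log_rpow hvk] at h6
        have h7 : log x * s - log (v (k x s)) ≤ log (2 * C2) / α := by
          rw [le_div_iff₀ hα]; linarith
        nlinarith
      simp only [hF]
      rw [hw.zero this]
      simp
  have hDCT : Tendsto (fun x => ∫ s in Set.Ioi (0 : ℝ), F x s) atTop
      (𝓝 (∫ s in Set.Ioi (0 : ℝ), (Set.Iio 1).indicator (fun s => α * A * B * (1 - s) ^ m) s)) := by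
    refine tendsto_integral_filter_of_dominated_convergence
      ((Set.Iic 2).indicator (fun _ => α * (2 * C2) * C)) ?_ ?_ ?_ ?_
    · refine Eventually.of_forall fun x => Measurable.aestronglyMeasurable ?_
      have e1 : Measurable (fun s : ℝ => exp (α * log x * s)) := by fun_prop
      have e2 : Measurable (fun s : ℝ => ⌊exp (α * log x * s)⌋₊) := Nat.measurable_floor.comp e1
      have e3 : Measurable (fun n : ℕ => gcnt w (x / v (n - 1)) / (x ^ α * (log x) ^ (m + 1))) :=
        measurable_from_nat
      exact (e1.const_mul _).mul (e3.comp e2)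
    · filter_upwards [hbound] with x hx
      exact (ae_restrict_iff' measurableSet_Ioi).2 (Eventually.of_forall hx)
    · apply IntegrableOn.integrable
      rw [integrableOn_indicator_iff measurableSet_Iic]
      refine integrableOn_const ?_
      rw [Set.inter_comm, Set.Ioi_inter_Iic]
      simp
    · rw [ae_restrict_iff' measurableSet_Ioi]
      have : ∀ᵐ s : ℝ, s ≠ 1 := by simp [ae_iff]
      filter_upwards [this] with s hs1 hs
      exact hlim s hs hs1
  have hint : ∫ s in Set.Ioi (0 : ℝ), (Set.Iio 1).indicator (fun s => α * A * B * (1 - s) ^ m) s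
      = α * A * B / (m + 1) := by
    rw [setIntegral_indicator measurableSet_Iio, Set.Ioi_inter_Iio, ← integral_Ioc_eq_integral_Ioo,
      ← intervalIntegral.integral_of_le zero_le_one, intervalIntegral.integral_const_mul,
      intervalIntegral.integral_comp_sub_left (fun s => s ^ m) 1, integral_pow]
    simp
    ring
  rw [hint] at hDCT
  exact hDCT.congr' hsum

/-- The state of a weight: either the `-α` powers are summable (`n = 0`), or the counting function
has the `n - 1` log-power asymptotics. -/
def St {ι : Type*} (w : ι → ℝ) (α : ℝ) (n : ℕ) (c : ℝ) : Prop :=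
  match n with
  | 0 => HasSum (fun i => w i ^ (-α)) c
  | m + 1 => Tendsto (fun x => gcnt w x / (x ^ α * (log x) ^ m)) atTop
      (𝓝 (c * α ^ m / (Nat.factorial m)))

lemma St.equiv {ι κ : Type*} {w : κ → ℝ} {α c : ℝ} {n : ℕ} (e : ι ≃ κ) (h : St w α n c) :
    St (fun i => w (e i)) α n c := by
  cases n with
  | zero => exact e.hasSum_iff (f := fun i => w i ^ (-α)) |>.2 h
  | succ m =>
    simp only [St] at h ⊢
    simpa only [gcnt_equiv] using h

lemma St.cons_zero {κ : Type*} {v : ℕ → ℝ} {w : κ → ℝ} {α a b c d : ℝ} {n : ℕ} (hα : 0 < α)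
    (hv : Good v a) (hw : Good w b) (h1 : HasSum (fun i => v i ^ (-α)) c) (h2 : St w α n d) :
    St (fun p : ℕ × κ => v p.1 * w p.2) α n (c * d) := by
  cases n with
  | zero =>
    simp only [St] at h2 ⊢
    have h3 : ∀ p : ℕ × κ, (v p.1 * w p.2) ^ (-α) = v p.1 ^ (-α) * w p.2 ^ (-α) := fun p =>
      mul_rpow (hv.wpos _).le (hw.wpos _).le
    simp_rw [h3]
    exact h1.mul h2 (h1.summable.mul_of_nonneg h2.summable
      (fun i => (rpow_pos_of_pos (hv.wpos i) _).le) (fun i => (rpow_pos_of_pos (hw.wpos i) _).le))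
  | succ m =>
    simp only [St] at h2 ⊢
    have := lemA hv hw hα h2 h1
    convert this using 2
    ring

lemma St.cons_one {κ : Type*} {v : ℕ → ℝ} {w : κ → ℝ} {α b c d : ℝ} {n : ℕ} (hα : 0 < α)
    (hm : Monotone v) (hp : ∀ k, 0 < v k) (ht : Tendsto v atTop atTop)
    (hw : Good w b) (hc : 0 < c) (h1 : Tendsto (fun x => gcnt v x / x ^ α) atTop (𝓝 c))
    (h2 : St w α n d) :
    St (fun p : ℕ × κ => v p.1 * w p.2) α (n + 1) (c * d) := by
  cases n with
  | zero =>
    simp only [St] at h2 ⊢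
    have h3 := lemA (m := 0) hw (seq_good hm hp ht) hα (by simpa using h1) h2
    have h4 : ∀ x, gcnt (fun p : ℕ × κ => v p.1 * w p.2) x =
        gcnt (fun p : κ × ℕ => w p.1 * v p.2) x := by
      intro x
      rw [← gcnt_equiv (Equiv.prodComm ℕ κ)]
      congr 1
      ext p
      simp [mul_comm]
    simp_rw [h4]
    convert h3 using 2
    simp [mul_comm]
  | succ m =>
    simp only [St] at h2 ⊢
    have := lemB hm hp ht hw hα hc h1 h2
    convert this using 2
    rw [Nat.factorial_succ, pow_succ]
    push_cast
    have : (Nat.factorial m : ℝ) ≠ 0 := by positivity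
    field_simp

attribute [irreducible] St

set_option maxHeartbeats 1000000 in
lemma main_ind {α : ℝ} (hα : 0 < α) : ∀ (n : ℕ) (f : Fin n → ℕ → ℝ) (e : Fin n → ℕ)
    (c : Fin n → ℝ) (_ : ∀ j, Monotone (f j)) (_ : ∀ j k, 0 < f j k)
    (_ : ∀ j, Tendsto (f j) atTop atTop)
    (_ : ∀ j, (e j = 0 ∧ HasSum (fun k => f j k ^ (-α)) (c j)) ∨
      (e j = 1 ∧ 0 < c j ∧ Tendsto (fun x => gcnt (f j) x / x ^ α) atTop (𝓝 (c j)))),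
    (∃ d, Good (fun k : Fin n → ℕ => ∏ j, f j (k j)) d) ∧
      St (fun k : Fin n → ℕ => ∏ j, f j (k j)) α (∑ j, e j) (∏ j, c j) := by
  intro n
  induction n with
  | zero =>
    intro f e c _ _ _ _
    refine ⟨⟨1, one_pos, by simp, fun x => Set.toFinite _⟩, ?_⟩
    simp only [Finset.univ_eq_empty, Finset.sum_empty, Finset.prod_empty, St, one_rpow]
    simpa using hasSum_fintype (fun _ : Fin 0 → ℕ => (1 : ℝ))
  | succ n ih =>
    intro f e c hm hp ht hh
    obtain ⟨⟨d, hd⟩, hst⟩ := ih (fun j => f j.succ) (fun j => e j.succ) (fun j => c j.succ)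
      (fun j => hm _) (fun j => hp _) (fun j => ht _) (fun j => hh _)
    have hg := seq_good (hm 0) (hp 0) (ht 0)
    let E := (Fin.consEquiv (fun _ : Fin (n + 1) => ℕ)).symm
    have hEq : (fun k : Fin (n + 1) → ℕ => ∏ j, f j (k j)) = fun k =>
        (fun p : ℕ × (Fin n → ℕ) => f 0 p.1 * ∏ j : Fin n, f j.succ (p.2 j)) (E k) := by
      ext k
      rw [Fin.prod_univ_succ]
      rfl
    rw [hEq]
    refine ⟨⟨_, (hg.prod hd).equiv E⟩, ?_⟩
    refine St.equiv (w := fun p : ℕ × (Fin n → ℕ) => f 0 p.1 * ∏ j : Fin n, f j.succ (p.2 j)) E ?_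
    rw [Fin.sum_univ_succ, Fin.prod_univ_succ]
    rcases hh 0 with ⟨he, h1⟩ | ⟨he, hc, h1⟩
    · rw [he, zero_add]
      exact St.cons_zero (v := f 0) (w := fun k : Fin n → ℕ => ∏ j, f j.succ (k j)) hα hg hd h1 hst
    · rw [he, add_comm 1]
      exact St.cons_one (v := f 0) (w := fun k : Fin n → ℕ => ∏ j, f j.succ (k j)) hα (hm 0) (hp 0) (ht 0) hd hc h1 hst

lemma summable_rest {v : ℕ → ℝ} (hm : Monotone v) (hp : ∀ k, 0 < v k)
    (ht : Tendsto v atTop atTop) {τ α : ℝ} (hτ : 0 ≤ τ) (hτα : τ < α)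
    (h : (gcnt v) =O[atTop] fun x => x ^ τ) : Summable fun k => v k ^ (-α) := by
  have hg := seq_good hm hp ht
  set σ := (τ + α) / 2 with hσ
  have hσ0 : 0 < σ := by linarith
  have hσα : σ < α := by linarith
  obtain ⟨C, hC, hb⟩ := h.exists_pos
  have hb := hb.bound
  have hev : ∀ᶠ k in atTop, ‖v k ^ (-α)‖ ≤ C ^ (α / σ) * (1 / ((k : ℝ) + 1) ^ (α / σ)) := by
    filter_upwards [ht.eventually hb, ht.eventually_ge_atTop 1] with k hk hk1
    have hv := hp k
    have h1 : (k : ℝ) + 1 ≤ C * v k ^ σ := by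
      calc (k : ℝ) + 1 ≤ gcnt v (v k) := cnt_ge hg hm k
        _ ≤ ‖gcnt v (v k)‖ := le_norm_self _
        _ ≤ C * ‖v k ^ τ‖ := hk
        _ = C * v k ^ τ := by rw [Real.norm_of_nonneg (by positivity)]
        _ ≤ C * v k ^ σ := by gcongr <;> linarith
    have h2 : ((k : ℝ) + 1) ^ (α / σ) ≤ C ^ (α / σ) * v k ^ α := by
      have := rpow_le_rpow (by positivity) h1 (show 0 ≤ α / σ by apply div_nonneg <;> linarith)
      rwa [mul_rpow hC.le (by positivity), ← rpow_mul hv.le, mul_div_cancel₀ _ hσ0.ne'] at this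
    rw [Real.norm_of_nonneg (by positivity), rpow_neg hv.le, mul_one_div,
      le_div_iff₀ (by positivity), inv_mul_eq_div, div_le_iff₀ (by positivity)]
    exact h2
  refine Summable.of_norm_bounded_eventually_nat ?_ hev
  refine Summable.mul_left _ ?_
  have := (Real.summable_one_div_nat_rpow (p := α / σ)).2 (by rwa [one_lt_div hσ0])
  have := (summable_nat_add_iff 1).2 this
  simpa using this

theorem prod_counting_asymptotics
    {p : ℕ} (hp : 1 ≤ p) (seq : Fin p → ℕ → ℝ)
    (hmono : ∀ j, Monotone (seq j)) (hpos : ∀ j k, 0 < seq j k)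
    (htend : ∀ j, Tendsto (seq j) atTop atTop)
    (τ α : ℝ) (hτ : 0 ≤ τ) (hτα : τ < α)
    (ν : ℕ) (hν1 : 1 ≤ ν) (hνp : ν ≤ p)
    (J : Fin ν → Fin p) (hJ : Function.Injective J)
    (A : Fin ν → ℝ) (hA : ∀ q, 0 < A q)
    (hmain : ∀ q, (countingFn (seq (J q))) ~[atTop] fun x => A q * x ^ α)
    (hrest : ∀ j, j ∉ Set.range J → (countingFn (seq j)) =O[atTop] fun x => x ^ τ) :
    (∀ j, j ∉ Set.range J → Summable fun k => (seq j k) ^ (-α)) ∧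
    (prodCountingFn seq) ~[atTop] fun x =>
      ((∏ q, A q) * ∏ j ∈ Finset.univ \ Finset.image J Finset.univ,
          ∑' k, (seq j k) ^ (-α))
        * x ^ α * (α * Real.log x) ^ (ν - 1) / (Nat.factorial (ν - 1)) := by
  have hα : 0 < α := hτ.trans_lt hτα
  have hS : ∀ j, j ∉ Set.range J → Summable fun k => (seq j k) ^ (-α) := fun j hj =>
    summable_rest (hmono j) (hpos j) (htend j) hτ hτα (hrest j hj)
  refine ⟨hS, ?_⟩
  set c : Fin p → ℝ := Function.extend J A (fun j => ∑' k, (seq j k) ^ (-α)) with hc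
  set e : Fin p → ℕ := Function.extend J (fun _ => 1) (fun _ => 0) with he
  have hcpos : ∀ j, 0 < c j := by
    intro j
    by_cases hj : j ∈ Set.range J
    · obtain ⟨q, rfl⟩ := hj
      rw [hc, hJ.extend_apply]
      exact hA q
    · rw [hc, Function.extend_apply' _ _ _ hj]
      exact (hS j hj).tsum_pos (fun k => (rpow_pos_of_pos (hpos j k) _).le) 0
        (rpow_pos_of_pos (hpos j 0) _)
  obtain ⟨-, hst⟩ := main_ind hα p seq e c hmono hpos htend (by
    intro j
    by_cases hj : j ∈ Set.range J
    · right
      refine ⟨?_, hcpos j, ?_⟩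
      · obtain ⟨q, rfl⟩ := hj
        rw [he, hJ.extend_apply]
      · obtain ⟨q, rfl⟩ := hj
        rw [hc, hJ.extend_apply]
        have hAq := hA q
        have h1 := (isEquivalent_iff_tendsto_one (by
          filter_upwards [eventually_gt_atTop 0] with x hx
          have := rpow_pos_of_pos hx α
          positivity)).1 (hmain q)
        have h2 := h1.const_mul (A q)
        rw [mul_one] at h2
        refine h2.congr' ?_
        filter_upwards [eventually_gt_atTop 0] with x hx
        have := rpow_pos_of_pos hx α
        show A q * (gcnt (seq (J q)) x / (A q * x ^ α)) = _
        field_simp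
    · left
      refine ⟨?_, ?_⟩
      · rw [he, Function.extend_apply' _ _ _ hj]
      · rw [hc, Function.extend_apply' _ _ _ hj]
        exact (hS j hj).hasSum)
  have hmem : ∀ j, j ∈ Finset.univ \ Finset.image J Finset.univ → j ∉ Set.range J := by
    intro j hj
    simpa using hj
  have hprod : ∏ j, c j = (∏ q, A q) * ∏ j ∈ Finset.univ \ Finset.image J Finset.univ,
      ∑' k, (seq j k) ^ (-α) := by
    rw [← Finset.prod_sdiff (Finset.subset_univ (Finset.image J Finset.univ)), mul_comm,
      Finset.prod_image hJ.injOn]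
    congr 1
    · exact Finset.prod_congr rfl fun q _ => by rw [hc, hJ.extend_apply]
    · exact Finset.prod_congr rfl fun j hj => by rw [hc, Function.extend_apply' _ _ _ (hmem j hj)]
  have hsum : ∑ j, e j = ν := by
    rw [← Finset.sum_sdiff (Finset.subset_univ (Finset.image J Finset.univ)),
      Finset.sum_image hJ.injOn, Finset.sum_eq_zero, zero_add,
      Finset.sum_congr rfl (g := fun _ => 1) fun q _ => by rw [he, hJ.extend_apply]]
    · simp
    · intro j hj
      rw [he, Function.extend_apply' _ _ _ (hmem j hj)]
  have hPpos : 0 < ∏ j, c j := Finset.prod_pos fun j _ => hcpos j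
  rw [hsum] at hst
  rw [← hprod]
  obtain ⟨m, rfl⟩ : ∃ m, ν = m + 1 := ⟨ν - 1, by omega⟩
  simp only [St] at hst
  rw [Nat.add_sub_cancel]
  have hfac : (0 : ℝ) < (Nat.factorial m : ℝ) := by positivity
  have hK : 0 < (∏ j, c j) * α ^ m / (Nat.factorial m) := by positivity
  refine isEquivalent_of_tendsto_one ?_
  have h1 := hst.div_const ((∏ j, c j) * α ^ m / (Nat.factorial m))
  rw [div_self hK.ne'] at h1
  refine h1.congr' ?_
  filter_upwards [eventually_gt_atTop 1] with x hx
  have hL := log_pos hx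
  have := rpow_pos_of_pos (show 0 < x by linarith) α
  show gcnt (fun k : Fin p → ℕ => ∏ j, seq j (k j)) x / _ / _ =
    gcnt (fun k : Fin p → ℕ => ∏ j, seq j (k j)) x / _
  simp only
  rw [mul_pow]
  field_simp
end

section
/- Let p ≥ 1 and for j = 1,…,p let (λ^{(j)}_k)_{k≥1} be a nondecreasing sequence of positive real numbers tending to infinity, with counting function N_j(λ) = #{k ∈ ℕ_{≥1} : λ^{(j)}_k ≤ λ}. Suppose that there exist α > 0 and constants A_j > 0 such that N_j(λ) ~ A_j λ^α as λ → ∞ for every j = 1,…,p. Then the product counting function N(λ) = #{(k_1,…,k_p) ∈ ℕ_{≥1}^p : λ^{(1)}_{k_1} λ^{(2)}_{k_2} ⋯ λ^{(p)}_{k_p} ≤ λ} satisfies N(λ) ~ A λ^α (α log λ)^{p−1}/(p−1)! as λ → ∞, where A = ∏_{j=1}^p A_j. -/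
open Filter Asymptotics Real

open Topology

lemma aux_log_ratio {ι : Type*} {l : Filter ι} {u v : ι → ℝ} {c : ℝ} (hc : 0 < c)
    (hv : Tendsto v l atTop) (h : Tendsto (fun i => u i / v i) l (𝓝 c)) :
    Tendsto (fun i => Real.log (u i) / Real.log (v i)) l (𝓝 1) := by
  have h1 : Tendsto (fun i => Real.log (u i / v i)) l (𝓝 (Real.log c)) :=
    h.log hc.ne'
  have h2 : Tendsto (fun i => Real.log (v i)) l atTop := Real.tendsto_log_atTop.comp hv
  have h3 := (h1.div_atTop h2).const_add 1
  rw [add_zero] at h3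
  refine h3.congr' ?_
  filter_upwards [h.eventually (lt_mem_nhds hc), hv.eventually_gt_atTop 0,
    h2.eventually_gt_atTop 0] with i hi hvi hli
  have hu : 0 < u i := by
    have := mul_pos hi hvi
    rwa [div_mul_cancel₀ _ hvi.ne'] at this
  rw [Real.log_div hu.ne' hvi.ne']
  field_simp
  ring

lemma aux_count {f : ℕ → ℝ} (hf : Monotone f) (ht : Tendsto f atTop atTop) (y : ℝ) (k : ℕ) :
    k < Nat.card {k : ℕ | f k ≤ y} ↔ f k ≤ y := by
  classical
  have hex : ∃ k, y < f k := (ht.eventually_gt_atTop y).exists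
  have key : ∀ k, f k ≤ y ↔ k < Nat.find hex := by
    intro k
    constructor
    · intro h
      by_contra hk
      exact absurd (lt_of_lt_of_le (Nat.find_spec hex) (hf (not_lt.1 hk))) (not_lt.2 h)
    · intro h
      exact not_lt.1 (Nat.find_min hex h)
  have hs : {k : ℕ | f k ≤ y} = Set.Iio (Nat.find hex) := by
    ext k; exact key k
  rw [hs, key]
  simp

lemma aux_inv {f : ℕ → ℝ} (hf : Monotone f) (hpos : ∀ k, 0 < f k) (ht : Tendsto f atTop atTop)
    {A : ℝ} (h : Tendsto (fun x => countingFn f x / x) atTop (𝓝 A)) :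
    Tendsto (fun k : ℕ => ((k : ℝ) + 1) / f k) atTop (𝓝 A) := by
  have hc : Tendsto (fun k : ℕ => (1 : ℝ) - 1 / ((k : ℝ) + 2)) atTop (𝓝 1) := by
    have : Tendsto (fun k : ℕ => ((k : ℝ) + 2)) atTop atTop :=
      tendsto_atTop_add_const_right _ _ tendsto_natCast_atTop_atTop
    simpa using (tendsto_const_nhds (x := (1 : ℝ))).div_atTop this |>.const_sub 1
  have hy : Tendsto (fun k : ℕ => f k * (1 - 1 / ((k : ℝ) + 2))) atTop atTop :=
    ht.atTop_mul_pos one_pos hc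
  have h1 := (h.comp hy).mul hc
  have h2 := h.comp ht
  have h3 : Tendsto (fun k : ℕ => 1 / f k) atTop (𝓝 0) := tendsto_const_nhds.div_atTop ht
  have h4 := h1.add h3
  rw [mul_one, add_zero] at h4
  refine tendsto_of_tendsto_of_tendsto_of_le_of_le h4 h2 ?_ ?_
  · intro k
    have hk : (0 : ℝ) < 1 - 1 / ((k : ℝ) + 2) := by
      rw [sub_pos, div_lt_one (by positivity)]
      linarith [(Nat.cast_nonneg k : (0 : ℝ) ≤ k)]
    have hk1 : (1 : ℝ) - 1 / ((k : ℝ) + 2) < 1 := by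
      have : (0 : ℝ) < 1 / ((k : ℝ) + 2) := by positivity
      linarith
    have hle : countingFn f (f k * (1 - 1 / ((k : ℝ) + 2))) ≤ k := by
      unfold countingFn
      have : ¬ k < Nat.card {i : ℕ | f i ≤ f k * (1 - 1 / ((k : ℝ) + 2))} := by
        rw [aux_count hf ht]
        have := mul_lt_mul_of_pos_left hk1 (hpos k)
        linarith
      exact_mod_cast not_lt.1 this
    have hfk := hpos k
    simp only [Function.comp]
    set c := (1 : ℝ) - 1 / ((k : ℝ) + 2)
    have e : countingFn f (f k * c) / (f k * c) * c = countingFn f (f k * c) / f k := by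
      field_simp
    rw [e, ← add_div]
    gcongr
  · intro k
    have : k < Nat.card {i : ℕ | f i ≤ f k} := by rw [aux_count hf ht]
    have h' : (k : ℝ) + 1 ≤ countingFn f (f k) := by
      unfold countingFn; exact_mod_cast this
    have hfk := hpos k
    simp only [Function.comp]
    gcongr

lemma aux_diff (j : ℕ) : Tendsto (fun k : ℕ => ((k : ℝ) + 1) *
    (Real.log ((k : ℝ) + 2) ^ (j + 1) - Real.log ((k : ℝ) + 1) ^ (j + 1)) /
      Real.log ((k : ℝ) + 1) ^ j) atTop (𝓝 ((j : ℝ) + 1)) := by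
  have hv : Tendsto (fun k : ℕ => ((k : ℝ) + 1)) atTop atTop :=
      tendsto_atTop_add_const_right _ _ tendsto_natCast_atTop_atTop
  have h1 : Tendsto (fun k : ℕ => ((k : ℝ) + 1) * Real.log (1 + 1 / ((k : ℝ) + 1))) atTop (𝓝 1) :=
    (Real.tendsto_mul_log_one_add_div_atTop 1).comp hv
  have hr : Tendsto (fun k : ℕ => ((k : ℝ) + 2) / ((k : ℝ) + 1)) atTop (𝓝 1) := by
    have := ((tendsto_const_nhds (x := (1 : ℝ))).div_atTop hv).const_add 1
    rw [add_zero] at this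
    refine this.congr fun k => ?_
    field_simp
    ring
  have h2 := aux_log_ratio one_pos hv hr
  have h3 : Tendsto (fun k : ℕ => ∑ i ∈ Finset.range (j + 1),
      (Real.log ((k : ℝ) + 2) / Real.log ((k : ℝ) + 1)) ^ i) atTop
      (𝓝 (∑ i ∈ Finset.range (j + 1), (1 : ℝ) ^ i)) :=
    tendsto_finsetSum _ fun i _ => h2.pow i
  have h4 := h1.mul h3
  simp only [one_pow, Finset.sum_const, Finset.card_range, nsmul_eq_mul, mul_one, one_mul] at h4
  push_cast at h4
  refine h4.congr' ?_
  filter_upwards [(Real.tendsto_log_atTop.comp hv).eventually_gt_atTop 0] with k hk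
  simp only [Function.comp] at hk
  have e1 : (1 : ℝ) + 1 / ((k : ℝ) + 1) = ((k : ℝ) + 2) / ((k : ℝ) + 1) := by field_simp; ring
  rw [e1, Real.log_div (by positivity) (by positivity)]
  set a := Real.log ((k : ℝ) + 1)
  set b := Real.log ((k : ℝ) + 2)
  have e2 : b ^ (j + 1) - a ^ (j + 1) = a ^ j * (b - a) * ∑ i ∈ Finset.range (j + 1), (b / a) ^ i := by
    have := geom_sum_mul (b / a) (j + 1)
    have h' : (∑ i ∈ Finset.range (j + 1), (b / a) ^ i) * (b / a - 1) * a ^ (j + 1) =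
      b ^ (j + 1) - a ^ (j + 1) := by
      rw [this, div_pow]; field_simp
    rw [← h', pow_succ]; field_simp
  rw [e2]
  field_simp

lemma aux_sum {f : ℕ → ℝ} (hpos : ∀ k, 0 < f k)
    (ht : Tendsto f atTop atTop) {A : ℝ} (hA : 0 < A)
    (h : Tendsto (fun k : ℕ => ((k : ℝ) + 1) / f k) atTop (𝓝 A)) (j : ℕ) :
    Tendsto (fun n : ℕ => (∑ k ∈ Finset.range n, Real.log (f k) ^ j / f k) /
      Real.log ((n : ℝ) + 1) ^ (j + 1)) atTop (𝓝 (A / (j + 1))) := by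
  have hv : Tendsto (fun k : ℕ => ((k : ℝ) + 1)) atTop atTop :=
      tendsto_atTop_add_const_right _ _ tendsto_natCast_atTop_atTop
  have hlv := Real.tendsto_log_atTop.comp hv
  have h1 : Tendsto (fun k : ℕ => Real.log (f k) / Real.log ((k : ℝ) + 1)) atTop (𝓝 1) := by
    have : Tendsto (fun k : ℕ => f k / ((k : ℝ) + 1)) atTop (𝓝 A⁻¹) := by
      refine (h.inv₀ hA.ne').congr fun k => ?_
      rw [inv_div]
    exact aux_log_ratio (inv_pos.2 hA) hv this
  set g : ℕ → ℝ := fun k => Real.log ((k : ℝ) + 2) ^ (j + 1) - Real.log ((k : ℝ) + 1) ^ (j + 1) with hg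
  have hgs : ∀ n : ℕ, ∑ k ∈ Finset.range n, g k = Real.log ((n : ℝ) + 1) ^ (j + 1) := by
    intro n
    induction n with
    | zero => simp
    | succ n ih =>
      rw [Finset.sum_range_succ, ih, hg]
      push_cast
      ring_nf
  have hgpos : ∀ k, 0 < g k := by
    intro k
    rw [hg]
    have h0 : 0 ≤ Real.log ((k : ℝ) + 1) := Real.log_nonneg (by linarith [(Nat.cast_nonneg k : (0 : ℝ) ≤ k)])
    have h1 : Real.log ((k : ℝ) + 1) < Real.log ((k : ℝ) + 2) :=
      Real.log_lt_log (by positivity) (by linarith)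
    have := pow_lt_pow_left₀ h1 h0 (Nat.succ_ne_zero j)
    simpa using this
  have hq : Tendsto (fun k => (Real.log (f k) ^ j / f k) / g k) atTop (𝓝 (A / (j + 1))) := by
    have := ((h1.pow j).mul h).div (aux_diff j) (by positivity)
    simp only [one_pow, one_mul] at this
    refine this.congr' ?_
    filter_upwards [hlv.eventually_gt_atTop 0] with k hk
    simp only [Function.comp] at hk
    have := hpos k
    have hgk := hgpos k
    change _ / (((k : ℝ) + 1) * g k / _) = _
    have : Real.log ((k : ℝ) + 1) ^ j ≠ 0 := by positivity
    beta_reduce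
    rw [div_pow]
    field_simp
  have hlo : (fun k => Real.log (f k) ^ j / f k - A / (j + 1) * g k) =o[atTop] g := by
    rw [isLittleO_iff_tendsto' (Eventually.of_forall fun k hk => absurd hk (hgpos k).ne')]
    have := hq.sub_const (A / (j + 1))
    rw [sub_self] at this
    refine this.congr fun k => ?_
    have hgk := hgpos k
    field_simp
  have hT : Tendsto (fun n : ℕ => Real.log ((n : ℝ) + 1) ^ (j + 1)) atTop atTop :=
    (tendsto_pow_atTop (Nat.succ_ne_zero j)).comp hlv
  have hs := hlo.sum_range (fun k => (hgpos k).le) (by simpa only [hgs] using hT)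
  simp only [hgs, Finset.sum_sub_distrib, ← Finset.mul_sum] at hs
  have := hs.tendsto_div_nhds_zero.add_const (A / (j + 1))
  rw [zero_add] at this
  refine this.congr' ?_
  filter_upwards [hT.eventually_gt_atTop 0] with n hn
  field_simp
  ring

lemma aux_binom (n : ℕ) : ∑ j ∈ Finset.range (n + 1), (n.choose j : ℝ) * (-1) ^ j * (1 / ((j : ℝ) + 1))
    = 1 / ((n : ℝ) + 1) := by
  have h := Int.alternating_sum_range_choose_of_ne (Nat.succ_ne_zero n)
  rw [Finset.sum_range_succ'] at h
  have h' : (∑ k ∈ Finset.range (n + 1), (-1 : ℝ) ^ (k + 1) * ((n + 1).choose (k + 1) : ℝ)) + 1 = 0 := by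
    have := congrArg (Int.cast : ℤ → ℝ) h
    push_cast at this
    simpa using this
  have hn : ((n : ℝ) + 1) ≠ 0 := by positivity
  rw [eq_div_iff hn, Finset.sum_mul]
  have : ∀ j ∈ Finset.range (n + 1), (n.choose j : ℝ) * (-1) ^ j * (1 / ((j : ℝ) + 1)) * (n + 1)
      = - ((-1 : ℝ) ^ (j + 1) * ((n + 1).choose (j + 1) : ℝ)) := by
    intro j _
    have e : ((n : ℝ) + 1) * (n.choose j : ℝ) = ((n + 1).choose (j + 1) : ℝ) * (j + 1) := by
      exact_mod_cast Nat.add_one_mul_choose_eq n j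
    have : ((j : ℝ) + 1) ≠ 0 := by positivity
    field_simp
    rw [pow_succ]
    linear_combination (-1 : ℝ) ^ j * e
  rw [Finset.sum_congr rfl this, Finset.sum_neg_distrib]
  linarith

lemma aux_err {M : ℝ → ℝ} (hMm : Monotone M) (hM0 : ∀ y, 0 ≤ M y) {m b : ℝ} (hm : 0 < m) {n : ℕ}
    (hM : Tendsto (fun y => M y / (y * Real.log y ^ n)) atTop (𝓝 b)) {ε : ℝ} (hε : 0 < ε) :
    ∃ C : ℝ, ∀ y, m ≤ y → |M y - b * (y * Real.log y ^ n)| ≤ ε * (y * |Real.log y| ^ n) + C := by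
  have h1 : ∀ᶠ y in atTop, |M y / (y * Real.log y ^ n) - b| < ε := by
    have := Metric.tendsto_nhds.1 hM ε hε
    simpa only [Real.dist_eq] using this
  obtain ⟨Y, hY⟩ := eventually_atTop.1 (h1.and (eventually_gt_atTop 1))
  have hY1 : 1 < Y := (hY Y le_rfl).2
  set L := |Real.log m| + |Real.log Y|
  have hL : 0 ≤ L := by positivity
  refine ⟨M Y + |b| * (Y * L ^ n), fun y hy => ?_⟩
  have hypos : 0 < y := hm.trans_le hy
  have hMY := hM0 Y
  rcases le_total Y y with h | h
  · obtain ⟨h2, h3⟩ := hY y h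
    have hl : 0 < Real.log y := Real.log_pos h3
    have hp : 0 < y * Real.log y ^ n := by positivity
    rw [abs_of_pos hl]
    have : M y - b * (y * Real.log y ^ n) =
        (M y / (y * Real.log y ^ n) - b) * (y * Real.log y ^ n) := by
      field_simp
    rw [this, abs_mul, abs_of_pos hp]
    have h4 := mul_le_mul_of_nonneg_right h2.le hp.le
    have : 0 ≤ M Y + |b| * (Y * L ^ n) := by positivity
    linarith
  · have hly : |Real.log y| ≤ L := by
      have a1 := Real.log_le_log hm hy
      have a2 := Real.log_le_log hypos h
      rw [abs_le]
      constructor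
      · linarith [neg_abs_le (Real.log m), abs_nonneg (Real.log Y)]
      · linarith [le_abs_self (Real.log Y), abs_nonneg (Real.log m)]
    have h5 : |M y| ≤ M Y := by rw [abs_of_nonneg (hM0 y)]; exact hMm h
    have h6 : |b * (y * Real.log y ^ n)| ≤ |b| * (Y * L ^ n) := by
      rw [abs_mul, abs_mul, abs_pow, abs_of_pos hypos]
      gcongr
    have h7 := abs_sub (M y) (b * (y * Real.log y ^ n))
    have : 0 ≤ ε * (y * |Real.log y| ^ n) := by positivity
    linarith

lemma aux_step {f : ℕ → ℝ} (hf : Monotone f) (hpos : ∀ k, 0 < f k)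
    (ht : Tendsto f atTop atTop) {A : ℝ} (hA : 0 < A)
    (h : Tendsto (fun x => countingFn f x / x) atTop (𝓝 A))
    {M : ℝ → ℝ} (hMm : Monotone M) (hM0 : ∀ y, 0 ≤ M y) {m b : ℝ} (hm : 0 < m) {n : ℕ}
    (hM : Tendsto (fun y => M y / (y * Real.log y ^ n)) atTop (𝓝 b)) :
    Tendsto (fun x => (∑ k ∈ Finset.range (Nat.card {k : ℕ | f k ≤ x / m}), M (x / f k)) /
      (x * Real.log x ^ (n + 1))) atTop (𝓝 (A * b / (n + 1))) := by
  set K : ℝ → ℕ := fun x => Nat.card {k : ℕ | f k ≤ x / m} with hKdef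
  have hK : Tendsto (fun x => (K x : ℝ) / x) atTop (𝓝 (A / m)) := by
    have := (h.comp (tendsto_id.atTop_div_const hm)).div_const m
    refine this.congr' ?_
    filter_upwards [eventually_gt_atTop 0] with x hx
    simp only [Function.comp, id]
    change (K x : ℝ) / (x / m) / m = _
    field_simp
  have hKtop : Tendsto K atTop atTop := by
    have : Tendsto (fun x => (K x : ℝ)) atTop atTop := by
      refine (hK.pos_mul_atTop (by positivity) tendsto_id).congr' ?_
      filter_upwards [eventually_gt_atTop 0] with x hx
      simp only [id]
      field_simp
    exact tendsto_natCast_atTop_iff.1 this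
  have hlogK : Tendsto (fun x => Real.log ((K x : ℝ) + 1) / Real.log x) atTop (𝓝 1) := by
    refine aux_log_ratio (c := A / m) (by positivity) tendsto_id ?_
    have := hK.add ((tendsto_const_nhds (x := (1 : ℝ))).div_atTop tendsto_id)
    rw [add_zero] at this
    refine this.congr fun x => ?_
    simp only [id]
    rw [add_div]
  have hlog := Real.tendsto_log_atTop
  set S : ℕ → ℝ → ℝ := fun j x => ∑ k ∈ Finset.range (K x), Real.log (f k) ^ j / f k with hSdef
  have hS : ∀ j : ℕ, Tendsto (fun x => S j x / Real.log x ^ (j + 1)) atTop (𝓝 (A / (j + 1))) := by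
    intro j
    have h1 := ((aux_sum hpos ht hA (aux_inv hf hpos ht h) j).comp hKtop).mul (hlogK.pow (j + 1))
    rw [one_pow, mul_one] at h1
    refine h1.congr' ?_
    filter_upwards [hKtop.eventually_gt_atTop 0] with x hx
    simp only [Function.comp]
    have : 0 < Real.log ((K x : ℝ) + 1) := Real.log_pos (by
      have : (0 : ℝ) < K x := by exact_mod_cast hx
      linarith)
    rw [div_pow]
    field_simp
    rfl
  -- main term
  have hmainT : Tendsto (fun x => (∑ k ∈ Finset.range (K x),
      b * (x / f k * Real.log (x / f k) ^ n)) / (x * Real.log x ^ (n + 1))) atTop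
      (𝓝 (A * b / (n + 1))) := by
    have h1 : Tendsto (fun x => ∑ j ∈ Finset.range (n + 1), b * ((n.choose j : ℝ) * (-1) ^ j) *
        (S j x / Real.log x ^ (j + 1))) atTop (𝓝 (∑ j ∈ Finset.range (n + 1),
          b * ((n.choose j : ℝ) * (-1) ^ j) * (A / (j + 1)))) :=
      tendsto_finsetSum _ fun j _ => (hS j).const_mul _
    have e : ∑ j ∈ Finset.range (n + 1), b * ((n.choose j : ℝ) * (-1) ^ j) * (A / (j + 1))
        = A * b / (n + 1) := by
      have := congrArg (fun t => A * b * t) (aux_binom n)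
      simp only [Finset.mul_sum] at this
      rw [div_eq_mul_one_div (A * b), ← this]
      refine Finset.sum_congr rfl fun j _ => ?_
      ring
    rw [e] at h1
    refine h1.congr' ?_
    filter_upwards [eventually_gt_atTop 0, hlog.eventually_gt_atTop 0] with x hx hl
    simp only [hSdef, Finset.sum_div, Finset.mul_sum]
    rw [Finset.sum_comm]
    refine Finset.sum_congr rfl fun k _ => ?_
    have hk := hpos k
    rw [Real.log_div hx.ne' hk.ne', sub_eq_neg_add, add_pow, Finset.mul_sum, Finset.mul_sum,
      Finset.sum_div]
    refine Finset.sum_congr rfl fun j hj => ?_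
    have hj' : j ≤ n := Nat.lt_succ_iff.1 (Finset.mem_range.1 hj)
    have e1 : Real.log x ^ (n + 1) = Real.log x ^ (n - j) * Real.log x ^ (j + 1) := by
      rw [← pow_add]; congr 1; omega
    rw [e1, neg_pow (Real.log (f k))]
    field_simp
  -- error term
  have herr : Tendsto (fun x => (∑ k ∈ Finset.range (K x), (M (x / f k) -
      b * (x / f k * Real.log (x / f k) ^ n))) / (x * Real.log x ^ (n + 1))) atTop (𝓝 0) := by
    rw [Metric.tendsto_nhds]
    intro δ hδ
    set ε : ℝ := δ / (2 * (2 ^ n * A)) with hεdef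
    have hε : 0 < ε := by positivity
    obtain ⟨C, hC⟩ := aux_err hMm hM0 hm hM hε
    have hR : Tendsto (fun x => ε * 2 ^ n * (S 0 x / Real.log x ^ (0 + 1)) +
        C * (K x / x) / Real.log x ^ (n + 1)) atTop
        (𝓝 (ε * 2 ^ n * (A / ((0 : ℕ) + 1)) + 0)) :=
      ((hS 0).const_mul _).add ((hK.const_mul C).div_atTop
        ((tendsto_pow_atTop (Nat.succ_ne_zero n)).comp hlog))
    have hlt : ε * 2 ^ n * (A / ((0 : ℕ) + 1)) + 0 < δ := by
      have : ε * 2 ^ n * (A / ((0 : ℕ) + 1)) + 0 = δ / 2 := by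
        rw [hεdef]; simp; field_simp
      rw [this]; linarith
    filter_upwards [hR.eventually (gt_mem_nhds hlt), eventually_gt_atTop 0,
      hlog.eventually_gt_atTop 0, hlog.eventually_ge_atTop |Real.log m|,
      hlog.eventually_ge_atTop |Real.log (f 0)|] with x hx hx0 hl hlm hlf
    rw [dist_zero_right, Real.norm_eq_abs, abs_div, abs_of_pos (by positivity : 0 < x * Real.log x ^ (n + 1))]
    refine lt_of_le_of_lt ?_ hx
    rw [div_le_iff₀ (by positivity)]
    have hb : |∑ k ∈ Finset.range (K x), (M (x / f k) -
      b * (x / f k * Real.log (x / f k) ^ n))| ≤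
        ∑ k ∈ Finset.range (K x), (ε * (x * (2 * Real.log x) ^ n) * (Real.log (f k) ^ 0 / f k) + C) := by
      refine (Finset.abs_sum_le_sum_abs _ _).trans (Finset.sum_le_sum fun k hk => ?_)
      have hk' : f k ≤ x / m := (aux_count hf ht _ _).1 (Finset.mem_range.1 hk)
      have hfk := hpos k
      have hmk : m ≤ x / f k := by
        rw [le_div_iff₀ hfk, mul_comm]; exact (le_div_iff₀ hm).1 hk'
      refine (hC _ hmk).trans ?_
      have hlk : |Real.log (x / f k)| ≤ 2 * Real.log x := by
        have a1 := Real.log_le_log hm hmk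
        have a2 := Real.log_le_log (hpos 0) (hf (Nat.zero_le k))
        have a3 := Real.log_div hx0.ne' hfk.ne'
        rw [abs_le]
        constructor
        · linarith [neg_abs_le (Real.log m)]
        · linarith [neg_abs_le (Real.log (f 0))]
      have : ε * (x * (2 * Real.log x) ^ n) * (Real.log (f k) ^ 0 / f k) =
        ε * (x / f k * (2 * Real.log x) ^ n) := by
        rw [pow_zero]; field_simp
      rw [this]
      gcongr
    refine hb.trans (le_of_eq ?_)
    rw [Finset.sum_add_distrib, ← Finset.mul_sum, Finset.sum_const, Finset.card_range, nsmul_eq_mul]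
    change ε * (x * (2 * Real.log x) ^ n) * S 0 x + _ = _
    rw [mul_pow]
    field_simp
    ring
  have := hmainT.add herr
  rw [add_zero] at this
  refine this.congr fun x => ?_
  rw [← add_div, ← Finset.sum_add_distrib]
  congr 1
  refine Finset.sum_congr rfl fun k _ => ?_
  ring

lemma aux_prod_ge {n : ℕ} {s : Fin n → ℕ → ℝ} (hmono : ∀ j, Monotone (s j))
    (hpos : ∀ j k, 0 < s j k) (k : Fin n → ℕ) : ∏ j, s j 0 ≤ ∏ j, s j (k j) :=
  Finset.prod_le_prod (fun j _ => (hpos j 0).le) fun j _ => hmono j (Nat.zero_le _)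

/-- Split off the first coordinate. -/
def auxEquiv {n : ℕ} {s : Fin (n + 1) → ℕ → ℝ} (hmono : ∀ j, Monotone (s j))
    (hpos : ∀ j k, 0 < s j k) (ht : ∀ j, Tendsto (s j) atTop atTop) (x : ℝ) :
    {k : Fin (n + 1) → ℕ | ∏ j, s j (k j) ≤ x} ≃
    Σ i : Fin (Nat.card {k : ℕ | s 0 k ≤ x / ∏ j : Fin n, s j.succ 0}),
      {k : Fin n → ℕ | ∏ j, s j.succ (k j) ≤ x / s 0 i} where
  toFun k := ⟨⟨k.1 0, by
      have h := k.2
      simp only [Set.mem_ofPred_eq, Fin.prod_univ_succ] at h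
      rw [aux_count (hmono 0) (ht 0), le_div_iff₀ (Finset.prod_pos fun j _ => hpos _ _)]
      refine le_trans (mul_le_mul_of_nonneg_left ?_ (hpos 0 _).le) h
      exact aux_prod_ge (s := fun j : Fin n => s j.succ) (fun j => hmono _) (fun j => hpos _)
        (fun j => k.1 j.succ)⟩, ⟨fun j => k.1 j.succ, by
      have h := k.2
      simp only [Set.mem_ofPred_eq, Fin.prod_univ_succ] at h
      change _ ≤ x / s 0 (k.1 0)
      rw [le_div_iff₀ (hpos 0 _), mul_comm]
      exact h⟩⟩
  invFun t := ⟨Fin.cons (t.1 : ℕ) t.2.1, by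
      have h := t.2.2
      simp only [Set.mem_ofPred_eq] at h
      rw [le_div_iff₀ (hpos 0 _), mul_comm] at h
      simpa [Fin.prod_univ_succ] using h⟩
  left_inv k := by
    apply Subtype.ext
    exact Fin.cons_self_tail k.1
  right_inv t := by
    rcases t with ⟨⟨i, hi⟩, ⟨k, hk⟩⟩
    rfl

lemma aux_finite : ∀ {n : ℕ} {s : Fin n → ℕ → ℝ} (_ : ∀ j, Monotone (s j))
    (_ : ∀ j k, 0 < s j k) (_ : ∀ j, Tendsto (s j) atTop atTop) (x : ℝ),
    Finite {k : Fin n → ℕ | ∏ j, s j (k j) ≤ x} := by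
  intro n
  induction n with
  | zero => intro s _ _ _ x; infer_instance
  | succ n ih =>
    intro s hmono hpos ht x
    have : ∀ i : Fin (Nat.card {k : ℕ | s 0 k ≤ x / ∏ j : Fin n, s j.succ 0}),
        Finite {k : Fin n → ℕ | ∏ j, s j.succ (k j) ≤ x / s 0 i} := fun i =>
      ih (s := fun j => s j.succ) (fun j => hmono _) (fun j => hpos _) (fun j => ht _) _
    exact Finite.of_equiv _ (auxEquiv hmono hpos ht x).symm

lemma aux_rec {n : ℕ} {s : Fin (n + 1) → ℕ → ℝ} (hmono : ∀ j, Monotone (s j))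
    (hpos : ∀ j k, 0 < s j k) (ht : ∀ j, Tendsto (s j) atTop atTop) (x : ℝ) :
    prodCountingFn s x = ∑ k ∈ Finset.range (Nat.card {k : ℕ | s 0 k ≤ x / ∏ j : Fin n, s j.succ 0}),
      prodCountingFn (fun j : Fin n => s j.succ) (x / s 0 k) := by
  have : ∀ i : Fin (Nat.card {k : ℕ | s 0 k ≤ x / ∏ j : Fin n, s j.succ 0}),
      Finite {k : Fin n → ℕ | ∏ j, s j.succ (k j) ≤ x / s 0 i} := fun i =>
    aux_finite (s := fun j => s j.succ) (fun j => hmono _) (fun j => hpos _) (fun j => ht _) _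
  unfold prodCountingFn
  rw [Nat.card_congr (auxEquiv hmono hpos ht x), Nat.card_sigma, Finset.sum_range]
  push_cast
  rfl

lemma aux_mono {n : ℕ} {s : Fin n → ℕ → ℝ} (hmono : ∀ j, Monotone (s j))
    (hpos : ∀ j k, 0 < s j k) (ht : ∀ j, Tendsto (s j) atTop atTop) :
    Monotone (prodCountingFn s) := by
  intro x y hxy
  unfold prodCountingFn
  have hfin : ({k : Fin n → ℕ | ∏ j, s j (k j) ≤ y}).Finite := aux_finite hmono hpos ht y
  have : Nat.card {k : Fin n → ℕ | ∏ j, s j (k j) ≤ x} ≤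
      Nat.card {k : Fin n → ℕ | ∏ j, s j (k j) ≤ y} :=
    Nat.card_mono hfin fun k hk => le_trans hk hxy
  exact_mod_cast this

lemma aux_one (s : Fin 1 → ℕ → ℝ) (x : ℝ) : prodCountingFn s x = countingFn (s 0) x := by
  unfold prodCountingFn countingFn
  congr 1
  refine Nat.card_congr ((Equiv.funUnique (Fin 1) ℕ).subtypeEquiv fun k => ?_)
  simp

lemma aux_main (n : ℕ) : ∀ (s : Fin (n + 1) → ℕ → ℝ) (_ : ∀ j, Monotone (s j))
    (_ : ∀ j k, 0 < s j k) (_ : ∀ j, Tendsto (s j) atTop atTop) (A : Fin (n + 1) → ℝ)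
    (_ : ∀ j, 0 < A j) (_ : ∀ j, Tendsto (fun x => countingFn (s j) x / x) atTop (𝓝 (A j))),
    Tendsto (fun x => prodCountingFn s x / (x * Real.log x ^ n)) atTop
      (𝓝 ((∏ j, A j) / n.factorial)) := by
  induction n with
  | zero =>
    intro s _ _ _ A _ h
    simpa [aux_one] using h 0
  | succ n ih =>
    intro s hmono hpos ht A hA h
    have h1 := ih (fun j => s j.succ) (fun j => hmono _) (fun j => hpos _) (fun j => ht _)
      (fun j => A j.succ) (fun j => hA _) (fun j => h _)
    have h2 := aux_step (hmono 0) (hpos 0) (ht 0) (hA 0) (h 0)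
      (aux_mono (s := fun j => s j.succ) (fun j => hmono _) (fun j => hpos _) (fun j => ht _))
      (fun y => by unfold prodCountingFn; positivity)
      (m := ∏ j : Fin (n + 1), s j.succ 0) (Finset.prod_pos fun j _ => hpos _ _) h1
    simp only [← aux_rec hmono hpos ht] at h2
    convert h2 using 2
    rw [Fin.prod_univ_succ, Nat.factorial_succ]
    push_cast
    field_simp

theorem prod_counting_asymptotics_all_same_order
    {p : ℕ} (hp : 1 ≤ p) (seq : Fin p → ℕ → ℝ)
    (hmono : ∀ j, Monotone (seq j)) (hpos : ∀ j k, 0 < seq j k)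
    (htend : ∀ j, Tendsto (seq j) atTop atTop)
    (α : ℝ) (hα : 0 < α) (A : Fin p → ℝ) (hA : ∀ j, 0 < A j)
    (hmain : ∀ j, (countingFn (seq j)) ~[atTop] fun x => A j * x ^ α) :
    (prodCountingFn seq) ~[atTop] fun x =>
      (∏ j, A j) * x ^ α * (α * Real.log x) ^ (p - 1) / (Nat.factorial (p - 1)) := by
  obtain ⟨n, rfl⟩ : ∃ n, p = n + 1 := ⟨p - 1, by omega⟩
  simp only [Nat.add_sub_cancel]
  have hcount : ∀ j, Tendsto (fun x => countingFn (fun k => seq j k ^ α) x / x) atTop (𝓝 (A j)) := by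
    intro j
    have h1 := hmain j
    rw [isEquivalent_iff_tendsto_one (by
      filter_upwards [eventually_gt_atTop 0] with x hx
      have := hA j
      positivity)] at h1
    have h2 := (h1.comp (tendsto_rpow_atTop (inv_pos.2 hα))).const_mul (A j)
    rw [mul_one] at h2
    refine h2.congr' ?_
    filter_upwards [eventually_gt_atTop 0] with x hx
    have e1 : (x ^ α⁻¹) ^ α = x := Real.rpow_inv_rpow hx.le hα.ne'
    have e2 : countingFn (seq j) (x ^ α⁻¹) = countingFn (fun k => seq j k ^ α) x := by
      unfold countingFn
      congr 3
      ext k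
      exact Real.le_rpow_inv_iff_of_pos (hpos j k).le hx.le hα
    simp only [Function.comp, Pi.div_apply, e1, e2]
    have := hA j
    field_simp
  have hX := aux_main n (fun j k => seq j k ^ α)
    (fun j a b hab => Real.rpow_le_rpow (hpos j a).le (hmono j hab) hα.le)
    (fun j k => Real.rpow_pos_of_pos (hpos j k) _)
    (fun j => (tendsto_rpow_atTop hα).comp (htend j)) A hA hcount
  have hP : 0 < ∏ j, A j := Finset.prod_pos fun j _ => hA j
  have hc : 0 < (∏ j, A j) / (n.factorial : ℝ) := by positivity
  rw [isEquivalent_iff_tendsto_one (by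
      filter_upwards [eventually_gt_atTop 1] with x hx
      have := Real.log_pos hx
      have : 0 < x := by linarith
      positivity)]
  have h3 := (hX.comp (tendsto_rpow_atTop hα)).div_const ((∏ j, A j) / (n.factorial : ℝ))
  rw [div_self hc.ne'] at h3
  refine h3.congr' ?_
  filter_upwards [eventually_gt_atTop 1] with x hx
  have hl := Real.log_pos hx
  have hx0 : 0 < x := by linarith
  have e2 : prodCountingFn (fun j k => seq j k ^ α) (x ^ α) = prodCountingFn seq x := by
    unfold prodCountingFn
    congr 3
    ext k
    simp only [Set.mem_ofPred_eq]
    rw [Real.finsetProd_rpow _ _ fun j _ => (hpos j _).le]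
    exact Real.rpow_le_rpow_iff (Finset.prod_nonneg fun j _ => (hpos j _).le) hx0.le hα
  simp only [Function.comp, Pi.div_apply, e2, Real.log_rpow hx0]
  field_simp
end

section
/- Let (μ^{(1)}_k)_{k≥1} and (μ^{(2)}_k)_{k≥1} be nondecreasing sequences of positive real numbers tending to infinity with counting functions M_1(λ) = #{k : μ^{(1)}_k ≤ λ} and M_2(λ) = #{k : μ^{(2)}_k ≤ λ}. Suppose M_1(λ) = O(λ^τ) as λ → ∞ and M_2(λ) ~ B λ^α log^b λ as λ → ∞, where 0 ≤ τ < α, B > 0 and b ≥ 0. Then the series Σ_{k=1}^∞ (μ^{(1)}_k)^{-α} converges and the product counting function M(λ) = #{(k_1,k_2) ∈ ℕ_{≥1}^2 : μ^{(1)}_{k_1} μ^{(2)}_{k_2} ≤ λ} satisfies M(λ) ~ B̃ λ^α log^b λ as λ → ∞, where B̃ = B · Σ_{k=1}^∞ (μ^{(1)}_k)^{-α}. -/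
open Filter Asymptotics Real

theorem finite_le_of_tendsto (f : ℕ → ℝ) (hf : Tendsto f atTop atTop) (x : ℝ) :
    {k : ℕ | f k ≤ x}.Finite := by
  obtain ⟨N, hN⟩ := eventually_atTop.1 (hf.eventually_gt_atTop x)
  refine (Set.finite_lt_nat N).subset fun k hk => ?_
  by_contra h
  exact absurd (hN k (not_lt.1 h)) (not_lt.2 hk)

theorem countingFn_mono (f : ℕ → ℝ) (hf : Tendsto f atTop atTop) : Monotone (countingFn f) := by
  intro x y hxy
  unfold countingFn
  exact_mod_cast Nat.card_mono (finite_le_of_tendsto f hf y) fun k (hk : f k ≤ x) => hk.trans hxy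

theorem countingFn_nonneg (f : ℕ → ℝ) (x : ℝ) : 0 ≤ countingFn f x := by
  unfold countingFn; positivity

theorem countingFn_zero (f : ℕ → ℝ) (hm : Monotone f) (x : ℝ) (hx : x < f 0) :
    countingFn f x = 0 := by
  have : {k : ℕ | f k ≤ x} = ∅ := by
    ext k
    simpa using hx.trans_le (hm (Nat.zero_le k))
  unfold countingFn
  rw [this]; simp

theorem summable_aux (μ : ℕ → ℝ) (hm : Monotone μ) (hp : ∀ k, 0 < μ k)
    (ht : Tendsto μ atTop atTop) (τ α : ℝ) (hτ : 0 ≤ τ) (hτα : τ < α)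
    (hM : (countingFn μ) =O[atTop] fun x => x ^ τ) : Summable (fun k => (μ k) ^ (-α)) := by
  obtain ⟨C, hC0, hC⟩ := hM.exists_pos
  rw [IsBigOWith] at hC
  set σ := (τ + α) / 2 with hσ
  have hσ0 : 0 < σ := by linarith
  have hτσ : τ ≤ σ := by linarith
  have hσα : σ < α := by linarith
  have h1 : ∀ᶠ k : ℕ in atTop, ((k : ℝ) + 1) ≤ C * μ k ^ σ := by
    filter_upwards [ht.eventually hC, ht.eventually_ge_atTop 1] with k hk hk1
    have h2 : ((k : ℝ) + 1) ≤ countingFn μ (μ k) := by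
      unfold countingFn
      have := Nat.card_mono (finite_le_of_tendsto μ ht (μ k))
        (s := (Finset.range (k+1) : Set ℕ)) (fun j hj => hm (by
          have : j < k + 1 := by simpa using hj
          omega))
      simp at this
      exact_mod_cast this
    rw [Real.norm_of_nonneg (countingFn_nonneg _ _),
      Real.norm_of_nonneg (Real.rpow_nonneg (hp k).le _)] at hk
    refine h2.trans (hk.trans ?_)
    gcongr
  have hs : Summable (fun k : ℕ => C ^ (α / σ) * ((k : ℝ) + 1) ^ (-(α / σ))) := by
    apply Summable.mul_left
    have : Summable (fun k : ℕ => (k : ℝ) ^ (-(α / σ))) := by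
      rw [Real.summable_nat_rpow]
      have : 1 < α / σ := (one_lt_div hσ0).2 hσα
      linarith
    simpa using (summable_nat_add_iff 1).2 this
  refine Summable.of_norm_bounded_eventually_nat hs ?_
  filter_upwards [h1] with k hk
  rw [Real.norm_of_nonneg (Real.rpow_nonneg (hp k).le _)]
  have h3 := Real.rpow_le_rpow (by positivity) hk (div_nonneg (by linarith) hσ0.le : 0 ≤ α / σ)
  rw [Real.mul_rpow hC0.le (Real.rpow_nonneg (hp k).le _), ← Real.rpow_mul (hp k).le,
    mul_div_cancel₀ _ hσ0.ne'] at h3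
  rw [Real.rpow_neg (hp k).le, Real.rpow_neg (by positivity), ← div_eq_mul_inv, 
    le_div_iff₀ (by positivity), inv_mul_le_iff₀ (Real.rpow_pos_of_pos (hp k) _)]
  linarith

theorem card_prod_eq (μ₁ μ₂ : ℕ → ℝ) (hmono₂ : Monotone μ₂)
    (hpos₁ : ∀ k, 0 < μ₁ k) (hpos₂ : ∀ k, 0 < μ₂ k)
    (htend₁ : Tendsto μ₁ atTop atTop) (htend₂ : Tendsto μ₂ atTop atTop) (x : ℝ) :
    (Nat.card {k : ℕ × ℕ | μ₁ k.1 * μ₂ k.2 ≤ x} : ℝ) = ∑' k, countingFn μ₂ (x / μ₁ k) := by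
  obtain ⟨N, hN⟩ := eventually_atTop.1 (htend₁.eventually_gt_atTop (x / μ₂ 0))
  have hz : ∀ i, N ≤ i → x / μ₁ i < μ₂ 0 := by
    intro i hi
    have := hN i hi
    rw [div_lt_iff₀ (hpos₂ 0)] at this
    rw [div_lt_iff₀ (hpos₁ i)]; linarith
  rw [tsum_eq_sum (s := Finset.range N) (fun i hi => countingFn_zero _ hmono₂ _
    (hz i (by simpa using hi)))]
  have hset : {k : ℕ × ℕ | μ₁ k.1 * μ₂ k.2 ≤ x} =
      (((Finset.range N).sigma fun i => (finite_le_of_tendsto μ₂ htend₂ (x / μ₁ i)).toFinset).map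
        (Equiv.sigmaEquivProd ℕ ℕ).toEmbedding : Finset (ℕ × ℕ)) := by
    ext ⟨i, j⟩
    have hiff : μ₁ i * μ₂ j ≤ x ↔ μ₂ j ≤ x / μ₁ i := by
      rw [le_div_iff₀ (hpos₁ i), mul_comm]
    have : μ₂ j ≤ x / μ₁ i → i < N := by
      intro h
      by_contra hi
      exact absurd (hz i (not_lt.1 hi)) (not_lt.2 ((hmono₂ (Nat.zero_le j)).trans h))
    simp [hiff]
    exact this
  rw [hset, Nat.card_coe_set_eq, Set.ncard_coe_finset, Finset.card_map, Finset.card_sigma]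
  push_cast
  refine Finset.sum_congr rfl fun i _ => ?_
  unfold countingFn
  rw [Nat.card_coe_set_eq, Set.ncard_eq_toFinset_card _ (finite_le_of_tendsto μ₂ htend₂ _)]

theorem counting_bound (μ₂ : ℕ → ℝ) (hmono₂ : Monotone μ₂) (hpos₂ : ∀ k, 0 < μ₂ k)
    (htend₂ : Tendsto μ₂ atTop atTop) (α B b : ℝ) (hα : 0 < α) (hB : 0 < B) (hb : 0 ≤ b)
    (hM₂ : (countingFn μ₂) ~[atTop] fun x => B * x ^ α * Real.log x ^ b) :
    ∃ C, 0 < C ∧ ∀ y, 0 < y → countingFn μ₂ y ≤ C * y ^ α * (max 1 (Real.log y)) ^ b := by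
  obtain ⟨C, hC0, hC⟩ := hM₂.isBigO.exists_pos
  rw [IsBigOWith] at hC
  obtain ⟨Y, hY⟩ := eventually_atTop.1 (hC.and (eventually_ge_atTop 1))
  have hm : 0 < μ₂ 0 ^ α := Real.rpow_pos_of_pos (hpos₂ 0) _
  have hn := countingFn_nonneg μ₂ Y
  refine ⟨C * B + countingFn μ₂ Y / μ₂ 0 ^ α, by positivity, fun y hy => ?_⟩
  have hya : 0 < y ^ α := Real.rpow_pos_of_pos hy _
  have hL : 1 ≤ max 1 (Real.log y) ^ b := Real.one_le_rpow (le_max_left _ _) hb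
  rcases le_or_gt Y y with h | h
  · obtain ⟨h1, h2⟩ := hY y h
    have hl := Real.log_nonneg h2
    rw [Real.norm_of_nonneg (countingFn_nonneg _ _), Real.norm_of_nonneg (by positivity)] at h1
    calc _ ≤ _ := h1
      _ = (C * B) * y ^ α * Real.log y ^ b := by ring
      _ ≤ _ := by
        gcongr
        · exact le_add_of_nonneg_right (by positivity)
        · exact le_max_right _ _
  · rcases lt_or_ge y (μ₂ 0) with h0 | h0
    · rw [countingFn_zero _ hmono₂ _ h0]; positivity
    · calc _ ≤ countingFn μ₂ Y := countingFn_mono _ htend₂ h.le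
        _ = countingFn μ₂ Y / μ₂ 0 ^ α * μ₂ 0 ^ α * 1 := by field_simp
        _ ≤ _ := by
          gcongr
          · exact le_add_of_nonneg_left (by positivity)
          · exact (hpos₂ 0).le

theorem term_tendsto (F : ℝ → ℝ) (α B b m : ℝ) (hB : 0 < B) (hm : 0 < m)
    (hM₂ : F ~[atTop] fun x => B * x ^ α * Real.log x ^ b) :
    Tendsto (fun x => F (x / m) / (x ^ α * Real.log x ^ b)) atTop (nhds (B * m ^ (-α))) := by
  have hdiv : Tendsto (fun x : ℝ => x / m) atTop atTop := tendsto_id.atTop_div_const hm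
  have h1 : Tendsto (fun x => F x / (B * x ^ α * Real.log x ^ b)) atTop (nhds 1) := by
    refine (isEquivalent_iff_tendsto_one ?_).1 hM₂
    filter_upwards [eventually_gt_atTop 1] with x hx
    have := Real.log_pos hx
    have : 0 < x := by linarith
    positivity
  have h2 := h1.comp hdiv
  have h3 : Tendsto (fun x => Real.log (x / m) / Real.log x) atTop (nhds 1) := by
    have : Tendsto (fun x => 1 - Real.log m / Real.log x) atTop (nhds (1 - 0)) :=
      tendsto_const_nhds.sub (Real.tendsto_log_atTop.const_div_atTop _)
    rw [sub_zero] at this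
    refine this.congr' ?_
    filter_upwards [eventually_gt_atTop 1] with x hx
    have := Real.log_pos hx
    rw [Real.log_div (by linarith) hm.ne']
    field_simp
  have h4 : Tendsto (fun x => (Real.log (x / m) / Real.log x) ^ b) atTop (nhds 1) := by
    simpa using h3.rpow_const (p := b) (Or.inl one_ne_zero)
  have h5 := (h2.mul h4).const_mul (B * m ^ (-α))
  simp only [mul_one] at h5
  refine h5.congr' ?_
  filter_upwards [eventually_gt_atTop 1, hdiv.eventually_gt_atTop 1] with x hx hxm
  have l1 := Real.log_pos hx
  have l2 := Real.log_pos hxm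
  have hx0 : 0 < x := by linarith
  simp only [Function.comp]
  rw [Real.div_rpow l2.le l1.le, Real.div_rpow hx0.le hm.le, Real.rpow_neg hm.le]
  have := Real.rpow_pos_of_pos l1 b
  have := Real.rpow_pos_of_pos l2 b
  have := Real.rpow_pos_of_pos hx0 α
  have := Real.rpow_pos_of_pos hm α
  field_simp

theorem prod_counting_two_sequences_dominated
    (μ₁ μ₂ : ℕ → ℝ)
    (hmono₁ : Monotone μ₁) (hmono₂ : Monotone μ₂)
    (hpos₁ : ∀ k, 0 < μ₁ k) (hpos₂ : ∀ k, 0 < μ₂ k)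
    (htend₁ : Tendsto μ₁ atTop atTop) (htend₂ : Tendsto μ₂ atTop atTop)
    (τ α B b : ℝ) (hτ : 0 ≤ τ) (hτα : τ < α) (hB : 0 < B) (hb : 0 ≤ b)
    (hM₁ : (countingFn μ₁) =O[atTop] fun x => x ^ τ)
    (hM₂ : (countingFn μ₂) ~[atTop] fun x => B * x ^ α * Real.log x ^ b) :
    Summable (fun k => (μ₁ k) ^ (-α)) ∧
    (fun x : ℝ => (Nat.card {k : ℕ × ℕ | μ₁ k.1 * μ₂ k.2 ≤ x} : ℝ)) ~[atTop]
      fun x => (B * ∑' k, (μ₁ k) ^ (-α)) * x ^ α * Real.log x ^ b := by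
  have hS := summable_aux μ₁ hmono₁ hpos₁ htend₁ τ α hτ hτα hM₁
  refine ⟨hS, ?_⟩
  have hSpos : 0 < ∑' k, (μ₁ k) ^ (-α) :=
    hS.tsum_pos (fun k => Real.rpow_nonneg (hpos₁ k).le _) 0 (Real.rpow_pos_of_pos (hpos₁ 0) _)
  obtain ⟨C, hC0, hC⟩ := counting_bound μ₂ hmono₂ hpos₂ htend₂ α B b (by linarith) hB hb hM₂
  have key : Tendsto (fun x => ∑' k, countingFn μ₂ (x / μ₁ k) / (x ^ α * Real.log x ^ b)) atTop
      (nhds (∑' k, B * μ₁ k ^ (-α))) := by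
    refine tendsto_tsum_of_dominated_convergence (bound := fun k => C * 2 ^ b * μ₁ k ^ (-α))
      (hS.mul_left _) (fun k => term_tendsto _ α B b _ hB (hpos₁ k) hM₂) ?_
    filter_upwards [eventually_gt_atTop 1, Real.tendsto_log_atTop.eventually_ge_atTop 1,
      Real.tendsto_log_atTop.eventually_ge_atTop (-Real.log (μ₁ 0))] with x hx hl1 hl2 k
    have hx0 : 0 < x := by linarith
    have hl0 : 0 < Real.log x := by linarith
    have hk := hpos₁ k
    rw [Real.norm_of_nonneg (div_nonneg (countingFn_nonneg _ _) (by positivity)),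
      div_le_iff₀ (by positivity)]
    have hmax : max 1 (Real.log (x / μ₁ k)) ≤ 2 * Real.log x := by
      refine max_le (by linarith) ?_
      rw [Real.log_div hx0.ne' hk.ne']
      have := Real.log_le_log (hpos₁ 0) (hmono₁ (Nat.zero_le k))
      linarith
    calc _ ≤ _ := hC _ (div_pos hx0 hk)
      _ ≤ C * (x / μ₁ k) ^ α * (2 * Real.log x) ^ b := by
        gcongr
      _ = _ := by
        rw [Real.div_rpow hx0.le hk.le, Real.mul_rpow (by norm_num) hl0.le, Real.rpow_neg hk.le]
        ring
  rw [tsum_mul_left] at key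
  have hD : 0 < B * ∑' k, (μ₁ k) ^ (-α) := mul_pos hB hSpos
  refine (isEquivalent_iff_tendsto_one ?_).2 ?_
  · filter_upwards [eventually_gt_atTop 1] with x hx
    have := Real.log_pos hx
    have : 0 < x := by linarith
    positivity
  · have h := key.div_const (B * ∑' k, (μ₁ k) ^ (-α))
    rw [div_self hD.ne'] at h
    refine h.congr fun x => ?_
    simp only [Pi.div_apply]
    rw [card_prod_eq μ₁ μ₂ hmono₂ hpos₁ hpos₂ htend₁ htend₂ x, tsum_div_const, div_div]
    congr 1
    ring
end

section
/- Let p ≥ 1 and for j = 1,…,p let (λ^{(j)}_k)_{k≥1} be a nondecreasing sequence of positive real numbers tending to infinity, with counting function N_j(λ) = #{k ∈ ℕ_{≥1} : λ^{(j)}_k ≤ λ}. Suppose there exist real numbers 0 ≤ τ < η < α and an index l ∈ {1,…,p} such that N_j(λ) = O(λ^τ) as λ → ∞ for every j ≠ l, and N_l(λ) = A_l λ^α + O(λ^η) as λ → ∞ with A_l > 0. Then for every j ≠ l the series Σ_{k=1}^∞ (λ^{(j)}_k)^{-α} converges, and the product counting function N(λ) = #{(k_1,…,k_p) ∈ ℕ_{≥1}^p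 : λ^{(1)}_{k_1} ⋯ λ^{(p)}_{k_p} ≤ λ} satisfies N(λ) = A λ^α + O(λ^η) as λ → ∞, where A = A_l · ∏_{j ≠ l} (Σ_{k=1}^∞ (λ^{(j)}_k)^{-α}). -/
open Filter Asymptotics Real

lemma aux_hasSum_pi : ∀ (n : ℕ) (g : Fin n → ℕ → ℝ), (∀ i k, 0 ≤ g i k) →
    (∀ i, Summable (g i)) →
    HasSum (fun m : Fin n → ℕ => ∏ i, g i (m i)) (∏ i, ∑' k, g i k) := by
  intro n
  induction n with
  | zero =>
    intro g _ _
    simp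
  | succ n ih =>
    intro g hg hs
    have h1 := ih (fun i => g i.succ) (fun i k => hg _ _) (fun i => hs _)
    have h0 := (hs 0).hasSum
    have hsum := (hs 0).mul_of_nonneg h1.summable (fun k => hg 0 k)
      (fun m => Finset.prod_nonneg fun i _ => hg _ _)
    have h2 := h0.mul h1 hsum
    rw [← (Fin.consEquiv (fun _ : Fin (n+1) => ℕ)).hasSum_iff, Fin.prod_univ_succ]
    have he : (fun m : Fin (n+1) → ℕ => ∏ i, g i (m i)) ∘ (Fin.consEquiv (fun _ : Fin (n+1) => ℕ))
        = fun x : ℕ × (Fin n → ℕ) => g 0 x.1 * ∏ i, g i.succ (x.2 i) := by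
      funext x
      simp [Fin.prod_univ_succ, Fin.consEquiv]
    rw [he]
    exact h2

lemma aux_count_tsum {ι : Type} (S : Set ι) :
    ((Nat.card S : ℕ) : ℝ) = ∑' i, S.indicator (fun _ => (1:ℝ)) i := by
  rw [← tsum_subtype, tsum_const]; simp

lemma aux_finite_s3 (f : ℕ → ℝ) (ht : Tendsto f atTop atTop) (x : ℝ) :
    {k : ℕ | f k ≤ x}.Finite := by
  obtain ⟨n, hn⟩ := eventually_atTop.1 (ht.eventually_gt_atTop x)
  refine (Set.finite_lt_nat n).subset fun k hk => ?_
  by_contra h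
  exact absurd (hn k (by simpa using h)) (not_lt.2 hk)

lemma aux_summable (f : ℕ → ℝ) (hm : Monotone f) (hp : ∀ k, 0 < f k)
    (ht : Tendsto f atTop atTop) (τ s : ℝ) (hτ : 0 ≤ τ) (hs : τ < s)
    (hO : (countingFn f) =O[atTop] fun x => x ^ τ) :
    Summable fun k => (f k) ^ (-s) := by
  obtain ⟨C, hC, hb⟩ := hO.exists_pos
  have hb' := ht.eventually (hb.bound)
  set t := (τ + s) / 2 with htdef
  have htp : 0 < t := by linarith
  have hts : t < s := by linarith
  have hst : 1 < s / t := by rwa [one_lt_div htp]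
  have hsum : Summable fun k : ℕ => C ^ (s/t) * (((k + 1 : ℕ) : ℝ) ^ (s / t))⁻¹ :=
    (((summable_nat_add_iff 1).2 (Real.summable_nat_rpow_inv.2 hst))).mul_left _
  refine hsum.of_norm_bounded_eventually_nat ?_
  filter_upwards [hb', ht.eventually_ge_atTop 1] with k hk h1
  have hcard : ((k + 1 : ℕ) : ℝ) ≤ countingFn f (f k) := by
    unfold countingFn
    have : (Set.Iic k).ncard ≤ ({j : ℕ | f j ≤ f k}).ncard :=
      Set.ncard_le_ncard (fun j hj => hm hj) (aux_finite_s3 f ht _)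
    rw [← Finset.coe_Iic, Set.ncard_coe_finset, Nat.card_Iic] at this
    exact_mod_cast this
  have h2 : ((k + 1 : ℕ) : ℝ) ≤ C * f k ^ t := by
    have e1 : countingFn f (f k) ≤ C * f k ^ τ := by
      rw [Real.norm_of_nonneg (rpow_nonneg (hp k).le _)] at hk
      exact (le_abs_self _).trans hk
    have e2 : f k ^ τ ≤ f k ^ t := rpow_le_rpow_of_exponent_le h1 (by linarith)
    exact hcard.trans (e1.trans (mul_le_mul_of_nonneg_left e2 hC.le))
  have h3 : (((k + 1 : ℕ) : ℝ)) ^ (s/t) ≤ C ^ (s/t) * f k ^ s := by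
    have := rpow_le_rpow (by positivity) h2 (by positivity : 0 ≤ s / t)
    rwa [mul_rpow hC.le (rpow_nonneg (hp k).le _), ← rpow_mul (hp k).le,
      mul_div_cancel₀ _ htp.ne'] at this
  rw [Real.norm_of_nonneg (rpow_nonneg (hp k).le _), rpow_neg (hp k).le]
  have hfs : 0 < f k ^ s := rpow_pos_of_pos (hp k) _
  have hks : 0 < (((k + 1 : ℕ) : ℝ)) ^ (s/t) := rpow_pos_of_pos (by positivity) _
  rw [← div_eq_mul_inv, le_div_iff₀ hks, inv_mul_le_iff₀ hfs]
  linarith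

lemma aux_global (f : ℕ → ℝ) (hm : Monotone f) (hp : ∀ k, 0 < f k)
    (ht : Tendsto f atTop atTop) (η α A : ℝ) (hη : 0 < η) (hηα : η < α) (hA : 0 < A)
    (hl : (fun x => countingFn f x - A * x ^ α) =O[atTop] fun x => x ^ η) :
    ∃ C, 0 < C ∧ ∀ x, 0 < x → |countingFn f x - A * x ^ α| ≤ C * x ^ η := by
  obtain ⟨C, hC, hb⟩ := hl.exists_pos
  obtain ⟨X, hX⟩ := eventually_atTop.1 hb.bound
  -- middle range
  set Y := max X (f 0) with hY
  have hYp : 0 < Y := lt_max_of_lt_right (hp 0)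
  have hmonoN : ∀ x y, x ≤ y → countingFn f x ≤ countingFn f y := by
    intro x y hxy
    unfold countingFn
    exact_mod_cast Set.ncard_le_ncard (fun j (hj : f j ≤ x) => hj.trans hxy) (aux_finite_s3 f ht y)
  have hN0 : ∀ x, 0 ≤ countingFn f x := fun x => by unfold countingFn; positivity
  set D := A * Y ^ (α - η) with hD
  set E := countingFn f Y / (f 0) ^ η with hE
  have hf0 : 0 < (f 0) ^ η := rpow_pos_of_pos (hp 0) _
  have hD0 : 0 < D := mul_pos hA (rpow_pos_of_pos hYp _)
  have hE0 : 0 ≤ E := div_nonneg (hN0 _) hf0.le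
  refine ⟨C + D + E, by positivity, fun x hx => ?_⟩
  have hxη : 0 < x ^ η := rpow_pos_of_pos hx _
  rcases le_total Y x with h | h
  · have := hX x ((le_max_left _ _).trans h)
    rw [Real.norm_eq_abs, Real.norm_of_nonneg hxη.le] at this
    nlinarith [mul_pos hD0 hxη, mul_nonneg hE0 hxη.le]
  · have e1 : A * x ^ α ≤ D * x ^ η := by
      have : x ^ α = x ^ (α - η) * x ^ η := by rw [← rpow_add hx]; ring_nf
      rw [this, hD, ← mul_assoc]
      gcongr
    have e2 : countingFn f x ≤ E * x ^ η := by
      rcases lt_or_ge x (f 0) with h0 | h0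
      · have : countingFn f x = 0 := by
          unfold countingFn
          have : {k : ℕ | f k ≤ x} = ∅ := by
            ext k; simpa using h0.trans_le (hm (Nat.zero_le k))
          rw [this]; simp
        rw [this]; positivity
      · have : (f 0) ^ η ≤ x ^ η := rpow_le_rpow (hp 0).le h0 hη.le
        calc countingFn f x ≤ countingFn f Y := hmonoN _ _ h
          _ = E * f 0 ^ η := by rw [hE]; field_simp
          _ ≤ _ := by gcongr
    have e3 : 0 ≤ A * x ^ α := mul_nonneg hA.le (rpow_nonneg hx.le _)
    have := hN0 x
    rw [abs_le]
    constructor <;> nlinarith [mul_pos hD0 hxη, mul_nonneg hE0 hxη.le, mul_pos hC hxη]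

theorem prod_counting_asymptotics_single_dominant
    {p : ℕ} (hp : 1 ≤ p) (seq : Fin p → ℕ → ℝ)
    (hmono : ∀ j, Monotone (seq j)) (hpos : ∀ j k, 0 < seq j k)
    (htend : ∀ j, Tendsto (seq j) atTop atTop)
    (τ η α : ℝ) (hτ : 0 ≤ τ) (hτη : τ < η) (hηα : η < α)
    (l : Fin p) (Al : ℝ) (hAl : 0 < Al)
    (hrest : ∀ j, j ≠ l → (countingFn (seq j)) =O[atTop] fun x => x ^ τ)
    (hl : (fun x => countingFn (seq l) x - Al * x ^ α) =O[atTop] fun x => x ^ η) :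
    (∀ j, j ≠ l → Summable fun k => (seq j k) ^ (-α)) ∧
    (fun x => prodCountingFn seq x -
        (Al * ∏ j ∈ Finset.univ.erase l, ∑' k, (seq j k) ^ (-α)) * x ^ α)
      =O[atTop] fun x => x ^ η := by
  have hη : 0 < η := hτ.trans_lt hτη
  have hsα : ∀ j, j ≠ l → Summable fun k => (seq j k) ^ (-α) := fun j hj =>
    aux_summable _ (hmono j) (hpos j) (htend j) τ α hτ (hτη.trans hηα) (hrest j hj)
  have hsη : ∀ j, j ≠ l → Summable fun k => (seq j k) ^ (-η) := fun j hj =>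
    aux_summable _ (hmono j) (hpos j) (htend j) τ η hτ hτη (hrest j hj)
  refine ⟨hsα, ?_⟩
  obtain ⟨C, hC, hb⟩ := aux_global _ (hmono l) (hpos l) (htend l) η α Al hη hηα hAl hl
  obtain ⟨n, rfl⟩ : ∃ n, p = n + 1 := ⟨p - 1, by omega⟩
  set μ : (Fin n → ℕ) → ℝ := fun m => ∏ i, seq (l.succAbove i) (m i) with hμ
  have hμp : ∀ m, 0 < μ m := fun m => Finset.prod_pos fun i _ => hpos _ _
  have hprod : ∀ s : ℝ, (fun m : Fin n → ℕ => ∏ i, seq (l.succAbove i) (m i) ^ (-s))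
      = fun m => μ m ^ (-s) := fun s => by
    ext m
    exact Real.finsetProd_rpow _ _ (fun i _ => (hpos _ _).le) _
  have Hα := aux_hasSum_pi n (fun i k => seq (l.succAbove i) k ^ (-α))
    (fun i k => rpow_nonneg (hpos _ _).le _) (fun i => hsα _ (Fin.succAbove_ne l i))
  have Hη := aux_hasSum_pi n (fun i k => seq (l.succAbove i) k ^ (-η))
    (fun i k => rpow_nonneg (hpos _ _).le _) (fun i => hsη _ (Fin.succAbove_ne l i))
  rw [hprod] at Hα Hη
  have hS : ∏ j ∈ Finset.univ.erase l, ∑' k, (seq j k) ^ (-α)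
      = ∏ i : Fin n, ∑' k, seq (l.succAbove i) k ^ (-α) := by
    have : (Finset.univ.erase l) = Finset.univ.map l.succAboveEmb := by
      ext j
      simp only [Finset.mem_erase, Finset.mem_univ, and_true, Finset.mem_map, true_and]
      exact Fin.exists_succAbove_eq_iff.symm
    rw [this, Finset.prod_map]; rfl
  rw [hS]
  set S := ∏ i : Fin n, ∑' k, seq (l.succAbove i) k ^ (-α) with hSdef
  set T := ∏ i : Fin n, ∑' k, seq (l.succAbove i) k ^ (-η) with hTdef
  refine IsBigO.of_bound (C * T) ?_
  filter_upwards [eventually_gt_atTop 0] with x hx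
  rw [Real.norm_eq_abs, Real.norm_of_nonneg (rpow_nonneg hx.le _)]
  -- the remainder terms
  have hterm : ∀ m, |countingFn (seq l) (x / μ m) - Al * x ^ α * μ m ^ (-α)|
      ≤ C * x ^ η * μ m ^ (-η) := fun m => by
    have := hb (x / μ m) (div_pos hx (hμp m))
    rw [div_rpow hx.le (hμp m).le, div_rpow hx.le (hμp m).le] at this
    rw [rpow_neg (hμp m).le, rpow_neg (hμp m).le, mul_assoc, mul_assoc]
    exact this
  have Hα' := Hα.mul_left (Al * x ^ α)
  have Hη' := Hη.mul_left (C * x ^ η)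
  have hRs : Summable fun m => countingFn (seq l) (x / μ m) - Al * x ^ α * μ m ^ (-α) :=
    Hη'.summable.of_norm_bounded hterm
  have hNs : Summable fun m => countingFn (seq l) (x / μ m) := by
    simpa using hRs.add Hα'.summable
  have hcount : prodCountingFn seq x = ∑' m, countingFn (seq l) (x / μ m) := by
    unfold prodCountingFn
    rw [aux_count_tsum]
    set F : (Fin n → ℕ) × ℕ → ℝ := fun q => {k : ℕ | seq l k ≤ x / μ q.1}.indicator
      (fun _ => (1:ℝ)) q.2 with hF
    have hinner : ∀ m, HasSum (fun k => F (m, k)) (countingFn (seq l) (x / μ m)) := fun m => by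
      unfold countingFn
      rw [aux_count_tsum]
      refine Summable.hasSum ?_
      exact summable_of_hasFiniteSupport ((aux_finite_s3 _ (htend l) (x / μ m)).subset
        (Set.support_indicator_subset))
    have hFs : Summable F := by
      rw [summable_prod_of_nonneg (fun q => Set.indicator_nonneg (fun _ _ => zero_le_one) _)]
      refine ⟨fun m => (hinner m).summable, ?_⟩
      exact (funext fun m => (hinner m).tsum_eq : (fun m => ∑' k, F (m, k)) = _) ▸ hNs
    have h1 := hFs.tsum_prod
    rw [(funext fun m => (hinner m).tsum_eq : (fun m => ∑' k, F (m, k)) = _)] at h1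
    rw [← h1]
    rw [← ((Equiv.prodComm _ _).trans (Fin.insertNthEquiv (fun _ : Fin (n+1) => ℕ) l)).tsum_eq]
    refine tsum_congr fun q => ?_
    obtain ⟨m, k⟩ := q
    simp only [hF, Set.indicator_apply, Set.mem_ofPred_eq]
    refine if_congr ?_ rfl rfl
    rw [le_div_iff₀ (hμp m), Fin.prod_univ_succAbove _ l]
    simp [hμ, Fin.insertNthEquiv]
  have hfin : prodCountingFn seq x - Al * S * x ^ α
      = ∑' m, (countingFn (seq l) (x / μ m) - Al * x ^ α * μ m ^ (-α)) := by
    rw [hNs.tsum_sub Hα'.summable, Hα'.tsum_eq, hcount]; ring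
  rw [hfin]
  have := tsum_of_norm_bounded (f := fun m =>
    countingFn (seq l) (x / μ m) - Al * x ^ α * μ m ^ (-α)) Hη' hterm
  rw [Real.norm_eq_abs] at this
  linarith
end

section
/- Let p ≥ 1 and for j = 1,…,p let (λ^{(j)}_k)_{k≥1} be a nondecreasing sequence of positive real numbers tending to infinity, with counting function N_j(λ) = #{k ∈ ℕ_{≥1} : λ^{(j)}_k ≤ λ}. Suppose there exist real numbers 0 ≤ τ < α, an integer 1 ≤ ν ≤ p, and distinct indices j_1,…,j_ν such that N_{j_q}(λ) = A_{j_q} λ^α + O(λ^τ) as λ → ∞ with A_{j_q} > 0 for q = 1,…,ν, and N_j(λ) = O(λ^τ) as λ → ∞ for every j ∉ {j_1,…,j_ν}. Then there exist a real number η < α and real constants C_0, C_1, …, C_{ν−2} such that the product counting function N(λ) = #{(k_1,…,k_p) ∈ ℕ_{≥1}^p : λ^{(1)}_{k_1} ⋯ λ^{(p)}_{k_p} ≤ λ} satisfies N(λ) = λ^α ( A (α log λ)^{ν−1}/(ν−1)! + Σ_{q=0}^{ν−2} C_q log^q λ ) + O(λ^η) as λ → ∞, where A = (∏_{q=1}^ν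 A_{j_q}) · ∏_{j ∉ {j_1,…,j_ν}} (Σ_{k=1}^∞ (λ^{(j)}_k)^{-α}). -/
open Filter Asymptotics Real

namespace PC

/-- A positive family with finite sublevel sets. -/
structure Fam {ι : Type} (f : ι → ℝ) : Prop where
  pos : ∀ i, 0 < f i
  fin : ∀ x, {i | f i ≤ x}.Finite

/-- Counting function of a family. -/
noncomputable def cnt {ι : Type} (f : ι → ℝ) (x : ℝ) : ℝ := Nat.card {i | f i ≤ x}

/-- Sublevel set as a finset. -/
noncomputable def Fam.lvl {ι : Type} {f : ι → ℝ} (hf : Fam f) (x : ℝ) : Finset ι :=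
  (hf.fin x).toFinset

variable {ι κ : Type} {f : ι → ℝ} {g : κ → ℝ}

lemma Fam.mem_lvl (hf : Fam f) {x : ℝ} {i : ι} : i ∈ hf.lvl x ↔ f i ≤ x := by
  simp [Fam.lvl]

lemma Fam.cnt_eq (hf : Fam f) (x : ℝ) : cnt f x = (hf.lvl x).card := by
  unfold cnt Fam.lvl
  rw [Nat.card_coe_set_eq, Set.ncard_eq_toFinset_card _ (hf.fin x)]

lemma Fam.mono (hf : Fam f) : Monotone (cnt f) := by
  intro x y hxy
  rw [hf.cnt_eq, hf.cnt_eq]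
  exact_mod_cast Finset.card_le_card (fun i hi => by
    rw [hf.mem_lvl] at *; exact hi.trans hxy)

lemma Fam.nonneg (x : ℝ) : 0 ≤ cnt f x := Nat.cast_nonneg _

lemma Fam.lower (hf : Fam f) : ∃ a : ℝ, 0 < a ∧ a ≤ 1 ∧ ∀ i, a < f i := by
  by_cases hne : ({i | f i ≤ 1} : Set ι).Nonempty
  · obtain ⟨i0, hi0, hmin⟩ := Set.exists_min_image _ f (hf.fin 1) hne
    have h0 := hf.pos i0
    simp only [Set.mem_ofPred_eq] at hi0 hmin
    refine ⟨f i0 / 2, by positivity, by linarith, fun i => ?_⟩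
    by_cases hi : f i ≤ 1
    · have := hmin i hi; linarith
    · push Not at hi; linarith
  · refine ⟨1, one_pos, le_rfl, fun i => ?_⟩
    by_contra h
    push Not at h
    exact hne ⟨i, h⟩

lemma Fam.cnt_zero (hf : Fam f) {a x : ℝ} (ha : ∀ i, a < f i) (hx : x ≤ a) : cnt f x = 0 := by
  rw [hf.cnt_eq]
  have : hf.lvl x = ∅ := by
    ext i; rw [hf.mem_lvl]; simp; exact hx.trans_lt (ha i)
  simp [this]

lemma Fam.prod (hf : Fam f) (hg : Fam g) : Fam (fun p : ι × κ => f p.1 * g p.2) := by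
  refine ⟨fun p => mul_pos (hf.pos _) (hg.pos _), fun x => ?_⟩
  obtain ⟨a, ha, -, hfa⟩ := hf.lower
  obtain ⟨b, hb, -, hgb⟩ := hg.lower
  refine ((hf.fin (x / b)).prod (hg.fin (x / a))).subset ?_
  rintro ⟨i, k⟩ h
  simp only [Set.mem_ofPred_eq, Set.mem_prod] at *
  constructor
  · rw [le_div_iff₀ hb]
    exact le_trans (mul_le_mul_of_nonneg_left (hgb k).le (hf.pos i).le) h
  · rw [le_div_iff₀ ha, mul_comm]
    exact le_trans (mul_le_mul_of_nonneg_right (hfa i).le (hg.pos k).le) h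

lemma Fam.reindex (hf : Fam f) (e : κ ≃ ι) : Fam (fun k => f (e k)) := by
  refine ⟨fun k => hf.pos _, fun x => ?_⟩
  exact (hf.fin x).preimage (e.injective.injOn)

lemma cnt_reindex (e : κ ≃ ι) (x : ℝ) : cnt (fun k => f (e k)) x = cnt f x := by
  unfold cnt
  congr 1
  exact Nat.card_congr (e.subtypeEquiv (fun k => Iff.rfl))

lemma polylog (H : Polynomial ℝ) {ε : ℝ} (hε : 0 < ε) :
    ∃ K, 0 ≤ K ∧ ∀ t : ℝ, 0 < t → |H.eval (log t)| ≤ K * (t ^ ε + t ^ (-ε)) := by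
  have key : ∀ j : ℕ, ∀ t : ℝ, 0 < t →
      |log t| ^ j ≤ (j.factorial / ε ^ j) * (t ^ ε + t ^ (-ε)) := by
    intro j t ht
    have h1 := Real.pow_div_factorial_le_exp (ε * |log t|) (by positivity) j
    have h2 : exp (ε * |log t|) ≤ t ^ ε + t ^ (-ε) := by
      rw [rpow_def_of_pos ht, rpow_def_of_pos ht]
      rcases abs_cases (log t) with ⟨h, _⟩ | ⟨h, _⟩ <;> rw [h]
      · rw [mul_comm ε]; linarith [exp_pos (log t * -ε)]
      · rw [show ε * -log t = log t * -ε by ring]; linarith [exp_pos (log t * ε)]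
    have h3 := h1.trans h2
    rw [mul_pow, div_le_iff₀ (by positivity)] at h3
    rw [div_mul_eq_mul_div, le_div_iff₀ (by positivity)]
    linarith
  refine ⟨∑ j ∈ Finset.range (H.natDegree + 1), |H.coeff j| * (j.factorial / ε ^ j),
    by positivity, fun t ht => ?_⟩
  rw [Polynomial.eval_eq_sum_range, Finset.sum_mul]
  refine (Finset.abs_sum_le_sum_abs _ _).trans (Finset.sum_le_sum fun j _ => ?_)
  rw [abs_mul, abs_pow, mul_assoc]
  exact mul_le_mul_of_nonneg_left (key j t ht) (abs_nonneg _)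

lemma polylog_ge (H : Polynomial ℝ) {ε a : ℝ} (hε : 0 < ε) (ha : 0 < a) :
    ∃ K, 0 ≤ K ∧ ∀ t : ℝ, a ≤ t → |H.eval (log t)| ≤ K * t ^ ε := by
  obtain ⟨K, hK, h⟩ := polylog H hε
  refine ⟨K * (1 + a ^ (-(2 * ε))), by positivity, fun t ht => ?_⟩
  have h0 : 0 < t := ha.trans_le ht
  refine (h t h0).trans ?_
  rw [mul_assoc]
  refine mul_le_mul_of_nonneg_left ?_ hK
  have : t ^ (-ε) = t ^ (-(2*ε)) * t ^ ε := by rw [← rpow_add h0]; congr 1; ring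
  rw [this, add_mul, one_mul]
  have h5 : t ^ (-(2*ε)) ≤ a ^ (-(2*ε)) := rpow_le_rpow_of_nonpos ha ht (by linarith)
  gcongr

/-- Asymptotics with power saving. -/
def Asym (f : ι → ℝ) (α : ℝ) (P : Polynomial ℝ) : Prop :=
  ∃ η, 0 ≤ η ∧ η < α ∧ (fun x => cnt f x - x ^ α * P.eval (log x)) =O[atTop] fun x => x ^ η

lemma Asym.global {α : ℝ} {P : Polynomial ℝ} (hf : Fam f) (h : Asym f α P) :
    ∃ η₀, 0 ≤ η₀ ∧ η₀ < α ∧ ∀ η, η₀ ≤ η → η < α → ∃ K, 0 ≤ K ∧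
      ∀ x, 0 < x → |cnt f x - x ^ α * P.eval (log x)| ≤ K * x ^ η := by
  obtain ⟨η₀, h0, h1, hO⟩ := h
  refine ⟨η₀, h0, h1, fun η hη hηα => ?_⟩
  obtain ⟨c, hc, hb⟩ := hO.exists_pos
  obtain ⟨X, hX⟩ := eventually_atTop.1 hb.bound
  obtain ⟨a, ha, ha1, hfa⟩ := hf.lower
  obtain ⟨K, hK, hp⟩ := polylog P (sub_pos.2 hηα)
  set Y := max X 1 with hY
  have hη0 : 0 ≤ η := h0.trans hη
  have hY1 : 1 ≤ Y := le_max_right _ _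
  have hcY := Fam.nonneg (f := f) Y
  refine ⟨c + (cnt f Y * a ^ (-η) + K * (Y ^ (2 * (α - η)) + 1)), by positivity, fun x hx => ?_⟩
  have hxη : 0 < x ^ η := rpow_pos_of_pos hx _
  rcases le_or_gt Y x with hxY | hxY
  · have := hX x ((le_max_left _ _).trans hxY)
    rw [norm_eq_abs, norm_of_nonneg (by positivity)] at this
    refine this.trans ?_
    have h2 : x ^ η₀ ≤ x ^ η := rpow_le_rpow_of_exponent_le (hY1.trans hxY) hη
    have h3 : c * x ^ η₀ ≤ c * x ^ η := by gcongr
    refine h3.trans ?_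
    gcongr
    have : 0 ≤ (cnt f Y * a ^ (-η) + K * (Y ^ (2 * (α - η)) + 1)) := by positivity
    linarith
  · have e1 : |cnt f x| ≤ cnt f Y * a ^ (-η) * x ^ η := by
      rw [abs_of_nonneg (Fam.nonneg x)]
      rcases le_or_gt x a with hxa | hxa
      · rw [hf.cnt_zero hfa hxa]; positivity
      · refine (hf.mono hxY.le).trans ?_
        have : 1 ≤ a ^ (-η) * x ^ η := by
          rw [rpow_neg ha.le, ← div_eq_inv_mul, one_le_div (by positivity)]
          exact rpow_le_rpow ha.le hxa.le hη0
        rw [mul_assoc]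
        exact le_mul_of_one_le_right hcY this
    have e2 : |x ^ α * P.eval (log x)| ≤ K * (Y ^ (2 * (α - η)) + 1) * x ^ η := by
      rw [abs_mul, abs_of_pos (rpow_pos_of_pos hx _)]
      have := mul_le_mul_of_nonneg_left (hp x hx) (rpow_pos_of_pos hx α).le
      refine this.trans ?_
      have e : x ^ α * (K * (x ^ (α - η) + x ^ (-(α - η)))) =
          K * (x ^ (2 * (α - η)) + 1) * x ^ η := by
        have e3 : x ^ α = x ^ (α - η) * x ^ η := by rw [← rpow_add hx]; congr 1; ring
        have e4 : x ^ (2 * (α - η)) = x ^ (α - η) * x ^ (α - η) := by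
          rw [← rpow_add hx]; congr 1; ring
        have e5 : x ^ (α - η) ≠ 0 := (rpow_pos_of_pos hx _).ne'
        rw [rpow_neg hx.le, e4, e3]
        field_simp
      rw [e]
      have : x ^ (2 * (α - η)) ≤ Y ^ (2 * (α - η)) :=
        rpow_le_rpow hx.le hxY.le (by linarith)
      gcongr
    refine (abs_sub _ _).trans ?_
    have : 0 ≤ c * x ^ η := by positivity
    nlinarith

/-- Abel summation. -/
lemma Fam.abel (hf : Fam f) {a y : ℝ} (ha : ∀ i, a < f i) (hay : a ≤ y) {h h' : ℝ → ℝ}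
    (hd : ∀ t, a ≤ t → HasDerivAt h (h' t) t) (hc : ContinuousOn h' (Set.Ici a)) :
    ∑ i ∈ hf.lvl y, h (f i) = cnt f y * h y - ∫ t in a..y, cnt f t * h' t := by
  have hIntg : ∀ u v, a ≤ u → a ≤ v → IntervalIntegrable h' MeasureTheory.volume u v := by
    intro u v hu hv
    refine (hc.mono ?_).intervalIntegrable
    intro t ht
    exact (le_min hu hv).trans ht.1
  have h1 : ∀ t ∈ Set.uIcc a y, cnt f t * h' t =
      ∑ i ∈ hf.lvl y, Set.indicator (Set.Ici (f i)) h' t := by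
    intro t ht
    rw [Set.uIcc_of_le hay] at ht
    rw [hf.cnt_eq, ← nsmul_eq_mul, ← Finset.sum_const]
    have : hf.lvl t = (hf.lvl y).filter (fun i => f i ≤ t) := by
      ext i
      simp only [Finset.mem_filter, hf.mem_lvl]
      exact ⟨fun h => ⟨h.trans ht.2, h⟩, fun h => h.2⟩
    rw [this, Finset.sum_filter]
    refine Finset.sum_congr rfl fun i _ => ?_
    simp [Set.indicator]
  rw [intervalIntegral.integral_congr h1]
  have hii : ∀ i, IntervalIntegrable (Set.indicator (Set.Ici (f i)) h') MeasureTheory.volume a y := by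
    intro i
    have := (hIntg a y le_rfl hay)
    rw [intervalIntegrable_iff] at this ⊢
    exact this.indicator measurableSet_Ici
  rw [intervalIntegral.integral_finsetSum (fun i _ => hii i)]
  have h2 : ∀ i ∈ hf.lvl y, ∫ t in a..y, Set.indicator (Set.Ici (f i)) h' t = h y - h (f i) := by
    intro i hi
    rw [hf.mem_lvl] at hi
    have hia := (ha i).le
    have hsub : ∀ {t}, t ∈ Set.uIcc (f i) y → f i ≤ t := by
      intro t ht; rw [Set.uIcc_of_le hi] at ht; exact ht.1
    rw [← intervalIntegral.integral_add_adjacent_intervals (b := f i)]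
    · have z1 : ∫ t in a..(f i), Set.indicator (Set.Ici (f i)) h' t = 0 := by
        rw [intervalIntegral.integral_of_le hia]
        rw [MeasureTheory.integral_Ioc_eq_integral_Ioo]
        rw [MeasureTheory.setIntegral_eq_zero_of_forall_eq_zero]
        intro t ht
        simp [Set.indicator, ht.2]
      have z2 : ∫ t in (f i)..y, Set.indicator (Set.Ici (f i)) h' t = ∫ t in (f i)..y, h' t := by
        refine intervalIntegral.integral_congr fun t ht => ?_
        simp [Set.indicator, hsub ht]
      rw [z1, z2, zero_add]
      refine intervalIntegral.integral_eq_sub_of_hasDerivAt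
        (fun t ht => hd t (hia.trans (hsub ht))) (hIntg _ _ hia hay)
    · refine (hii i).mono_set ?_
      rw [Set.uIcc_of_le hia, Set.uIcc_of_le hay]; exact Set.Icc_subset_Icc_right hi
    · refine (hii i).mono_set ?_
      rw [Set.uIcc_of_le hi, Set.uIcc_of_le hay]; exact Set.Icc_subset_Icc_left hia
  rw [Finset.sum_congr rfl h2, Finset.sum_sub_distrib, Finset.sum_const, nsmul_eq_mul,
    ← hf.cnt_eq]
  ring

lemma Fam.summable (hf : Fam f) {σ β K : ℝ} (hσβ : σ < β) (hβ : 0 < β) (hK : 0 ≤ K)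
    (h : ∀ x, 0 < x → cnt f x ≤ K * x ^ σ) : Summable (fun i => f i ^ (-β)) := by
  obtain ⟨a, ha, ha1, hfa⟩ := hf.lower
  have main : ∀ y, a ≤ y → ∑ i ∈ hf.lvl y, f i ^ (-β) ≤
      K * a ^ (σ - β) + β * (K * (a ^ (σ - β) / (β - σ))) := by
    intro y hy
    have hy0 := ha.trans_le hy
    have hne : ∀ t, t ∈ Set.uIcc a y → 0 < t := fun t ht => by
      rw [Set.uIcc_of_le hy] at ht; exact ha.trans_le ht.1
    have hab := hf.abel hfa hy (h := fun t => t ^ (-β)) (h' := fun t => (-β) * t ^ (-β - 1))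
      (fun t ht => Real.hasDerivAt_rpow_const (Or.inl (ha.trans_le ht).ne'))
      (continuousOn_const.mul (continuousOn_id.rpow_const
        (fun t ht => Or.inl (ha.trans_le ht).ne')))
    rw [hab]
    have i1 : (∫ t in a..y, cnt f t * (-β * t ^ (-β - 1))) =
        -(β * ∫ t in a..y, cnt f t * t ^ (-β - 1)) := by
      rw [← intervalIntegral.integral_const_mul, ← intervalIntegral.integral_neg]
      congr 1; ext t; ring
    have i2 : ∫ t in a..y, cnt f t * t ^ (-β - 1) ≤ ∫ t in a..y, K * t ^ (σ - β - 1) := by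
      refine intervalIntegral.integral_mono_on hy ?_ ?_ ?_
      · refine (hf.mono.intervalIntegrable).mul_continuousOn ?_
        exact continuousOn_id.rpow_const (fun t ht => Or.inl (hne t ht).ne')
      · refine (ContinuousOn.intervalIntegrable ?_)
        exact continuousOn_const.mul
          (continuousOn_id.rpow_const (fun t ht => Or.inl (hne t ht).ne'))
      · intro t ht
        have h0 : 0 < t := ha.trans_le ht.1
        have := mul_le_mul_of_nonneg_right (h t h0) (rpow_pos_of_pos h0 (-β - 1)).le
        refine this.trans (le_of_eq ?_)
        rw [mul_assoc, ← rpow_add h0]; congr 2; ring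
    have i3 : ∫ t in a..y, t ^ (σ - β - 1) ≤ a ^ (σ - β) / (β - σ) := by
      rw [integral_rpow (Or.inr ⟨by linarith, fun h0 => lt_irrefl _ (hne 0 h0)⟩)]
      rw [show σ - β - 1 + 1 = σ - β by ring, ← neg_sub β σ, div_neg, ← neg_div]
      have : 0 < y ^ (-(β - σ)) := rpow_pos_of_pos hy0 _
      have h2 : 0 < β - σ := by linarith
      gcongr
      linarith
    rw [intervalIntegral.integral_const_mul] at i2
    have i4 : cnt f y * y ^ (-β) ≤ K * a ^ (σ - β) := by
      calc cnt f y * y ^ (-β) ≤ K * y ^ σ * y ^ (-β) := by gcongr; exact h y hy0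
        _ = K * y ^ (σ - β) := by rw [mul_assoc, ← rpow_add hy0]; rfl
        _ ≤ _ := by
          have := rpow_le_rpow_of_nonpos ha hy (by linarith : σ - β ≤ 0)
          gcongr
    rw [i1, sub_neg_eq_add]
    have i5 := mul_le_mul_of_nonneg_left i3 hK
    have i6 := mul_le_mul_of_nonneg_left (i2.trans i5) hβ.le
    linarith
  refine summable_of_sum_le (fun i => (rpow_pos_of_pos (hf.pos i) _).le) (fun u => ?_)
    (c := K * a ^ (σ - β) + β * (K * (a ^ (σ - β) / (β - σ))))
  have hsub : u ⊆ hf.lvl (a + ∑ i ∈ u, f i) := by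
    intro i hi
    rw [hf.mem_lvl]
    have := Finset.single_le_sum (f := f) (fun i _ => (hf.pos i).le) hi
    linarith
  refine (Finset.sum_le_sum_of_subset_of_nonneg hsub
    (fun i _ _ => (rpow_pos_of_pos (hf.pos i) _).le)).trans (main _ ?_)
  have := Finset.sum_nonneg (s := u) (fun i _ => (hf.pos i).le)
  linarith

lemma exists_antideriv (P : Polynomial ℝ) :
    ∃ Q : Polynomial ℝ, Q.derivative = P ∧ (∀ n, Q.coeff (n + 1) = P.coeff n / (n + 1)) ∧
      Q.natDegree ≤ P.natDegree + 1 := by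
  refine ⟨∑ i ∈ Finset.range (P.natDegree + 1),
    Polynomial.monomial (i + 1) (P.coeff i / (i + 1)), ?_, ?_, ?_⟩
  · conv_rhs => rw [P.as_sum_range]
    rw [Polynomial.derivative_sum]
    refine Finset.sum_congr rfl fun i _ => ?_
    rw [Polynomial.derivative_monomial]
    have : (i : ℝ) + 1 ≠ 0 := by positivity
    simp [this]
  · intro n
    rw [Polynomial.finsetSum_coeff]
    simp only [Polynomial.coeff_monomial, add_left_inj]
    rw [Finset.sum_ite_eq']
    split_ifs with h
    · rfl
    · rw [Polynomial.coeff_eq_zero_of_natDegree_lt]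
      · simp
      · rw [Finset.mem_range] at h; omega
  · refine Polynomial.natDegree_sum_le_of_forall_le _ _ fun i hi => ?_
    refine (Polynomial.natDegree_monomial_le _).trans ?_
    simp at hi ⊢; omega

lemma Fam.abel_asym (hf : Fam f) {α η η' K : ℝ} {P : Polynomial ℝ} (hη' : η' < α) (hηη : η < η')
    (hK : 0 ≤ K) (hb : ∀ x, 0 < x → |cnt f x - x ^ α * P.eval (log x)| ≤ K * x ^ η)
    (H W : Polynomial ℝ)
    (hW : W.derivative = (Polynomial.C α * P + P.derivative) * H) :
    ∃ c D, ∀ y, 1 ≤ y →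
      |∑ i ∈ hf.lvl y, f i ^ (-α) * H.eval (log (f i)) - (W.eval (log y) + c)|
        ≤ D * y ^ (η' - α) := by
  obtain ⟨a, ha, ha1, hfa⟩ := hf.lower
  set V : Polynomial ℝ := H.derivative - Polynomial.C α * H with hV
  set W2 : Polynomial ℝ := P * H - W with hW2
  have hW2d : W2.derivative = P * V := by
    rw [hW2, hV, Polynomial.derivative_sub, hW, Polynomial.derivative_mul]; ring
  set R : ℝ → ℝ := fun t => cnt f t - t ^ α * P.eval (log t) with hR
  set h : ℝ → ℝ := fun t => t ^ (-α) * H.eval (log t) with hh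
  set h' : ℝ → ℝ := fun t => t ^ (-α - 1) * V.eval (log t) with hh'
  have hlog : ∀ (Q : Polynomial ℝ) t, 0 < t →
      HasDerivAt (fun t => Q.eval (log t)) (t⁻¹ * Q.derivative.eval (log t)) t := by
    intro Q t ht
    have := (Q.hasDerivAt (log t)).comp t (Real.hasDerivAt_log ht.ne')
    rw [mul_comm]; exact this
  have hlogc : ∀ (Q : Polynomial ℝ) (s : Set ℝ), (∀ t ∈ s, 0 < t) →
      ContinuousOn (fun t => Q.eval (log t)) s := fun Q s hs t ht =>
    (hlog Q t (hs t ht)).continuousAt.continuousWithinAt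
  have hpc : ∀ (r : ℝ) (s : Set ℝ), (∀ t ∈ s, 0 < t) → ContinuousOn (fun t : ℝ => t ^ r) s :=
    fun r s hs => continuousOn_id.rpow_const (fun t ht => Or.inl (hs t ht).ne')
  have hhd : ∀ t, a ≤ t → HasDerivAt h (h' t) t := by
    intro t ht
    have h0 := ha.trans_le ht
    have := (Real.hasDerivAt_rpow_const (p := -α) (Or.inl h0.ne')).mul (hlog H t h0)
    refine this.congr_deriv ?_
    have e : t ^ (-α) = t ^ (-α - 1) * t := by
      rw [rpow_sub_one h0.ne']; field_simp
    simp only [hh', hV, Polynomial.eval_sub, Polynomial.eval_mul, Polynomial.eval_C]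
    rw [e]; field_simp; ring
  have hIci : ∀ t ∈ Set.Ici a, 0 < t := fun t ht => ha.trans_le ht
  have hhc : ContinuousOn h' (Set.Ici a) := (hpc _ _ hIci).mul (hlogc _ _ hIci)
  have hs : η' - α - 1 < -1 := by linarith
  obtain ⟨KV, hKV, hVb⟩ := polylog_ge V (sub_pos.2 hηη) ha
  obtain ⟨KH, hKH, hHb⟩ := polylog_ge H (sub_pos.2 hηη) ha
  have hRh' : ∀ t, a ≤ t → ‖R t * h' t‖ ≤ K * KV * t ^ (η' - α - 1) := by
    intro t ht
    have h0 := ha.trans_le ht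
    rw [norm_eq_abs, abs_mul, abs_mul, abs_of_pos (rpow_pos_of_pos h0 _)]
    calc |R t| * (t ^ (-α - 1) * |V.eval (log t)|)
        ≤ (K * t ^ η) * (t ^ (-α - 1) * (KV * t ^ (η' - η))) := by
          gcongr
          · exact hb t h0
          · exact hVb t ht
      _ = K * KV * (t ^ η * t ^ (-α - 1) * t ^ (η' - η)) := by ring
      _ = _ := by rw [← rpow_add h0, ← rpow_add h0]; congr 2; ring
  have hmeas : Measurable (fun t => R t * h' t) := by
    have hl : ∀ Q : Polynomial ℝ, Measurable (fun t => Q.eval (log t)) := fun Q =>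
      Q.continuous.measurable.comp measurable_log
    exact (hf.mono.measurable.sub ((measurable_id.pow_const _).mul (hl P))).mul
      ((measurable_id.pow_const _).mul (hl V))
  have hIntg : ∀ y, a ≤ y → MeasureTheory.IntegrableOn (fun t => R t * h' t) (Set.Ioi y) := by
    intro y hy
    refine MeasureTheory.Integrable.mono'
      ((integrableOn_Ioi_rpow_of_lt hs (ha.trans_le hy)).const_mul (K * KV))
      hmeas.aestronglyMeasurable ?_
    filter_upwards [MeasureTheory.ae_restrict_mem measurableSet_Ioi] with t ht
    exact hRh' t (hy.trans (le_of_lt ht))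
  refine ⟨W2.eval (log a) - ∫ t in Set.Ioi a, R t * h' t,
    K * KH + K * KV * (1 / (α - η')), fun y hy1 => ?_⟩
  have hay : a ≤ y := ha1.trans hy1
  have hy0 : 0 < y := ha.trans_le hay
  have hab := hf.abel hfa hay hhd hhc
  have huIcc : ∀ t ∈ Set.uIcc a y, 0 < t := fun t ht => by
    rw [Set.uIcc_of_le hay] at ht; exact ha.trans_le ht.1
  have hsplit : ∫ t in a..y, cnt f t * h' t =
      (W2.eval (log y) - W2.eval (log a)) + ∫ t in a..y, R t * h' t := by
    have e1 : ∫ t in a..y, t⁻¹ * (W2.derivative).eval (log t) =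
        W2.eval (log y) - W2.eval (log a) := by
      refine intervalIntegral.integral_eq_sub_of_hasDerivAt (fun t ht => hlog W2 t (huIcc t ht)) ?_
      exact ((continuousOn_id.inv₀ (fun t ht => (huIcc t ht).ne')).mul
        (hlogc _ _ huIcc)).intervalIntegrable
    rw [← e1, ← intervalIntegral.integral_add]
    · refine intervalIntegral.integral_congr fun t ht => ?_
      have h0 := huIcc t ht
      simp only [hR, hh', hW2d, Polynomial.eval_mul]
      have e : t⁻¹ = t ^ α * t ^ (-α - 1) := by
        rw [← rpow_add h0, ← rpow_neg_one]; congr 1; ring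
      rw [e]; ring
    · exact ((continuousOn_id.inv₀ (fun t ht => (huIcc t ht).ne')).mul
        (hlogc _ _ huIcc)).intervalIntegrable
    · rw [intervalIntegrable_iff, Set.uIoc_of_le hay]
      exact (hIntg a le_rfl).mono_set Set.Ioc_subset_Ioi_self
  have htail := intervalIntegral.integral_interval_add_Ioi (hIntg a le_rfl) (hIntg y hay)
  have hfin : ∑ i ∈ hf.lvl y, f i ^ (-α) * H.eval (log (f i)) - (W.eval (log y) +
      (W2.eval (log a) - ∫ t in Set.Ioi a, R t * h' t)) =
      R y * h y + ∫ t in Set.Ioi y, R t * h' t := by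
    have e : y ^ α * y ^ (-α) = 1 := by rw [← rpow_add hy0]; simp
    have e2 : cnt f y * h y = R y * h y + P.eval (log y) * H.eval (log y) := by
      simp only [hR, hh]
      linear_combination (P.eval (log y) * H.eval (log y)) * e
    have e3 : W2.eval (log y) = P.eval (log y) * H.eval (log y) - W.eval (log y) := by
      simp [hW2]
    change ∑ i ∈ hf.lvl y, h (f i) - _ = _
    rw [hab, hsplit, ← htail, e2, e3]
    ring
  rw [hfin]
  refine (abs_add_le _ _).trans ?_
  rw [add_mul]
  refine add_le_add ?_ ?_
  · rw [abs_mul, abs_mul, abs_of_pos (rpow_pos_of_pos hy0 _)]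
    calc |R y| * (y ^ (-α) * |H.eval (log y)|)
        ≤ (K * y ^ η) * (y ^ (-α) * (KH * y ^ (η' - η))) := by
          gcongr
          · exact hb y hy0
          · exact hHb y hay
      _ = K * KH * (y ^ η * y ^ (-α) * y ^ (η' - η)) := by ring
      _ = _ := by rw [← rpow_add hy0, ← rpow_add hy0]; congr 2; ring
  · have := MeasureTheory.norm_integral_le_of_norm_le
      (μ := MeasureTheory.volume.restrict (Set.Ioi y))
      ((integrableOn_Ioi_rpow_of_lt hs hy0).const_mul (K * KV)) (f := fun t => R t * h' t) (by
        filter_upwards [MeasureTheory.ae_restrict_mem measurableSet_Ioi] with t ht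
        exact hRh' t (hay.trans (le_of_lt ht)))
    refine this.trans (le_of_eq ?_)
    rw [MeasureTheory.integral_const_mul, integral_Ioi_rpow_of_lt hs hy0]
    rw [show η' - α - 1 + 1 = -(α - η') by ring, show η' - α = -(α - η') by ring]
    have : α - η' ≠ 0 := by linarith
    field_simp

lemma Fam.hyperbola (hf : Fam f) (hg : Fam g) {y z : ℝ} (hy : 0 < y) (hz : 0 < z) :
    cnt (fun p : ι × κ => f p.1 * g p.2) (z * y) =
      ∑ k ∈ hg.lvl y, cnt f (z * y / g k) + ∑ i ∈ hf.lvl z, cnt g (z * y / f i)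
        - cnt f z * cnt g y := by
  classical
  have hp := hf.prod hg
  set S := hp.lvl (z * y) with hS
  have hmS : ∀ p : ι × κ, p ∈ S ↔ f p.1 * g p.2 ≤ z * y := fun p => hp.mem_lvl
  set A := S.filter (fun p => g p.2 ≤ y) with hA
  set B := S.filter (fun p => f p.1 ≤ z) with hB
  have hU : A ∪ B = S := by
    ext p
    simp only [hA, hB, Finset.mem_union, Finset.mem_filter]
    constructor
    · rintro (h | h) <;> exact h.1
    · intro h
      by_contra hc
      push Not at hc
      have h1 := hc.1 h
      have h2 := hc.2 h
      have h3 := (hmS p).1 h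
      have := mul_lt_mul h2 h1.le hy (hf.pos _).le
      linarith
  have hI : A ∩ B = hf.lvl z ×ˢ hg.lvl y := by
    ext p
    simp only [hA, hB, Finset.mem_inter, Finset.mem_filter, Finset.mem_product, hf.mem_lvl,
      hg.mem_lvl, hmS]
    constructor
    · rintro ⟨h1, h2⟩; exact ⟨h2.2, h1.2⟩
    · rintro ⟨h1, h2⟩
      have := mul_le_mul h1 h2 (hg.pos _).le hz.le
      exact ⟨⟨this, h2⟩, this, h1⟩
  have hAc : (A.card : ℝ) = ∑ k ∈ hg.lvl y, cnt f (z * y / g k) := by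
    rw [Finset.card_eq_sum_card_fiberwise (f := Prod.snd) (t := hg.lvl y)]
    · push_cast
      refine Finset.sum_congr rfl fun k hk => ?_
      rw [hf.cnt_eq]
      congr 1
      refine Finset.card_bij (fun p _ => p.1) ?_ ?_ ?_
      · intro p hp
        simp only [hA, Finset.mem_filter, hmS] at hp
        rw [hf.mem_lvl, le_div_iff₀ (hg.pos k), ← hp.2]
        exact hp.1.1
      · intro p hp q hq h
        simp only [Finset.mem_filter] at hp hq
        exact Prod.ext h (hp.2.trans hq.2.symm)
      · intro i hi
        rw [hf.mem_lvl, le_div_iff₀ (hg.pos k)] at hi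
        rw [hg.mem_lvl] at hk
        exact ⟨(i, k), by simp [hA, hmS, hi, hk], rfl⟩
    · intro p hp
      simp only [hA, Finset.coe_filter, Set.mem_ofPred_eq] at hp
      simpa [hg.mem_lvl] using hp.2
  have hBc : (B.card : ℝ) = ∑ i ∈ hf.lvl z, cnt g (z * y / f i) := by
    rw [Finset.card_eq_sum_card_fiberwise (f := Prod.fst) (t := hf.lvl z)]
    · push_cast
      refine Finset.sum_congr rfl fun i hi => ?_
      rw [hg.cnt_eq]
      congr 1
      refine Finset.card_bij (fun p _ => p.2) ?_ ?_ ?_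
      · intro p hp
        simp only [hB, Finset.mem_filter, hmS] at hp
        rw [hg.mem_lvl, le_div_iff₀ (hf.pos i), ← hp.2, mul_comm]
        exact hp.1.1
      · intro p hp q hq h
        simp only [Finset.mem_filter] at hp hq
        exact Prod.ext (hp.2.trans hq.2.symm) h
      · intro k hk
        rw [hg.mem_lvl, le_div_iff₀ (hf.pos i), mul_comm] at hk
        rw [hf.mem_lvl] at hi
        exact ⟨(i, k), by simp [hB, hmS, hi, hk], rfl⟩
    · intro p hp
      simp only [hB, Finset.coe_filter, Set.mem_ofPred_eq] at hp
      simpa [hf.mem_lvl] using hp.2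
  have hc := Finset.card_union_add_card_inter A B
  rw [hU, hI, Finset.card_product] at hc
  have hc' : (S.card : ℝ) + (hf.lvl z).card * (hg.lvl y).card = A.card + B.card := by
    exact_mod_cast hc
  rw [hp.cnt_eq, ← hAc, ← hBc, hf.cnt_eq, hg.cnt_eq]
  linarith

/-- Global bound for the remainder. -/
def Bd (f : ι → ℝ) (α : ℝ) (P : Polynomial ℝ) (η : ℝ) : Prop :=
  ∃ K, 0 ≤ K ∧ ∀ x, 0 < x → |cnt f x - x ^ α * P.eval (log x)| ≤ K * x ^ η

lemma Bd.summable {α η β : ℝ} {P : Polynomial ℝ} (hf : Fam f) (h : Bd f α P η) (hη : η < α)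
    (hα : 0 < α) (hβ : α < β) : Summable (fun i => f i ^ (-β)) := by
  obtain ⟨K, hK, hb⟩ := h
  obtain ⟨a, ha, ha1, hfa⟩ := hf.lower
  set ε := (β - α) / 2 with hε
  have hε0 : 0 < ε := by rw [hε]; linarith
  obtain ⟨KP, hKP, hp⟩ := polylog_ge P hε0 ha
  refine hf.summable (σ := α + ε) (K := KP + K * a ^ (η - (α + ε))) (by rw [hε]; linarith)
    (by linarith) (by positivity) fun x hx => ?_
  rcases le_or_gt x a with hxa | hxa
  · rw [hf.cnt_zero hfa hxa]; positivity
  · have h1 := (abs_le.1 (hb x hx)).2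
    have h2 : x ^ α * P.eval (log x) ≤ KP * x ^ (α + ε) := by
      calc x ^ α * P.eval (log x) ≤ x ^ α * (KP * x ^ ε) := by
            gcongr; exact (le_abs_self _).trans (hp x hxa.le)
        _ = KP * (x ^ α * x ^ ε) := by ring
        _ = _ := by rw [← rpow_add hx]
    have h3 : x ^ η ≤ a ^ (η - (α + ε)) * x ^ (α + ε) := by
      have : x ^ η = x ^ (η - (α + ε)) * x ^ (α + ε) := by rw [← rpow_add hx]; congr 1; ring
      rw [this]
      have h4 := rpow_le_rpow_of_nonpos ha hxa.le (by linarith : η - (α + ε) ≤ 0)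
      gcongr
    have h5 := mul_le_mul_of_nonneg_left h3 hK
    linarith

lemma small_summable {α : ℝ} (hg : Fam g) {η β : ℝ} (h : Bd g α 0 η) (hη : 0 ≤ η)
    (hβ : η < β) : Summable (fun k => g k ^ (-β)) := by
  obtain ⟨K, hK, hb⟩ := h
  refine hg.summable hβ (by linarith) hK fun x hx => ?_
  have := (abs_le.1 (hb x hx)).2
  simpa using this

lemma Asym.common {α : ℝ} {P Q : Polynomial ℝ} (hf : Fam f) (hg : Fam g) (h1 : Asym f α P)
    (h2 : Asym g α Q) : ∃ η₀, 0 ≤ η₀ ∧ η₀ < α ∧ ∀ η, η₀ ≤ η → η < α → Bd f α P η ∧ Bd g α Q η := by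
  obtain ⟨a, ha, ha', h1⟩ := h1.global hf
  obtain ⟨b, hb, hb', h2⟩ := h2.global hg
  exact ⟨max a b, le_max_of_le_left ha, max_lt ha' hb', fun η hη hα =>
    ⟨h1 η ((le_max_left _ _).trans hη) hα, h2 η ((le_max_right _ _).trans hη) hα⟩⟩

lemma Asym.summable {α : ℝ} (hg : Fam g) (h : Asym g α 0) : Summable (fun k => g k ^ (-α)) := by
  obtain ⟨η, h0, hα, h⟩ := h.global hg
  exact small_summable hg (h η le_rfl hα) h0 hα

lemma stepS {α A : ℝ} (hf : Fam f) (hg : Fam g) (h1 : Asym f α (Polynomial.C A))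
    (h2 : Asym g α 0) :
    Asym (fun p : ι × κ => f p.1 * g p.2) α (Polynomial.C (A * ∑' k, g k ^ (-α))) := by
  have hsα := h2.summable hg
  obtain ⟨η₀, h0, hα, hcom⟩ := Asym.common hf hg h1 h2
  set η := (η₀ + α) / 2 with hη
  have hs : Summable (fun k => g k ^ (-η)) :=
    small_summable hg (hcom η₀ le_rfl hα).2 h0 (by rw [hη]; linarith)
  obtain ⟨K, hK, hb⟩ := (hcom η (by rw [hη]; linarith) (by rw [hη]; linarith)).1
  refine ⟨η, by rw [hη]; linarith, by rw [hη]; linarith, ?_⟩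
  obtain ⟨a, ha, ha1, hfa⟩ := hf.lower
  refine IsBigO.of_bound (K * ∑' k, g k ^ (-η)) ?_
  filter_upwards [eventually_gt_atTop 0] with x hx
  have hy : 0 < x / a := by positivity
  have hyp := hf.hyperbola hg hy ha
  have hlv : hf.lvl a = ∅ := by
    ext i; rw [hf.mem_lvl]; simp [hfa i]
  rw [hlv, hf.cnt_zero hfa le_rfl, mul_div_cancel₀ _ ha.ne'] at hyp
  simp only [Finset.sum_empty, zero_mul, add_zero, sub_zero] at hyp
  have hS1 : HasSum (fun k => cnt f (x / g k)) (cnt (fun p : ι × κ => f p.1 * g p.2) x) := by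
    rw [hyp]
    refine hasSum_sum_of_ne_finset_zero fun k hk => ?_
    rw [hg.mem_lvl, not_le] at hk
    refine hf.cnt_zero hfa ?_
    rw [div_le_iff₀ (hg.pos k)]
    rw [div_lt_iff₀ ha] at hk
    linarith
  have hS2 : HasSum (fun k => x ^ α * (A * g k ^ (-α))) (x ^ α * (A * ∑' k, g k ^ (-α))) :=
    (hsα.hasSum.mul_left A).mul_left _
  have hS := hS1.sub hS2
  simp only [Polynomial.eval_C]
  rw [← hS.tsum_eq]
  refine tsum_of_norm_bounded (g := fun k => K * g k ^ (-η) * ‖x ^ η‖)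
    ((hs.hasSum.mul_left K).mul_right _) fun k => ?_
  have hgk := hg.pos k
  have := hb (x / g k) (by positivity)
  rw [norm_eq_abs, norm_of_nonneg (by positivity)]
  simp only [Polynomial.eval_C] at this
  rw [div_rpow hx.le hgk.le, div_rpow hx.le hgk.le] at this
  rw [rpow_neg hgk.le, rpow_neg hgk.le]
  convert this using 1
  · congr 1; ring
  · ring

lemma bigO_rpow {a b : ℝ} (h : a ≤ b) : (fun x : ℝ => x ^ a) =O[atTop] fun x => x ^ b := by
  refine IsBigO.of_bound 1 ?_
  filter_upwards [eventually_ge_atTop 1] with x hx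
  rw [norm_of_nonneg (by positivity), norm_of_nonneg (by positivity), one_mul]
  exact rpow_le_rpow_of_exponent_le hx h

lemma bigO_mul {F G : ℝ → ℝ} {a b c : ℝ} (hF : F =O[atTop] fun x => x ^ a)
    (hG : G =O[atTop] fun x => x ^ b) (h : a + b ≤ c) :
    (fun x => F x * G x) =O[atTop] fun x => x ^ c := by
  refine (hF.mul hG).trans ?_
  refine IsBigO.trans (EventuallyEq.isBigO ?_) (bigO_rpow h)
  filter_upwards [eventually_gt_atTop 0] with x hx
  rw [rpow_add hx]

lemma bigO_sqrt {F : ℝ → ℝ} {a : ℝ} (hF : F =O[atTop] fun x => x ^ a) :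
    (fun x => F (√x)) =O[atTop] fun x => x ^ (a / 2) := by
  refine (hF.comp_tendsto tendsto_sqrt_atTop).trans (EventuallyEq.isBigO ?_)
  filter_upwards [eventually_gt_atTop 0] with x hx
  simp only [Function.comp]
  rw [sqrt_eq_rpow, ← rpow_mul hx.le]
  congr 1; ring

lemma bigO_polylog (H : Polynomial ℝ) {ε : ℝ} (hε : 0 < ε) :
    (fun x => H.eval (log x)) =O[atTop] fun x => x ^ ε := by
  obtain ⟨K, _, h⟩ := polylog_ge H hε one_pos
  refine IsBigO.of_bound K ?_
  filter_upwards [eventually_ge_atTop 1] with x hx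
  rw [norm_eq_abs, norm_of_nonneg (by positivity)]
  exact h x hx

lemma err (hg : Fam g) {η β K : ℝ} (hs : Summable (fun k => g k ^ (-β))) (hηβ : η ≤ β)
    (hK : 0 ≤ K) {R : ℝ → ℝ} (hR : ∀ x, 0 < x → |R x| ≤ K * x ^ η) :
    (fun x => ∑ k ∈ hg.lvl (√x), R (x / g k)) =O[atTop] fun x => x ^ ((η + β) / 2) := by
  refine IsBigO.of_bound (K * ∑' k, g k ^ (-β)) ?_
  filter_upwards [eventually_gt_atTop 0] with x hx
  have hy : 0 < √x := by positivity
  rw [norm_eq_abs, norm_of_nonneg (by positivity)]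
  refine (Finset.abs_sum_le_sum_abs _ _).trans ?_
  have h1 : ∀ k ∈ hg.lvl (√x), |R (x / g k)| ≤ K * x ^ ((η + β) / 2) * g k ^ (-β) := by
    intro k hk
    rw [hg.mem_lvl] at hk
    have hgk := hg.pos k
    refine (hR (x / g k) (by positivity)).trans ?_
    rw [mul_assoc]
    refine mul_le_mul_of_nonneg_left ?_ hK
    rw [div_rpow hx.le hgk.le, div_eq_mul_inv, ← rpow_neg hgk.le]
    have e1 : g k ^ (-η) = g k ^ (β - η) * g k ^ (-β) := by rw [← rpow_add hgk]; congr 1; ring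
    have e2 : g k ^ (β - η) ≤ (√x) ^ (β - η) := rpow_le_rpow hgk.le hk (by linarith)
    have e3 : x ^ ((η + β) / 2) = x ^ η * (√x) ^ (β - η) := by
      rw [sqrt_eq_rpow, ← rpow_mul hx.le, ← rpow_add hx]; congr 1; ring
    rw [e1, e3, mul_assoc]
    gcongr
  refine (Finset.sum_le_sum h1).trans ?_
  rw [← Finset.mul_sum]
  have := hs.sum_le_tsum (hg.lvl (√x)) (fun k _ => (rpow_pos_of_pos (hg.pos k) _).le)
  calc _ ≤ K * x ^ ((η + β) / 2) * ∑' k, g k ^ (-β) := by gcongr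
    _ = _ := by ring

lemma hasse_antideriv {P Q : Polynomial ℝ} (hQ : ∀ n, Q.coeff (n + 1) = P.coeff n / (n + 1))
    (j : ℕ) (t : ℝ) : (Polynomial.hasseDeriv (j + 1) Q).eval t =
      (Polynomial.hasseDeriv j P).eval t / (j + 1) := by
  have : Polynomial.hasseDeriv (j + 1) Q =
      Polynomial.C ((j + 1 : ℝ)⁻¹) * Polynomial.hasseDeriv j P := by
    ext m
    rw [Polynomial.coeff_C_mul, Polynomial.hasseDeriv_coeff, Polynomial.hasseDeriv_coeff,
      ← add_assoc, hQ]
    have h := Nat.add_one_mul_choose_eq (m + j) j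
    have h' : ((m + j : ℕ) + 1 : ℝ) * ((m + j).choose j : ℝ) =
      ((m + j + 1).choose (j + 1) : ℝ) * (j + 1) := by exact_mod_cast h
    have h1 : ((m + j : ℕ) + 1 : ℝ) ≠ 0 := by positivity
    have h2 : (j + 1 : ℝ) ≠ 0 := by positivity
    field_simp
    linear_combination (-(P.coeff (m + j))) * h'
  rw [this, Polynomial.eval_mul, Polynomial.eval_C]
  ring

lemma taylor_expand {P : Polynomial ℝ} {n : ℕ} (hP : P.natDegree ≤ n) (L u : ℝ) :
    P.eval (L - u) = ∑ j ∈ Finset.range (n + 1),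
      (Polynomial.hasseDeriv j P).eval L * ((-1) ^ j * u ^ j) := by
  have h := Polynomial.taylor_eval L P (-u)
  rw [show -u + L = L - u by ring] at h
  rw [← h, Polynomial.eval_eq_sum_range' (n := n + 1)
    (by rw [Polynomial.natDegree_taylor]; omega)]
  refine Finset.sum_congr rfl fun j _ => ?_
  rw [Polynomial.taylor_coeff, neg_pow]

lemma piece3 {α η A : ℝ} {P : Polynomial ℝ} (hη : η < α) (h1 : Bd f α P η)
    (h2 : Bd g α (Polynomial.C A) η) :
    (fun x => cnt f (√x) * cnt g (√x) - x ^ α * (A * P.eval (log x / 2)))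
      =O[atTop] fun x => x ^ (α - (α - η) / 8) := by
  obtain ⟨K1, hK1, hb1⟩ := h1
  obtain ⟨K2, hK2, hb2⟩ := h2
  have o1 : (fun x => cnt f x - x ^ α * P.eval (log x)) =O[atTop] fun x => x ^ η := by
    refine IsBigO.of_bound K1 ?_
    filter_upwards [eventually_gt_atTop 0] with x hx
    rw [norm_eq_abs, norm_of_nonneg (by positivity)]; exact hb1 x hx
  have o2 : (fun x => cnt g x - x ^ α * A) =O[atTop] fun x => x ^ η := by
    refine IsBigO.of_bound K2 ?_
    filter_upwards [eventually_gt_atTop 0] with x hx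
    rw [norm_eq_abs, norm_of_nonneg (by positivity)]; simpa using hb2 x hx
  have o3 : (fun x => x ^ α * P.eval (log x)) =O[atTop] fun x => x ^ (α + (α - η) / 2) :=
    bigO_mul (isBigO_refl _ _) (bigO_polylog P (by linarith : 0 < (α - η) / 2)) le_rfl
  have o4 : (fun x : ℝ => x ^ α * A) =O[atTop] fun x => x ^ α := by
    simpa [mul_comm] using (isBigO_refl (fun x : ℝ => x ^ α) atTop).const_mul_left A
  have o5 : (fun x => cnt f x * cnt g x - x ^ α * x ^ α * (A * P.eval (log x)))
      =O[atTop] fun x => x ^ (2 * α - (α - η) / 4) := by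
    have := ((bigO_mul o1 o2 (c := 2 * α - (α - η) / 4) (by linarith)).add
      (bigO_mul o1 o4 (c := 2 * α - (α - η) / 4) (by linarith))).add
      (bigO_mul o3 o2 (c := 2 * α - (α - η) / 4) (by linarith))
    refine this.congr_left fun x => ?_
    ring
  have o6 := bigO_sqrt o5
  rw [show (2 * α - (α - η) / 4) / 2 = α - (α - η) / 8 by ring] at o6
  refine o6.congr' ?_ EventuallyEq.rfl
  filter_upwards [eventually_gt_atTop 0] with x hx
  have : (√x) ^ α * (√x) ^ α = x ^ α := by
    rw [← mul_rpow (sqrt_nonneg x) (sqrt_nonneg x), mul_self_sqrt hx.le]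
  rw [this, log_sqrt hx.le]

lemma piece_abel {α η : ℝ} {P : Polynomial ℝ} (hf : Fam f) (hη : η < α) (h1 : Bd f α P η)
    (H W : Polynomial ℝ) (hW : W.derivative = (Polynomial.C α * P + P.derivative) * H) :
    ∃ c, (fun x => ∑ i ∈ hf.lvl (√x), f i ^ (-α) * H.eval (log (f i)) -
        (W.eval (log x / 2) + c)) =O[atTop] fun x => x ^ (-((α - η) / 4)) := by
  obtain ⟨K, hK, hb⟩ := h1
  obtain ⟨c, D, h⟩ := hf.abel_asym (η' := (α + η) / 2) (by linarith) (by linarith) hK hb H W hW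
  refine ⟨c, ?_⟩
  have o : (fun y => ∑ i ∈ hf.lvl y, f i ^ (-α) * H.eval (log (f i)) -
        (W.eval (log y) + c)) =O[atTop] fun y => y ^ ((α + η) / 2 - α) := by
    refine IsBigO.of_bound D ?_
    filter_upwards [eventually_ge_atTop 1] with x hx
    rw [norm_eq_abs, norm_of_nonneg (by positivity)]; exact h x hx
  have o2 := bigO_sqrt o
  rw [show ((α + η) / 2 - α) / 2 = -((α - η) / 4) by ring] at o2
  refine o2.congr' ?_ EventuallyEq.rfl
  filter_upwards [eventually_gt_atTop 0] with x hx
  rw [log_sqrt hx.le]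

lemma piece2 {α η A : ℝ} {P Q : Polynomial ℝ} (hf : Fam f) (hα : 0 < α) (hη : η < α)
    (h1 : Bd f α P η) (h2 : Bd g α (Polynomial.C A) η) (hQ : Q.derivative = P) :
    ∃ c, (fun x => ∑ i ∈ hf.lvl (√x), cnt g (x / f i) - x ^ α * (A * (α * Q.eval (log x / 2)
        + P.eval (log x / 2) + c))) =O[atTop] fun x => x ^ (α - (α - η) / 8) := by
  obtain ⟨c, hc⟩ := piece_abel hf hη h1 1 (Polynomial.C α * Q + P) (by simp [hQ])
  refine ⟨c, ?_⟩
  have hs := h1.summable hf hη hα (β := α + (α - η) / 2) (by linarith)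
  obtain ⟨K2, hK2, hb2⟩ := h2
  have o1 := err (η := η) hf hs (by linarith) hK2 (R := fun x => cnt g x - x ^ α * A)
    (fun x hx => by simpa using hb2 x hx)
  have o1' := o1.trans (bigO_rpow
    (by linarith : (η + (α + (α - η) / 2)) / 2 ≤ α - (α - η) / 8))
  have o2 := (bigO_mul (isBigO_refl (fun x : ℝ => x ^ α) atTop) hc
    (c := α - (α - η) / 8) (by linarith)).const_mul_left A
  refine (o1'.add o2).congr' ?_ EventuallyEq.rfl
  filter_upwards [eventually_gt_atTop 0] with x hx
  rw [Finset.sum_sub_distrib]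
  have : ∑ i ∈ hf.lvl (√x), (x / f i) ^ α * A =
      A * (x ^ α * ∑ i ∈ hf.lvl (√x), f i ^ (-α) * (1 : Polynomial ℝ).eval (log (f i))) := by
    rw [Finset.mul_sum, Finset.mul_sum]
    refine Finset.sum_congr rfl fun i _ => ?_
    rw [div_rpow hx.le (hf.pos i).le, rpow_neg (hf.pos i).le, Polynomial.eval_one]
    ring
  rw [this]
  simp only [Polynomial.eval_add, Polynomial.eval_mul, Polynomial.eval_C]
  ring

lemma piece1 {α η A : ℝ} {P Q : Polynomial ℝ} {n : ℕ} (hg : Fam g) (hα : 0 < α)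
    (hη : η < α) (h1 : Bd f α P η) (h2 : Bd g α (Polynomial.C A) η) (hP : P.natDegree ≤ n)
    (hQ : ∀ n, Q.coeff (n + 1) = P.coeff n / (n + 1)) (hQd : Q.natDegree ≤ n + 1) :
    ∃ U : Polynomial ℝ, U.natDegree ≤ n ∧
      (fun x => ∑ k ∈ hg.lvl (√x), cnt f (x / g k) - x ^ α * (α * A * (Q.eval (log x) -
        Q.eval (log x / 2)) + U.eval (log x))) =O[atTop] fun x => x ^ (α - (α - η) / 8) := by
  have hW : ∀ j : ℕ, (Polynomial.monomial (j + 1) (α * A / (j + 1))).derivative =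
      (Polynomial.C α * Polynomial.C A + (Polynomial.C A).derivative) * Polynomial.X ^ j := by
    intro j
    rw [Polynomial.derivative_monomial]
    have : (j : ℝ) + 1 ≠ 0 := by positivity
    rw [Polynomial.derivative_C, add_zero, ← Polynomial.C_mul, Polynomial.C_mul_X_pow_eq_monomial]
    push_cast
    rw [div_mul_cancel₀ _ this]
    try simp
  choose c hc using fun j : ℕ => piece_abel hg hη h2 (Polynomial.X ^ j)
    (Polynomial.monomial (j + 1) (α * A / (j + 1))) (hW j)
  refine ⟨∑ j ∈ Finset.range (n + 1), Polynomial.C ((-1) ^ j * c j) * Polynomial.hasseDeriv j P,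
    ?_, ?_⟩
  · refine Polynomial.natDegree_sum_le_of_forall_le _ _ fun j _ => ?_
    refine (Polynomial.natDegree_C_mul_le _ _).trans ?_
    exact (Polynomial.natDegree_hasseDeriv_le _ _).trans (by omega)
  have hs := h2.summable hg hη hα (β := α + (α - η) / 2) (by linarith)
  obtain ⟨K1, hK1, hb1⟩ := h1
  have o1 := err (η := η) hg hs (by linarith) hK1 (R := fun x => cnt f x - x ^ α * P.eval (log x))
    (fun x hx => hb1 x hx)
  have o1' := o1.trans (bigO_rpow
    (by linarith : (η + (α + (α - η) / 2)) / 2 ≤ α - (α - η) / 8))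
  have o2 : ∀ j ∈ Finset.range (n + 1), (fun x => (-1) ^ j * (x ^ α *
      ((Polynomial.hasseDeriv j P).eval (log x) *
      (∑ k ∈ hg.lvl (√x), g k ^ (-α) * (Polynomial.X ^ j : Polynomial ℝ).eval (log (g k)) -
        ((Polynomial.monomial (j + 1) (α * A / (j + 1))).eval (log x / 2) + c j)))))
      =O[atTop] fun x => x ^ (α - (α - η) / 8) := by
    intro j _
    refine IsBigO.const_mul_left ?_ _
    refine bigO_mul (isBigO_refl (fun x : ℝ => x ^ α) atTop)
      (bigO_mul (bigO_polylog _ (by linarith : 0 < (α - η) / 8)) (hc j)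
      (c := -((α - η) / 8)) (by linarith)) (by linarith)
  have o3 := IsBigO.sum o2
  refine (o1'.add o3).congr' ?_ EventuallyEq.rfl
  filter_upwards [eventually_gt_atTop 0] with x hx
  set L := log x with hL
  have e1 : ∑ k ∈ hg.lvl (√x), (x / g k) ^ α * P.eval (log (x / g k)) =
      ∑ j ∈ Finset.range (n + 1), (-1) ^ j * (x ^ α * ((Polynomial.hasseDeriv j P).eval L *
      (∑ k ∈ hg.lvl (√x), g k ^ (-α) * (Polynomial.X ^ j : Polynomial ℝ).eval (log (g k))))) := by
    simp only [Finset.mul_sum]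
    rw [Finset.sum_comm]
    refine Finset.sum_congr rfl fun k _ => ?_
    have hk := hg.pos k
    rw [div_rpow hx.le hk.le, rpow_neg hk.le, log_div hx.ne' hk.ne', taylor_expand hP,
      Finset.mul_sum]
    refine Finset.sum_congr rfl fun j _ => ?_
    simp only [Polynomial.eval_pow, Polynomial.eval_X]
    ring
  have e2 : ∑ j ∈ Finset.range (n + 1), (-1) ^ j * ((Polynomial.hasseDeriv j P).eval L *
      (Polynomial.monomial (j + 1) (α * A / (j + 1))).eval (L / 2)) =
      α * A * (Q.eval L - Q.eval (L / 2)) := by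
    have := taylor_expand hQd L (L / 2)
    rw [show L - L / 2 = L / 2 by ring, Finset.sum_range_succ'] at this
    simp only [hasse_antideriv hQ] at this
    rw [this]
    simp only [Polynomial.hasseDeriv_zero, LinearMap.id_coe, id, pow_zero, mul_one]
    rw [sub_add_eq_sub_sub, sub_right_comm, sub_self, zero_sub, ← Finset.sum_neg_distrib,
      Finset.mul_sum]
    refine Finset.sum_congr rfl fun j _ => ?_
    rw [Polynomial.eval_monomial]
    ring
  rw [Finset.sum_sub_distrib, e1, ← e2]
  have e3 : ∀ S W : ℕ → ℝ, ∑ j ∈ Finset.range (n + 1), (-1) ^ j * (x ^ α *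
      ((Polynomial.hasseDeriv j P).eval L * (S j - (W j + c j)))) =
      ∑ j ∈ Finset.range (n + 1), (-1) ^ j * (x ^ α * ((Polynomial.hasseDeriv j P).eval L * S j))
      - x ^ α * (∑ j ∈ Finset.range (n + 1), (-1) ^ j * ((Polynomial.hasseDeriv j P).eval L * W j)
      + (∑ j ∈ Finset.range (n + 1),
        Polynomial.C ((-1) ^ j * c j) * Polynomial.hasseDeriv j P).eval L) := by
    intro S W
    rw [Polynomial.eval_finsetSum, ← Finset.sum_add_distrib, Finset.mul_sum,
      ← Finset.sum_sub_distrib]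
    refine Finset.sum_congr rfl fun j _ => ?_
    rw [Polynomial.eval_mul, Polynomial.eval_C]
    ring
  rw [Finset.sum_apply]
  refine (congrArg (_ + ·) (e3
    (fun j => ∑ k ∈ hg.lvl (√x), g k ^ (-α) * (Polynomial.X ^ j : Polynomial ℝ).eval (log (g k)))
    (fun j => (Polynomial.monomial (j + 1) (α * A / (j + 1))).eval (L / 2)))).trans ?_
  ring

lemma stepM {α A : ℝ} {P : Polynomial ℝ} {n : ℕ} (hf : Fam f) (hg : Fam g)
    (hP : P.natDegree ≤ n) (h1 : Asym f α P) (h2 : Asym g α (Polynomial.C A)) :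
    ∃ Q : Polynomial ℝ, Q.natDegree ≤ n + 1 ∧ Q.coeff (n + 1) = α * A * (P.coeff n / (n + 1)) ∧
      Asym (fun p : ι × κ => f p.1 * g p.2) α Q := by
  obtain ⟨η, h0, hη, hcom⟩ := Asym.common hf hg h1 h2
  obtain ⟨b1, b2⟩ := hcom η le_rfl hη
  have hα : 0 < α := by linarith
  obtain ⟨Q, hQ1, hQ2, hQ3⟩ := exists_antideriv P
  obtain ⟨U, hU, o1⟩ := piece1 hg hα hη b1 b2 hP hQ2 (hQ3.trans (by omega))
  obtain ⟨c, o2⟩ := piece2 hf hα hη b1 b2 hQ1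
  have o3 := piece3 hη b1 b2
  refine ⟨Polynomial.C (α * A) * Q + U + Polynomial.C (A * c), ?_, ?_,
    α - (α - η) / 8, by linarith, by linarith, ?_⟩
  · refine Polynomial.natDegree_add_le_of_degree_le (Polynomial.natDegree_add_le_of_degree_le
      ((Polynomial.natDegree_C_mul_le _ _).trans (hQ3.trans (by omega))) (by omega)) (by rw [Polynomial.natDegree_C]; omega)
  · rw [Polynomial.coeff_add, Polynomial.coeff_add, Polynomial.coeff_C_mul, hQ2,
      Polynomial.coeff_eq_zero_of_natDegree_lt (p := U) (by omega),
      Polynomial.coeff_C_of_ne_zero (by omega)]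
    ring
  · refine ((o1.add o2).sub o3).congr' ?_ EventuallyEq.rfl
    filter_upwards [eventually_gt_atTop 0] with x hx
    have hy : 0 < √x := by positivity
    have hyp := hf.hyperbola hg hy hy
    rw [mul_self_sqrt hx.le] at hyp
    rw [hyp]
    simp only [Polynomial.eval_add, Polynomial.eval_mul, Polynomial.eval_C]
    ring

lemma Asym.reindex {α : ℝ} {P : Polynomial ℝ} (h : Asym f α P) (e : κ ≃ ι) :
    Asym (fun k => f (e k)) α P := by
  obtain ⟨η, h0, h1, h2⟩ := h
  refine ⟨η, h0, h1, ?_⟩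
  simpa only [cnt_reindex] using h2

lemma small_prod {α : ℝ} (hα : 0 < α) : ∀ (n : ℕ) (s : Fin n → ℕ → ℝ) (_ : ∀ j, Fam (s j))
    (_ : ∀ j, Asym (s j) α 0),
    Fam (fun k : Fin n → ℕ => ∏ j, s j (k j)) ∧ Asym (fun k : Fin n → ℕ => ∏ j, s j (k j)) α 0 ∧
      ∑' k : Fin n → ℕ, (∏ j, s j (k j)) ^ (-α) = ∏ j, ∑' k, s j k ^ (-α) := by
  intro n
  induction n with
  | zero =>
    intro s _ _
    have hF : Fam (fun k : Fin 0 → ℕ => ∏ j, s j (k j)) :=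
      ⟨fun k => by simp, fun x => Set.toFinite _⟩
    refine ⟨hF, ⟨0, le_rfl, hα, ?_⟩, ?_⟩
    · refine IsBigO.of_bound 1 (Eventually.of_forall fun x => ?_)
      rw [hF.cnt_eq]
      have : (hF.lvl x).card ≤ 1 := (Finset.card_le_univ _).trans (by simp)
      simpa using this
    · simp
  | succ n ih =>
    intro s hs ha
    obtain ⟨h1, h2, h3⟩ := ih (fun j => s j.succ) (fun j => hs _) (fun j => ha _)
    have e := (Fin.consEquiv (fun _ : Fin (n + 1) => ℕ)).symm
    have key : ∀ k : Fin (n + 1) → ℕ, ∏ j, s j (k j) =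
        (fun p : ℕ × (Fin n → ℕ) => s 0 p.1 * ∏ j, s j.succ (p.2 j))
          ((Fin.consEquiv (fun _ : Fin (n + 1) => ℕ)).symm k) := by
      intro k
      rw [Fin.prod_univ_succ]
      rfl
    have hF := (hs 0).prod h1
    have h0 : Asym (s 0) α (Polynomial.C 0) := by simpa using ha 0
    have hA := stepS (hs 0) h1 h0 h2
    rw [zero_mul, Polynomial.C_0] at hA
    have g1 := hF.reindex (Fin.consEquiv (fun _ : Fin (n + 1) => ℕ)).symm
    have g2 := hA.reindex (Fin.consEquiv (fun _ : Fin (n + 1) => ℕ)).symm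
    simp only [key]
    refine ⟨g1, g2, ?_⟩
    rw [(Fin.consEquiv (fun _ : Fin (n + 1) => ℕ)).symm.tsum_eq
      (fun p : ℕ × (Fin n → ℕ) => (s 0 p.1 * ∏ j, s j.succ (p.2 j)) ^ (-α))]
    rw [Fin.prod_univ_succ, ← h3, tsum_mul_tsum_of_summable_norm
      ((ha 0).summable (hs 0)).norm (h2.summable h1).norm]
    refine tsum_congr fun p => ?_
    rw [mul_rpow ((hs 0).pos _).le (h1.pos _).le]

/-- Splitting off the first coordinate. -/
def splitEquiv (κ : Type) (n : ℕ) :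
    κ × (Fin (n + 1) → ℕ) ≃ (κ × (Fin n → ℕ)) × ℕ where
  toFun p := ((p.1, fun j => p.2 j.succ), p.2 0)
  invFun q := (q.1.1, Fin.cons q.2 q.1.2)
  left_inv p := by
    refine Prod.ext rfl ?_
    funext j
    refine Fin.cases ?_ (fun j => ?_) j <;> simp
  right_inv q := by simp

lemma main_prod {α : ℝ} {u : κ → ℝ} (hu : Fam u) (hua : Asym u α 0) :
    ∀ (n : ℕ) (s : Fin (n + 1) → ℕ → ℝ) (A : Fin (n + 1) → ℝ) (_ : ∀ j, Fam (s j))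
    (_ : ∀ j, Asym (s j) α (Polynomial.C (A j))),
    Fam (fun p : κ × (Fin (n + 1) → ℕ) => u p.1 * ∏ j, s j (p.2 j)) ∧
    ∃ Q : Polynomial ℝ, Q.natDegree ≤ n ∧
      Q.coeff n = ((∏ j, A j) * ∑' k, u k ^ (-α)) * α ^ n / n.factorial ∧
      Asym (fun p : κ × (Fin (n + 1) → ℕ) => u p.1 * ∏ j, s j (p.2 j)) α Q := by
  intro n
  induction n with
  | zero =>
    intro s A hs ha
    have hF := (hs 0).prod hu
    have hA := stepS (hs 0) hu (ha 0) hua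
    let e : κ × (Fin (0 + 1) → ℕ) ≃ ℕ × κ :=
      (Equiv.prodComm _ _).trans ((Equiv.funUnique (Fin 1) ℕ).prodCongr (Equiv.refl _))
    have key : (fun p : κ × (Fin (0 + 1) → ℕ) => u p.1 * ∏ j, s j (p.2 j)) =
        fun p => (fun q : ℕ × κ => s 0 q.1 * u q.2) (e p) := by
      funext p
      simp [e, mul_comm]
    rw [key]
    refine ⟨hF.reindex e, _, ?_, ?_, hA.reindex e⟩
    · exact (Polynomial.natDegree_C _).le
    · simp
  | succ n ih =>
    intro s A hs ha
    obtain ⟨h1, Q, hQ1, hQ2, hQ3⟩ := ih (fun j => s j.succ) (fun j => A j.succ)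
      (fun j => hs _) (fun j => ha _)
    obtain ⟨Q', hd, hc, hA⟩ := stepM h1 (hs 0) hQ1 hQ3 (ha 0)
    have hF := h1.prod (hs 0)
    have key : (fun p : κ × (Fin (n + 1 + 1) → ℕ) => u p.1 * ∏ j, s j (p.2 j)) =
        fun p => (fun q : (κ × (Fin (n + 1) → ℕ)) × ℕ =>
          (u q.1.1 * ∏ j, s j.succ (q.1.2 j)) * s 0 q.2) (splitEquiv κ (n + 1) p) := by
      funext p
      simp only [splitEquiv, Equiv.coe_fn_mk]
      rw [Fin.prod_univ_succ]
      ring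
    rw [key]
    refine ⟨hF.reindex _, Q', hd, ?_, hA.reindex _⟩
    rw [hc, hQ2, Fin.prod_univ_succ A, Nat.factorial_succ]
    push_cast
    field_simp
    ring

end PC

theorem prod_counting_asymptotics_with_remainder
    {p : ℕ} (hp : 1 ≤ p) (seq : Fin p → ℕ → ℝ)
    (hmono : ∀ j, Monotone (seq j)) (hpos : ∀ j k, 0 < seq j k)
    (htend : ∀ j, Tendsto (seq j) atTop atTop)
    (τ α : ℝ) (hτ : 0 ≤ τ) (hτα : τ < α)
    (ν : ℕ) (hν1 : 1 ≤ ν) (hνp : ν ≤ p)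
    (J : Fin ν → Fin p) (hJ : Function.Injective J)
    (A : Fin ν → ℝ) (hA : ∀ q, 0 < A q)
    (hmain : ∀ q, (fun x => countingFn (seq (J q)) x - A q * x ^ α)
      =O[atTop] fun x => x ^ τ)
    (hrest : ∀ j, j ∉ Set.range J → (countingFn (seq j)) =O[atTop] fun x => x ^ τ) :
    ∃ η : ℝ, η < α ∧ ∃ C : ℕ → ℝ,
      (fun x => prodCountingFn seq x -
          x ^ α * (((∏ q, A q) * ∏ j ∈ Finset.univ \ Finset.image J Finset.univ,
                ∑' k, (seq j k) ^ (-α))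
              * (α * Real.log x) ^ (ν - 1) / (Nat.factorial (ν - 1))
            + ∑ q ∈ Finset.range (ν - 1), C q * Real.log x ^ q))
        =O[atTop] fun x => x ^ η := by
  obtain ⟨n, rfl⟩ : ∃ n, ν = n + 1 := ⟨ν - 1, by omega⟩
  have hα : 0 < α := by linarith
  have hFam : ∀ j, PC.Fam (seq j) := by
    intro j
    refine ⟨hpos j, fun x => ?_⟩
    have h := (htend j).eventually_gt_atTop x
    rw [← Nat.cofinite_eq_atTop, Filter.eventually_cofinite] at h
    simpa using h
  have hM : ∀ q, PC.Asym (seq (J q)) α (Polynomial.C (A q)) := by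
    intro q
    refine ⟨τ, hτ, hτα, (hmain q).congr_left fun x => ?_⟩
    rw [Polynomial.eval_C, mul_comm]
    rfl
  have hS : ∀ j, j ∉ Set.range J → PC.Asym (seq j) α 0 := by
    intro j hj
    refine ⟨τ, hτ, hτα, (hrest j hj).congr_left fun x => ?_⟩
    rw [Polynomial.eval_zero, mul_zero, sub_zero]
    rfl
  classical
  let e : Fin (Fintype.card {j // j ∉ Set.range J}) ≃ {j // j ∉ Set.range J} :=
    (Fintype.equivFin _).symm
  let σ : Fin (Fintype.card {j // j ∉ Set.range J}) ⊕ Fin (n + 1) ≃ Fin p :=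
    (Equiv.sumCongr e (Equiv.ofInjective J hJ)).trans
      ((Equiv.sumComm _ _).trans (Equiv.Set.sumCompl (Set.range J)))
  have σl : ∀ i, σ (Sum.inl i) = (e i : Fin p) := fun i => rfl
  have σr : ∀ q, σ (Sum.inr q) = J q := fun i => rfl
  let E : (Fin p → ℕ) ≃ (Fin (Fintype.card {j // j ∉ Set.range J}) → ℕ) × (Fin (n + 1) → ℕ) :=
    (Equiv.arrowCongr σ.symm (Equiv.refl ℕ)).trans (Equiv.sumArrowEquivProdArrow _ _ _)
  have El : ∀ k i, (E k).1 i = k (e i) := fun k i => rfl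
  have Er : ∀ k q, (E k).2 q = k (J q) := fun k q => rfl
  obtain ⟨s1, s2, s3⟩ := PC.small_prod hα _ (fun i => seq (e i)) (fun i => hFam _)
    (fun i => hS _ (e i).2)
  obtain ⟨m1, Q, m2, m3, m4⟩ := PC.main_prod s1 s2 n (fun q => seq (J q)) A (fun q => hFam _) hM
  obtain ⟨η, h0, h1, h2⟩ := m4.reindex E
  refine ⟨η, h1, fun q => Q.coeff q, h2.congr_left fun x => ?_⟩
  have c1 : PC.cnt (fun k => (fun p : (Fin (Fintype.card {j // j ∉ Set.range J}) → ℕ) ×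
      (Fin (n + 1) → ℕ) => (∏ j, seq (e j) (p.1 j)) * ∏ j, seq (J j) (p.2 j)) (E k)) x =
      prodCountingFn seq x := by
    have : (fun k => (fun p : (Fin (Fintype.card {j // j ∉ Set.range J}) → ℕ) ×
      (Fin (n + 1) → ℕ) => (∏ j, seq (e j) (p.1 j)) * ∏ j, seq (J j) (p.2 j)) (E k)) =
      fun k : Fin p → ℕ => ∏ j, seq j (k j) := by
      funext k
      simp only [El, Er]
      rw [← σ.prod_comp, Fintype.prod_sum_type]
      simp only [σl, σr]
    rw [this]
    rfl
  have c2 : ∏ j ∈ Finset.univ \ Finset.image J Finset.univ, ∑' k, (seq j k) ^ (-α) =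
      ∑' k : Fin (Fintype.card {j // j ∉ Set.range J}) → ℕ, (∏ j, seq (e j) (k j)) ^ (-α) := by
    rw [s3, e.prod_comp (fun j : {j // j ∉ Set.range J} => ∑' k, (seq j k) ^ (-α))]
    refine Finset.prod_subtype _ (fun j => ?_) _
    simp
  rw [c1, c2, Polynomial.eval_eq_sum_range' (n := n + 1) (by omega), Finset.sum_range_succ, m3]
  simp only [Nat.add_sub_cancel]
  rw [mul_pow]
  ring
end

section
/- Let a > 0 and let s > 0 be a real number with s ≠ 1. Then, as λ → ∞, Σ_{0 ≤ k ≤ λ, k ∈ ℤ} (k + a)^{-s} = (λ + a)^{1−s}/(1 − s) + ζ(s; a) + O(λ^{-s}), where ζ(s; a) denotes the value at s of the meromorphic (analytic for s ≠ 1) continuation of the Hurwitz zeta function. -/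
open Filter Asymptotics Real

/-- The classical Hurwitz zeta function `ζ(s; a)` for `a > 0`, as a real number: the value at
real `s` of the meromorphic continuation of `∑_{k ≥ 0} (k + a)^{-s}`. It is expressed through
Mathlib's `HurwitzZeta.hurwitzZeta` (which is periodic in the parameter, so the finitely many
terms with `k + Int.fract a < a` must be subtracted off). -/
noncomputable def hurwitzZetaReal (s a : ℝ) : ℝ :=
  (HurwitzZeta.hurwitzZeta (↑(Int.fract a) : UnitAddCircle) (s : ℂ)).re
    - ∑ k ∈ Finset.range ⌊a⌋₊, ((k : ℝ) + Int.fract a) ^ (-s)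

/-- The complex Euler-Maclaurin remainder term, multiplied by `s - 1`. -/
noncomputable def emTerm (c : ℝ) (s : ℂ) : ℂ :=
  (s - 1) * (c : ℂ) ^ (-s) + ((c + 1 : ℝ) : ℂ) ^ (1 - s) - (c : ℂ) ^ (1 - s)

lemma cpow_sub_bound {c x : ℝ} (hc : 0 < c) (hx : c ≤ x) {w : ℂ} (hw : w.re ≤ 1) :
    ‖(x : ℂ) ^ w - (c : ℂ) ^ w‖ ≤ ‖w‖ * c ^ (w.re - 1) * (x - c) := by
  by_cases h0 : w = 0
  · simp [h0]
  refine norm_image_sub_le_of_norm_deriv_le_segment' (f := fun y : ℝ => (y : ℂ) ^ w)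
    (f' := fun y : ℝ => w * (y : ℂ) ^ (w - 1)) (a := c) (b := x) ?_ ?_ x ⟨hx, le_rfl⟩
  · intro y hy
    exact (hasDerivAt_ofReal_cpow_const (by linarith [hy.1] : y ≠ 0) h0).hasDerivWithinAt
  · intro y hy
    have hy0 : 0 < y := by linarith [hy.1]
    rw [norm_mul, Complex.norm_cpow_eq_rpow_re_of_pos hy0]
    simp only [Complex.sub_re, Complex.one_re]
    refine mul_le_mul_of_nonneg_left ?_ (norm_nonneg w)
    exact Real.rpow_le_rpow_of_nonpos hc hy.1 (by linarith [hw])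

lemma emTerm_bound {c : ℝ} (hc : 0 < c) {s : ℂ} (hs : 0 < s.re) :
    ‖emTerm c s‖ ≤ ‖1 - s‖ * (‖s‖ * c ^ (-s.re - 1)) := by
  by_cases h1 : s = 1
  · simp [emTerm, h1]
  have h0 : 1 - s ≠ 0 := sub_ne_zero.2 (Ne.symm h1)
  have := norm_image_sub_le_of_norm_deriv_le_segment'
    (f := fun y : ℝ => (y : ℂ) ^ (1 - s) - (y : ℂ) * ((1 - s) * (c : ℂ) ^ (-s)))
    (f' := fun y : ℝ => (1 - s) * (y : ℂ) ^ (1 - s - 1) - 1 * ((1 - s) * (c : ℂ) ^ (-s)))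
    (a := c) (b := c + 1) (C := ‖1 - s‖ * (‖s‖ * c ^ (-s.re - 1))) ?_ ?_ (c + 1)
    ⟨by linarith, le_rfl⟩
  · calc ‖emTerm c s‖ = _ := by
          congr 1
          rw [emTerm]
          push_cast
          ring
      _ ≤ _ := this
      _ = _ := by ring
  · intro y hy
    refine HasDerivAt.hasDerivWithinAt ?_
    exact (hasDerivAt_ofReal_cpow_const (by linarith [hy.1] : y ≠ 0) h0).sub
      ((HasDerivAt.ofReal_comp (hasDerivAt_id y)).mul_const _)
  · intro y hy
    have e : (1 - s) * (y : ℂ) ^ (1 - s - 1) - 1 * ((1 - s) * (c : ℂ) ^ (-s))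
        = (1 - s) * ((y : ℂ) ^ (-s) - (c : ℂ) ^ (-s)) := by
      rw [show 1 - s - 1 = -s by ring]; ring
    rw [e, norm_mul]
    gcongr
    have := cpow_sub_bound hc hy.1 (w := -s) (by simp; linarith)
    simp only [norm_neg, Complex.neg_re] at this
    refine this.trans ?_
    have : 0 ≤ ‖s‖ * c ^ (-s.re - 1) := by positivity
    nlinarith [hy.2]

lemma emTerm_real_bound {c : ℝ} (hc : 0 < c) {s : ℝ} (hs : 0 < s) :
    |(s - 1) * c ^ (-s) + (c + 1) ^ (1 - s) - c ^ (1 - s)|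
      ≤ |1 - s| * (c ^ (-s) - (c + 1) ^ (-s)) := by
  have := norm_image_sub_le_of_norm_deriv_le_segment'
    (f := fun y : ℝ => y ^ (1 - s) - y * ((1 - s) * c ^ (-s)))
    (f' := fun y : ℝ => (1 - s) * y ^ (1 - s - 1) - 1 * ((1 - s) * c ^ (-s)))
    (a := c) (b := c + 1) (C := |1 - s| * (c ^ (-s) - (c + 1) ^ (-s))) ?_ ?_ (c + 1)
    ⟨by linarith, le_rfl⟩
  · rw [Real.norm_eq_abs] at this
    calc _ = _ := by
          congr 1
          ring
      _ ≤ _ := this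
      _ = _ := by ring
  · intro y hy
    refine HasDerivAt.hasDerivWithinAt ?_
    exact (Real.hasDerivAt_rpow_const (Or.inl (by linarith [hy.1] : y ≠ 0))).sub
      ((hasDerivAt_id y).mul_const _)
  · intro y hy
    have e : (1 - s) * y ^ (1 - s - 1) - 1 * ((1 - s) * c ^ (-s))
        = (1 - s) * (y ^ (-s) - c ^ (-s)) := by
      rw [show 1 - s - 1 = -s by ring]; ring
    rw [e, norm_mul, Real.norm_eq_abs, Real.norm_eq_abs]
    gcongr
    have h1 := Real.rpow_le_rpow_of_nonpos hc hy.1 (by linarith : -s ≤ 0)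
    have h2 := Real.rpow_le_rpow_of_nonpos (by linarith [hy.1]) hy.2.le (by linarith : -s ≤ 0)
    rw [abs_sub_comm, abs_of_nonneg (by linarith)]
    linarith

lemma sum_emTerm (a : ℝ) (s : ℂ) (N : ℕ) :
    ∑ n ∈ Finset.range N, emTerm (n + a) s
      = (s - 1) * ∑ n ∈ Finset.range N, ((n + a : ℝ) : ℂ) ^ (-s)
        + ((N + a : ℝ) : ℂ) ^ (1 - s) - (a : ℂ) ^ (1 - s) := by
  induction N with
  | zero => simp
  | succ N ih =>
    rw [Finset.sum_range_succ, ih, Finset.sum_range_succ, emTerm,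
      show ((N + 1 : ℕ) : ℝ) + a = N + a + 1 by push_cast; ring]
    ring

lemma emTerm_ofReal {c : ℝ} (hc : 0 < c) (s : ℝ) :
    emTerm c s = (((s - 1) * c ^ (-s) + (c + 1) ^ (1 - s) - c ^ (1 - s) : ℝ) : ℂ) := by
  rw [emTerm]
  push_cast
  rw [Complex.ofReal_cpow hc.le, Complex.ofReal_cpow hc.le, Complex.ofReal_cpow (by linarith)]
  push_cast
  rfl

lemma differentiable_emTerm {c : ℝ} (hc : 0 < c) : Differentiable ℂ (emTerm c) := by
  have h1 : (c : ℂ) ≠ 0 := by exact_mod_cast hc.ne'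
  have h2 : ((c + 1 : ℝ) : ℂ) ≠ 0 := by exact_mod_cast (by linarith : c + 1 ≠ 0)
  intro s
  unfold emTerm
  refine ((((differentiableAt_id).sub_const 1).mul ?_).add ?_).sub ?_
  · exact (differentiableAt_id.neg).const_cpow (Or.inl h1)
  · exact (differentiableAt_id.const_sub 1).const_cpow (Or.inl h2)
  · exact (differentiableAt_id.const_sub 1).const_cpow (Or.inl h1)

/-- Uniform summable bound on a half disc. -/
lemma emTerm_unif {a δ R : ℝ} (ha : 0 < a) (hδ : 0 < δ) :
    ∃ u : ℕ → ℝ, Summable u ∧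
      ∀ (n : ℕ) (s : ℂ), δ < s.re → ‖s‖ < R → ‖emTerm (n + a) s‖ ≤ u n := by
  have hm : 0 < min a 1 := lt_min ha one_pos
  set m := min a 1 with hmdef
  refine ⟨fun n => (1 + R) * (R * (m ^ (-R - 1) * (m ^ (δ + 1) * (1 / |(n : ℝ) + a| ^ (δ + 1))))), ?_, ?_⟩
  · refine (((Summable.mul_left _ ?_).mul_left _).mul_left _).mul_left _
    exact (Real.summable_one_div_nat_add_rpow a (δ + 1)).2 (by linarith)
  · intro n s h1 h2
    have hc : 0 < (n : ℝ) + a := by positivity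
    have hs0 : ‖1 - s‖ ≤ 1 + R := by
      have := norm_sub_le (1 : ℂ) s
      rw [norm_one] at this
      linarith
    have hR : 0 < R := (norm_nonneg s).trans_lt h2
    have hre : s.re ≤ R := (Complex.re_le_norm s).trans h2.le
    refine (emTerm_bound hc (hδ.trans h1)).trans ?_
    have hmc : m ≤ (n : ℝ) + a := (min_le_left a 1).trans (by simp)
    have hq : 1 ≤ ((n : ℝ) + a) / m := (one_le_div hm).2 hmc
    have key : ((n : ℝ) + a) ^ (-s.re - 1)
        ≤ m ^ (-R - 1) * (m ^ (δ + 1) * (1 / |(n : ℝ) + a| ^ (δ + 1))) := by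
      have e1 : ((n : ℝ) + a) ^ (-s.re - 1)
          = m ^ (-s.re - 1) * (((n : ℝ) + a) / m) ^ (-s.re - 1) := by
        rw [← Real.mul_rpow hm.le (by positivity), mul_div_cancel₀ _ hm.ne']
      have e2 : m ^ (δ + 1) * (1 / |(n : ℝ) + a| ^ (δ + 1))
          = (((n : ℝ) + a) / m) ^ (-δ - 1) := by
        rw [abs_of_pos hc, show -δ - 1 = -(δ + 1) by ring, Real.rpow_neg (by positivity),
          Real.div_rpow hc.le hm.le]
        field_simp
      rw [e1, e2]
      gcongr ?_ * ?_
      · exact Real.rpow_le_rpow_of_exponent_ge hm (min_le_right a 1) (by linarith)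
      · exact Real.rpow_le_rpow_of_exponent_le hq (by linarith)
    exact mul_le_mul hs0 (mul_le_mul h2.le key (by positivity) hR.le) (by positivity)
      (by linarith)

lemma differentiable_aux (x : UnitAddCircle) :
    ∃ H : ℂ → ℂ, Differentiable ℂ H ∧
      ∀ s, s ≠ 1 → H s = (s - 1) * HurwitzZeta.hurwitzZeta x s := by
  refine ⟨fun s => (s - 1) * (HurwitzZeta.hurwitzZeta x s - 1 / (s - 1) / Complex.Gammaℝ s)
    + (Complex.Gammaℝ s)⁻¹, ?_, ?_⟩
  · intro s
    refine (((differentiableAt_id).sub_const 1).mul ?_).add (Complex.differentiable_Gammaℝ_inv s)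
    by_cases h : s = 1
    · rw [h]; exact HurwitzZeta.differentiableAt_hurwitzZeta_sub_one_div x
    · refine (HurwitzZeta.differentiableAt_hurwitzZeta x h).sub ?_
      simp only [div_eq_mul_inv]
      refine DifferentiableAt.mul ?_ (Complex.differentiable_Gammaℝ_inv s)
      refine (differentiableAt_const _).mul (((differentiableAt_id).sub_const 1).inv ?_)
      exact sub_ne_zero.2 h
  · intro s h
    have : s - 1 ≠ 0 := sub_ne_zero.2 h
    simp only []
    rw [mul_sub, div_eq_mul_inv, ← mul_assoc, mul_one_div_cancel this]
    ring

/-- Dirichlet series of the shifted zeta function in the convergence range. -/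
lemma hasSum_shift {a : ℝ} (ha : 0 < a) {s : ℂ} (hs : 1 < s.re) :
    HasSum (fun n : ℕ => ((n + a : ℝ) : ℂ) ^ (-s))
      (HurwitzZeta.hurwitzZeta (↑(Int.fract a) : UnitAddCircle) s
        - ∑ k ∈ Finset.range ⌊a⌋₊, ((k + Int.fract a : ℝ) : ℂ) ^ (-s)) := by
  have h := HurwitzZeta.hasSum_hurwitzZeta_of_one_lt_re (a := Int.fract a)
    ⟨Int.fract_nonneg a, (Int.fract_lt_one a).le⟩ hs
  have h' : HasSum (fun n : ℕ => ((n + Int.fract a : ℝ) : ℂ) ^ (-s))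
      (HurwitzZeta.hurwitzZeta (↑(Int.fract a) : UnitAddCircle) s) := by
    convert h using 2 with n
    rw [Complex.cpow_neg, one_div]
    push_cast
    rfl
  have := (hasSum_nat_add_iff (f := fun n : ℕ => ((n + Int.fract a : ℝ) : ℂ) ^ (-s))
    (g := HurwitzZeta.hurwitzZeta (↑(Int.fract a) : UnitAddCircle) s
        - ∑ k ∈ Finset.range ⌊a⌋₊, ((k + Int.fract a : ℝ) : ℂ) ^ (-s)) ⌊a⌋₊).2
    (by rw [sub_add_cancel]; exact h')
  have e : ∀ n : ℕ, ((n + ⌊a⌋₊ : ℕ) : ℝ) + Int.fract a = n + a := by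
    intro n
    push_cast
    rw [natCast_floor_eq_intCast_floor ha.le, add_assoc, Int.floor_add_fract]
  simpa only [e] using this

lemma hasSum_emTerm {a s : ℝ} (ha : 0 < a) (hs : 0 < s) (hs1 : s ≠ 1) :
    HasSum (fun n : ℕ => emTerm (n + a) s)
      (((s : ℂ) - 1) * (HurwitzZeta.hurwitzZeta (↑(Int.fract a) : UnitAddCircle) s
        - ∑ k ∈ Finset.range ⌊a⌋₊, ((k + Int.fract a : ℝ) : ℂ) ^ (-(s : ℂ)))
        - (a : ℂ) ^ (1 - (s : ℂ))) := by
  obtain ⟨H, hH, hHe⟩ := differentiable_aux (↑(Int.fract a) : UnitAddCircle)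
  obtain ⟨u, hu, hub⟩ := emTerm_unif (a := a) (δ := s / 2) (R := s + 3) ha (by linarith)
  set U : Set ℂ := {z | s / 2 < z.re} ∩ Metric.ball 0 (s + 3) with hU
  have hUo : IsOpen U := (isOpen_lt continuous_const Complex.continuous_re).inter Metric.isOpen_ball
  have hUc : Convex ℝ U := (convex_halfSpace_re_gt _).inter (convex_ball _ _)
  have hb : ∀ (n : ℕ) (z : ℂ), z ∈ U → ‖emTerm (n + a) z‖ ≤ u n := fun n z hz =>
    hub n z hz.1 (by simpa using hz.2)
  have hsum : ∀ z ∈ U, Summable (fun n : ℕ => emTerm (n + a) z) := fun z hz =>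
    Summable.of_norm_bounded hu (fun n => hb n z hz)
  have hG : DifferentiableOn ℂ (fun z => ∑' n : ℕ, emTerm (n + a) z) U :=
    Complex.differentiableOn_tsum_of_summable_norm hu
      (fun n => (differentiable_emTerm (by positivity)).differentiableOn) hUo hb
  have hF : DifferentiableOn ℂ (fun z => H z - (z - 1) *
      ∑ k ∈ Finset.range ⌊a⌋₊, ((k + Int.fract a : ℝ) : ℂ) ^ (-z) - (a : ℂ) ^ (1 - z)) U := by
    intro z hz
    have hz0 : z ≠ 0 := by
      rintro rfl
      have := hz.1
      simp only [Set.mem_ofPred_eq, Complex.zero_re] at this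
      linarith
    refine DifferentiableAt.differentiableWithinAt ?_
    refine ((hH z).sub (((differentiableAt_id).sub_const 1).mul ?_)).sub ?_
    · refine DifferentiableAt.fun_sum fun k _ => ?_
      exact (differentiableAt_id.neg).const_cpow (Or.inr (by simpa using hz0))
    · exact (differentiableAt_id.const_sub 1).const_cpow (Or.inl (by exact_mod_cast ha.ne'))
  have hpt : ((s + 2 : ℝ) : ℂ) ∈ U := by
    refine ⟨?_, ?_⟩
    · simp only [Set.mem_ofPred_eq, Complex.ofReal_re]; linarith
    · rw [mem_ball_zero_iff, Complex.norm_real, Real.norm_eq_abs, abs_of_pos (by linarith)]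
      linarith
  have hsU : (s : ℂ) ∈ U := by
    refine ⟨?_, ?_⟩
    · simp only [Set.mem_ofPred_eq, Complex.ofReal_re]; linarith
    · rw [mem_ball_zero_iff, Complex.norm_real, Real.norm_eq_abs, abs_of_pos (by linarith)]
      linarith
  have hev : (fun z => ∑' n : ℕ, emTerm (n + a) z) =ᶠ[nhds ((s + 2 : ℝ) : ℂ)]
      (fun z => H z - (z - 1) *
      ∑ k ∈ Finset.range ⌊a⌋₊, ((k + Int.fract a : ℝ) : ℂ) ^ (-z) - (a : ℂ) ^ (1 - z)) := by
    have hop : IsOpen {z : ℂ | 1 < z.re} := isOpen_lt continuous_const Complex.continuous_re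
    have hmem : ((s + 2 : ℝ) : ℂ) ∈ {z : ℂ | 1 < z.re} := by
      simp only [Set.mem_ofPred_eq, Complex.ofReal_re]; linarith
    filter_upwards [hUo.mem_nhds hpt, hop.mem_nhds hmem] with z hzU hz1
    have hz1' : 1 < z.re := hz1
    have hzne : z ≠ 1 := by
      rintro rfl
      simp at hz1'
    have t1 := (hsum z hzU).hasSum.tendsto_sum_nat
    have t2 := (hasSum_shift ha hz1').tendsto_sum_nat
    have t3 : Tendsto (fun N : ℕ => ((N + a : ℝ) : ℂ) ^ (1 - z)) atTop (nhds 0) := by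
      rw [tendsto_zero_iff_norm_tendsto_zero]
      have q : Tendsto (fun N : ℕ => ((N : ℝ) + a)) atTop atTop :=
        tendsto_atTop_add_const_right _ _ tendsto_natCast_atTop_atTop
      have := (tendsto_rpow_neg_atTop (by linarith : 0 < z.re - 1)).comp q
      refine this.congr fun N => ?_
      rw [Complex.norm_cpow_eq_rpow_re_of_pos (by positivity)]
      simp
    have t4 := ((t2.const_mul (z - 1)).add t3).sub_const ((a : ℂ) ^ (1 - z))
    have := tendsto_nhds_unique t1 (t4.congr fun N => (sum_emTerm a z N).symm)
    rw [this, hHe z hzne]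
    ring
  have := (hG.analyticOnNhd hUo).eqOn_of_preconnected_of_eventuallyEq (hF.analyticOnNhd hUo)
    hUc.isPreconnected hpt hev hsU
  have hs1' : (s : ℂ) ≠ 1 := by exact_mod_cast hs1
  have h := (hsum s hsU).hasSum
  simp only at this
  rw [this, hHe _ hs1'] at h
  convert h using 1
  ring

lemma tail_bound {a s : ℝ} (ha : 0 < a) (hs : 0 < s) (hs1 : s ≠ 1) (N : ℕ) :
    |(∑ k ∈ Finset.range N, ((k : ℝ) + a) ^ (-s)) - ((N + a) ^ (1 - s) / (1 - s)
      + hurwitzZetaReal s a)| ≤ (N + a) ^ (-s) := by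
  set e : ℕ → ℝ := fun k => (s - 1) * ((k : ℝ) + a) ^ (-s) + ((k : ℝ) + a + 1) ^ (1 - s)
    - ((k : ℝ) + a) ^ (1 - s) with he
  have hS : HasSum e ((s - 1) * hurwitzZetaReal s a - a ^ (1 - s)) := by
    have h := Complex.hasSum_re (hasSum_emTerm ha hs hs1)
    convert h using 1
    · funext n
      rw [emTerm_ofReal (by positivity), Complex.ofReal_re]
    · have e1 : (a : ℂ) ^ (1 - (s : ℂ)) = ((a ^ (1 - s) : ℝ) : ℂ) := by
        rw [Complex.ofReal_cpow ha.le]; push_cast; rfl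
      have e2 : ∀ k : ℕ, ((k + Int.fract a : ℝ) : ℂ) ^ (-(s : ℂ))
          = ((((k : ℝ) + Int.fract a) ^ (-s) : ℝ) : ℂ) := by
        intro k
        rw [Complex.ofReal_cpow (add_nonneg k.cast_nonneg (Int.fract_nonneg a))]
        push_cast; rfl
      simp only [e1, e2]
      rw [← Complex.ofReal_sum, ← Complex.ofReal_one, ← Complex.ofReal_sub, Complex.sub_re,
        Complex.re_ofReal_mul, Complex.sub_re, Complex.ofReal_re, Complex.ofReal_re,
        hurwitzZetaReal]
  have hpart : ∀ M : ℕ, ∑ k ∈ Finset.range M, e k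
      = (s - 1) * ∑ k ∈ Finset.range M, ((k : ℝ) + a) ^ (-s) + (M + a) ^ (1 - s) - a ^ (1 - s) := by
    intro M
    induction M with
    | zero => simp
    | succ M ih =>
      rw [Finset.sum_range_succ, ih, Finset.sum_range_succ, he,
        show ((M + 1 : ℕ) : ℝ) + a = M + a + 1 by push_cast; ring]
      ring
  have hdiff : ∀ j : ℕ, |∑ k ∈ Finset.range (N + j), e k - ∑ k ∈ Finset.range N, e k|
      ≤ |1 - s| * ((N + a) ^ (-s) - (N + j + a) ^ (-s)) := by
    intro j
    induction j with
    | zero => simp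
    | succ j ih =>
      rw [← add_assoc, Finset.sum_range_succ, add_sub_right_comm]
      refine (abs_add_le _ _).trans ?_
      have := emTerm_real_bound (c := ((N + j : ℕ) : ℝ) + a) (by positivity) hs
      have h2 : |e (N + j)| ≤ |1 - s| * ((N + j + a) ^ (-s) - (N + (j + 1 : ℕ) + a) ^ (-s)) := by
        rw [he]
        convert this using 4
        · push_cast; ring
        · push_cast; ring
      linarith
  have hlim : |((s - 1) * hurwitzZetaReal s a - a ^ (1 - s)) - ∑ k ∈ Finset.range N, e k|
      ≤ |1 - s| * (N + a) ^ (-s) := by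
    have t := (hS.tendsto_sum_nat.comp (tendsto_add_atTop_nat N)).sub_const
      (∑ k ∈ Finset.range N, e k)
    refine le_of_tendsto t.abs (Eventually.of_forall fun j => ?_)
    have h1 := hdiff j
    simp only [Function.comp_apply]
    rw [add_comm j N]
    refine h1.trans ?_
    have : 0 ≤ ((N : ℝ) + j + a) ^ (-s) := by positivity
    gcongr
    linarith
  have h1s : 1 - s ≠ 0 := sub_ne_zero.2 hs1.symm
  rw [hpart] at hlim
  have hp : 0 < |1 - s| := abs_pos.2 h1s
  refine le_of_mul_le_mul_left ?_ hp
  rw [← abs_mul]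
  refine le_trans (le_of_eq (congrArg _ ?_)) hlim
  rw [mul_sub, mul_add, mul_div_cancel₀ _ h1s]
  ring

theorem partial_sum_hurwitz_asymptotics (a s : ℝ) (ha : 0 < a) (hs : 0 < s) (hs1 : s ≠ 1) :
    (fun lam : ℝ =>
        (∑ k ∈ Finset.range (⌊lam⌋₊ + 1), ((k : ℝ) + a) ^ (-s))
          - ((lam + a) ^ (1 - s) / (1 - s) + hurwitzZetaReal s a))
      =O[atTop] fun lam => lam ^ (-s) := by
  refine IsBigO.of_bound 2 ?_
  filter_upwards [eventually_gt_atTop 0] with x hx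
  have h1s : 1 - s ≠ 0 := sub_ne_zero.2 hs1.symm
  have hN1 : x < ((⌊x⌋₊ + 1 : ℕ) : ℝ) := by push_cast; exact Nat.lt_floor_add_one x
  have hN2 : ((⌊x⌋₊ + 1 : ℕ) : ℝ) ≤ x + 1 := by
    push_cast
    linarith [Nat.floor_le hx.le]
  have ht := tail_bound ha hs hs1 (⌊x⌋₊ + 1)
  set N := ⌊x⌋₊ + 1
  have hm := norm_image_sub_le_of_norm_deriv_le_segment'
    (f := fun y : ℝ => y ^ (1 - s) / (1 - s))
    (f' := fun y : ℝ => (1 - s) * y ^ (1 - s - 1) / (1 - s))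
    (a := x + a) (b := N + a) (C := x ^ (-s)) ?_ ?_ (N + a)
    ⟨by linarith, le_rfl⟩
  · have hb : ((N : ℝ) + a) ^ (-s) ≤ x ^ (-s) :=
      Real.rpow_le_rpow_of_nonpos hx (by linarith) (by linarith)
    have hp : 0 < x ^ (-s) := Real.rpow_pos_of_pos hx _
    have hm' : |((N : ℝ) + a) ^ (1 - s) / (1 - s) - (x + a) ^ (1 - s) / (1 - s)| ≤ x ^ (-s) := by
      refine hm.trans ?_
      nlinarith
    rw [Real.norm_eq_abs, Real.norm_eq_abs, abs_of_pos hp]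
    rw [abs_le] at *
    constructor <;> linarith [ht.1, ht.2, hm'.1, hm'.2]
  · intro y hy
    exact ((Real.hasDerivAt_rpow_const (Or.inl (by linarith [hy.1] : y ≠ 0))).div_const
      _).hasDerivWithinAt
  · intro y hy
    have hy0 : 0 < y := by linarith [hy.1]
    rw [mul_div_cancel_left₀ _ h1s, show 1 - s - 1 = -s by ring, Real.norm_eq_abs,
      abs_of_pos (Real.rpow_pos_of_pos hy0 _)]
    exact Real.rpow_le_rpow_of_nonpos hx (by linarith [hy.1]) (by linarith)
end
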